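/- Let λ > 0, D ⊂ ℝⁿ a bounded C¹ domain (Lipschitz if n = 2,3) with ℝⁿ \ D̄ connected, and assume λ² is not a Dirichlet eigenvalue of −Δ in D. Then there exists a real-valued function u₀ : ℝⁿ → ℝ with Δu₀ + λ²u₀ = 0 in ℝⁿ and u₀ > 0 on ∂D. -/

import Mathlib

open Metric Set Filter
open scoped RealInnerProductSpace Topology

noncomputable section

/-- The Laplacian of a real-valued function on Euclidean space. -/
def lap {n : ℕ} (u : EuclideanSpace ℝ (Fin n) → ℝ) (x : EuclideanSpace ℝ (Fin n)) : ℝ :=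
  ∑ i : Fin n, fderiv ℝ (fun y => fderiv ℝ u y (EuclideanSpace.single i 1)) x
    (EuclideanSpace.single i 1)

/-- `D` is a Lipschitz domain: locally the region above the graph of a Lipschitz function. -/
def IsLipschitzDomain {n : ℕ} (D : Set (EuclideanSpace ℝ (Fin n))) : Prop :=
  ∀ x₀ ∈ frontier D, ∃ (e : EuclideanSpace ℝ (Fin n)) (L : NNReal)
    (φ : EuclideanSpace ℝ (Fin n) → ℝ) (ρ : ℝ), ‖e‖ = 1 ∧ 0 < ρ ∧ LipschitzWith L φ ∧
    ∀ x ∈ ball x₀ ρ, (x ∈ D ↔ φ (x - ⟪x, e⟫ • e) < ⟪x, e⟫)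

/-- `D` is a `C¹` domain: locally the region above the graph of a `C¹` function. -/
def IsC1Domain {n : ℕ} (D : Set (EuclideanSpace ℝ (Fin n))) : Prop :=
  ∀ x₀ ∈ frontier D, ∃ (e : EuclideanSpace ℝ (Fin n))
    (φ : EuclideanSpace ℝ (Fin n) → ℝ) (ρ : ℝ), ‖e‖ = 1 ∧ 0 < ρ ∧ ContDiff ℝ 1 φ ∧
    ∀ x ∈ ball x₀ ρ, (x ∈ D ↔ φ (x - ⟪x, e⟫ • e) < ⟪x, e⟫)

/-- `λ²` is not a Dirichlet eigenvalue of `−Δ` in `D`. -/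
def NotDirichletEigenvalue {n : ℕ} (lam : ℝ) (D : Set (EuclideanSpace ℝ (Fin n))) : Prop :=
  ¬ ∃ w : EuclideanSpace ℝ (Fin n) → ℝ, (∃ x ∈ D, w x ≠ 0) ∧ ContDiffOn ℝ 2 w D ∧
    (∀ x ∈ frontier D, Tendsto w (𝓝[D] x) (𝓝 0)) ∧
    ∀ x ∈ D, lap w x + lam ^ 2 * w x = 0

section
open Metric Set Filter MeasureTheory
open scoped RealInnerProductSpace Topology

noncomputable section

/-- exponential generating function -/
def egf (c : ℕ → ℝ) (x : ℝ) : ℝ := ∑' k, c k * (x ^ k / k.factorial)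

def EB (c : ℕ → ℝ) (C A : ℝ) : Prop := ∀ k, |c k| ≤ C * A ^ k

lemma EB.summable_abs {c : ℕ → ℝ} {C A : ℝ} (h : EB c C A) (x : ℝ) :
    Summable (fun k => |c k * (x ^ k / k.factorial)|) := by
  refine Summable.of_nonneg_of_le (fun _ => abs_nonneg _) (fun k => ?_)
    ((Real.summable_pow_div_factorial (A * |x|)).mul_left C)
  rw [abs_mul, abs_div, abs_pow, Nat.abs_cast]
  calc |c k| * (|x| ^ k / k.factorial) ≤ C * A ^ k * (|x| ^ k / k.factorial) := by
        gcongr; exact h k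
    _ = C * ((A * |x|) ^ k / k.factorial) := by rw [mul_pow]; ring

lemma EB.summable {c : ℕ → ℝ} {C A : ℝ} (h : EB c C A) (x : ℝ) :
    Summable (fun k => c k * (x ^ k / k.factorial)) := (h.summable_abs x).of_abs

lemma EB.hasSum {c : ℕ → ℝ} {C A : ℝ} (h : EB c C A) (x : ℝ) :
    HasSum (fun k => c k * (x ^ k / k.factorial)) (egf c x) := (h.summable x).hasSum

lemma EB.abs_egf_le {c : ℕ → ℝ} {C A : ℝ} (h : EB c C A) (x : ℝ) :
    |egf c x| ≤ C * Real.exp (A * |x|) := by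
  have h1 : HasSum (fun k : ℕ => C * ((A * |x|) ^ k / k.factorial)) (C * Real.exp (A * |x|)) := by
    rw [Real.exp_eq_exp_ℝ]
    exact (NormedSpace.expSeries_div_hasSum_exp (A * |x|)).mul_left C
  have := h.summable x
  unfold egf
  rw [← Real.norm_eq_abs]
  refine tsum_of_norm_bounded h1 (fun k => ?_)
  rw [Real.norm_eq_abs, abs_mul, abs_div, abs_pow, Nat.abs_cast]
  calc |c k| * (|x| ^ k / k.factorial) ≤ C * A ^ k * (|x| ^ k / k.factorial) := by
        gcongr; exact h k
    _ = C * ((A * |x|) ^ k / k.factorial) := by rw [mul_pow]; ring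

lemma EB.shift {c : ℕ → ℝ} {C A : ℝ} (h : EB c C A) (m : ℕ) :
    EB (fun k => c (k + m)) (C * A ^ m) A := fun k => by
  have := h (k + m)
  rw [pow_add] at this
  linarith [this]

lemma EB.hasDerivAt {c : ℕ → ℝ} {C A : ℝ} (hA : 0 ≤ A) (h : EB c C A) (x : ℝ) :
    HasDerivAt (egf c) (egf (fun k => c (k + 1)) x) x := by
  have hC : 0 ≤ C := by have := (abs_nonneg _).trans (h 0); simpa using this
  set R := |x| + 1
  have key : HasDerivAt (fun z => ∑' k, c k * (z ^ k / k.factorial))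
      (∑' k, c k * (((k:ℕ) : ℝ) * x ^ (k - 1) / k.factorial)) x := by
    refine hasDerivAt_tsum_of_isPreconnected (u := fun k : ℕ => C * (k * (A ^ k * R ^ (k-1)) / k.factorial))
      (t := Metric.ball 0 R) (y₀ := 0) (g := fun k z => c k * (z ^ k / k.factorial))
      (g' := fun k z => c k * ((k:ℝ) * z ^ (k - 1) / k.factorial)) ?_ Metric.isOpen_ball
      (convex_ball _ _).isPreconnected (fun k y _ => ?_) (fun k y hy => ?_) ?_ ?_ ?_
    · rw [← summable_nat_add_iff 1]
      refine (((Real.summable_pow_div_factorial (A * R)).mul_left (C * A))).congr (fun k => ?_)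
      rw [Nat.factorial_succ]; push_cast
      have : (k.factorial : ℝ) ≠ 0 := by positivity
      try simp only [Nat.add_sub_cancel]
      field_simp
      simp only [Nat.add_sub_cancel, mul_pow, pow_succ]; ring
    · exact ((hasDerivAt_pow k y).div_const _).const_mul _
    · have hy' : |y| ≤ R := by
        have := Metric.mem_ball.1 hy; rw [Real.dist_eq, sub_zero] at this; exact this.le
      rw [Real.norm_eq_abs, abs_mul, abs_div, abs_mul, abs_pow, Nat.abs_cast, Nat.abs_cast]
      calc |c k| * (k * |y| ^ (k-1) / k.factorial) ≤ C * A ^ k * (k * R ^ (k-1) / k.factorial) := by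
            gcongr; exact h k
        _ = _ := by ring
    · simp only [Metric.mem_ball, dist_self]; positivity
    · exact h.summable 0
    · simp only [Metric.mem_ball, dist_zero_right, Real.norm_eq_abs]; exact lt_add_one _
  have hs : Summable (fun k : ℕ => c k * (((k:ℕ) : ℝ) * x ^ (k - 1) / k.factorial)) := by
    rw [← summable_nat_add_iff 1]
    refine ((h.shift 1).summable x).congr (fun k => ?_)
    rw [Nat.factorial_succ]; push_cast
    have : (k.factorial : ℝ) ≠ 0 := by positivity
    try simp only [Nat.add_sub_cancel]
    field_simp
  have e : ∑' k, c k * (((k:ℕ) : ℝ) * x ^ (k - 1) / k.factorial) = egf (fun k => c (k + 1)) x := by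
   rw [hs.tsum_eq_zero_add]
   simp only [Nat.cast_zero, zero_mul, zero_div, mul_zero, zero_add]
   refine tsum_congr (fun k => ?_)
   rw [Nat.factorial_succ]; push_cast
   have : (k.factorial : ℝ) ≠ 0 := by positivity
   try simp only [Nat.add_sub_cancel]
   field_simp
  rw [← e]; exact key

lemma EB.contDiff_nat (m : ℕ) : ∀ {c : ℕ → ℝ} {C A : ℝ} (_ : 0 ≤ A) (_ : EB c C A),
    ContDiff ℝ m (egf c) := by
  induction m with
  | zero =>
    intro c C A hA h
    exact contDiff_zero.2 (continuous_iff_continuousAt.2 fun x => (h.hasDerivAt hA x).continuousAt)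
  | succ m ih =>
    intro c C A hA h
    have : ((m + 1 : ℕ) : WithTop ℕ∞) = (m : WithTop ℕ∞) + 1 := by push_cast; rfl
    rw [this, contDiff_succ_iff_deriv]
    refine ⟨fun x => (h.hasDerivAt hA x).differentiableAt, by simp, ?_⟩
    have : deriv (egf c) = egf (fun k => c (k + 1)) := funext fun x => (h.hasDerivAt hA x).deriv
    rw [this]
    exact ih hA (h.shift 1)

lemma EB.contDiff {c : ℕ → ℝ} {C A : ℝ} (hA : 0 ≤ A) (h : EB c C A) :
    ContDiff ℝ (⊤ : ℕ∞) (egf c) := contDiff_infty.2 fun m => EB.contDiff_nat m hA h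

lemma _root_.HasSum.congr_fun' {ι : Type*} {f g : ι → ℝ} {a : ℝ} (h : HasSum f a)
    (e : ∀ i, g i = f i) : HasSum g a := by
  rwa [funext e]

lemma EB.mul_shift {c : ℕ → ℝ} {C A : ℝ} (h : EB c C A) (x : ℝ) :
    HasSum (fun k : ℕ => (k * c (k + 1)) * (x ^ k / k.factorial))
      (x * egf (fun k => c (k + 2)) x) := by
  have h1 := ((h.shift 2).hasSum x).mul_left x
  rw [← hasSum_nat_add_iff' 1]
  simp only [Finset.range_one, Finset.sum_singleton, Nat.cast_zero, zero_mul, sub_zero]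
  refine h1.congr_fun' fun k => ?_
  rw [Nat.factorial_succ, pow_succ]; push_cast
  have : (k.factorial : ℝ) ≠ 0 := by positivity
  field_simp

/-- the ODE for egfs -/
lemma EB.ode {c : ℕ → ℝ} {C A : ℝ} (h : EB c C A) (B l x : ℝ) :
    HasSum (fun k : ℕ => ((4 * k + B) * c (k + 1) + l * c k) * (x ^ k / k.factorial))
      (4 * x * egf (fun k => c (k + 2)) x + B * egf (fun k => c (k + 1)) x + l * egf c x) := by
  have h1 := (h.mul_shift x).mul_left 4
  have h2 := ((h.shift 1).hasSum x).mul_left B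
  have h3 := (h.hasSum x).mul_left l
  have h4 := (h1.add h2).add h3
  rw [← mul_assoc] at h4
  exact h4.congr_fun' fun k => by ring

/-- addition theorem -/
lemma egf_add {c : ℕ → ℝ} {x y : ℝ}
    (hs : Summable (fun k => |c k| * ((|x| + |y|) ^ k / k.factorial))) :
    HasSum (fun p : ℕ × ℕ => c (p.1 + p.2) * (x ^ p.1 / p.1.factorial) * (y ^ p.2 / p.2.factorial))
      (egf c (x + y)) ∧
    Summable (fun p : ℕ × ℕ => |c (p.1 + p.2) * (x ^ p.1 / p.1.factorial) * (y ^ p.2 / p.2.factorial)|) := by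
  have bin : ∀ (a b : ℝ) (m : ℕ), ∑ p ∈ Finset.HasAntidiagonal.antidiagonal m,
      (a ^ p.1 / p.1.factorial) * (b ^ p.2 / p.2.factorial) = (a + b) ^ m / m.factorial := by
    intro a b m
    rw [Commute.add_pow' (Commute.all a b), Finset.sum_div]
    refine Finset.sum_congr rfl fun p hp => ?_
    rw [Finset.HasAntidiagonal.mem_antidiagonal] at hp
    subst hp
    rw [nsmul_eq_mul, Nat.choose_symm_add, Nat.add_choose, Nat.cast_div (Nat.factorial_mul_factorial_dvd_factorial_add _ _)
      (by positivity)]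
    push_cast
    field_simp
  have habs : Summable (fun p : ℕ × ℕ => |c (p.1 + p.2) * (x ^ p.1 / p.1.factorial) * (y ^ p.2 / p.2.factorial)|) := by
    rw [← Finset.HasAntidiagonal.sigmaAntidiagonalEquivProd.summable_iff]
    refine (summable_sigma_of_nonneg (fun _ => abs_nonneg _)).2 ⟨fun m => (hasSum_fintype _).summable, ?_⟩
    refine hs.congr fun m => ?_
    rw [tsum_fintype, ← bin, Finset.mul_sum, ← Finset.sum_coe_sort]
    refine Finset.sum_congr rfl fun p _ => ?_
    have hp := Finset.HasAntidiagonal.mem_antidiagonal.1 p.2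
    simp only [Function.comp, Finset.HasAntidiagonal.sigmaAntidiagonalEquivProd_apply]
    rw [hp, abs_mul, abs_mul, abs_div, abs_div, abs_pow, abs_pow, Nat.abs_cast, Nat.abs_cast]
    ring
  refine ⟨?_, habs⟩
  have h1 := habs.of_abs
  have h2 := h1.hasSum
  suffices hh : egf c (x + y) = ∑' b : ℕ × ℕ, c (b.1 + b.2) * (x ^ b.1 / b.1.factorial) * (y ^ b.2 / b.2.factorial) by
    rw [hh]; exact h2
  rw [← Finset.HasAntidiagonal.sigmaAntidiagonalEquivProd.tsum_eq]
  refine Eq.trans ?_ (Summable.tsum_sigma'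
    (fun m => (hasSum_fintype _).summable) (Finset.HasAntidiagonal.sigmaAntidiagonalEquivProd.summable_iff.2 h1)).symm
  unfold egf
  refine tsum_congr fun m => ?_
  rw [tsum_fintype, ← bin, Finset.mul_sum, ← Finset.sum_coe_sort]
  refine Finset.sum_congr rfl fun p _ => ?_
  have hp := Finset.HasAntidiagonal.mem_antidiagonal.1 p.2
  simp only [Function.comp, Finset.HasAntidiagonal.sigmaAntidiagonalEquivProd_apply]
  rw [hp]
  ring

end

end

section
open Metric Set Filter MeasureTheory
open scoped RealInnerProductSpace Topology

noncomputable section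

abbrev EE (n : ℕ) := EuclideanSpace ℝ (Fin n)

/-- partial derivative -/
def pd {n : ℕ} (i : Fin n) (f : EE n → ℝ) (x : EE n) : ℝ :=
  fderiv ℝ f x (EuclideanSpace.single i 1)

lemma lap_eq {n : ℕ} (u : EE n → ℝ) (x : EE n) : lap u x = ∑ i, pd i (pd i u) x := rfl

lemma pd_congr {n : ℕ} {i : Fin n} {f g : EE n → ℝ} {x : EE n} (h : f =ᶠ[𝓝 x] g) :
    pd i f =ᶠ[𝓝 x] pd i g := by
  filter_upwards [h.fderiv (𝕜 := ℝ)] with y hy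
  simp only [pd, hy]

lemma lap_congr {n : ℕ} {f g : EE n → ℝ} {x : EE n} (h : f =ᶠ[𝓝 x] g) :
    lap f x = lap g x := by
  simp only [lap_eq]
  exact Finset.sum_congr rfl fun i _ => (pd_congr (pd_congr h)).eq_of_nhds

lemma pd_contDiff {n : ℕ} {i : Fin n} {f : EE n → ℝ} {m m' : WithTop ℕ∞} (h : ContDiff ℝ m f)
    (hm : m' + 1 ≤ m) : ContDiff ℝ m' (pd i f) :=
  (h.fderiv_right hm).clm_apply contDiff_const

lemma pd_mul {n : ℕ} {i : Fin n} {f g : EE n → ℝ} (hf : Differentiable ℝ f)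
    (hg : Differentiable ℝ g) :
    pd i (fun x => f x * g x) = fun x => f x * pd i g x + g x * pd i f x := by
  ext x
  simp only [pd]
  rw [fderiv_fun_mul (hf x) (hg x)]
  simp

lemma pd_add {n : ℕ} {i : Fin n} {f g : EE n → ℝ} (hf : Differentiable ℝ f)
    (hg : Differentiable ℝ g) :
    pd i (fun x => f x + g x) = fun x => pd i f x + pd i g x := by
  ext x
  simp only [pd]
  rw [fderiv_fun_add (hf x) (hg x)]
  simp

lemma pd_const_mul {n : ℕ} {i : Fin n} {f : EE n → ℝ} (c : ℝ) (hf : Differentiable ℝ f) :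
    pd i (fun x => c * f x) = fun x => c * pd i f x := by
  ext x
  simp only [pd]
  rw [fderiv_const_mul (hf x)]
  simp

lemma cd2_diff {n : ℕ} {f : EE n → ℝ} (hf : ContDiff ℝ 2 f) : Differentiable ℝ f :=
  hf.differentiable (by norm_num)

lemma cd2_pd {n : ℕ} {f : EE n → ℝ} (hf : ContDiff ℝ 2 f) (i : Fin n) : Differentiable ℝ (pd i f) :=
  (pd_contDiff (m' := 1) hf (by norm_num)).differentiable (by norm_num)

lemma lap_mul {n : ℕ} {f g : EE n → ℝ} (hf : ContDiff ℝ 2 f) (hg : ContDiff ℝ 2 g) (x : EE n) :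
    lap (fun x => f x * g x) x = f x * lap g x + 2 * ∑ i, pd i f x * pd i g x + g x * lap f x := by
  simp only [lap_eq]
  have : ∀ i, pd i (pd i (fun x => f x * g x)) x =
      f x * pd i (pd i g) x + 2 * (pd i f x * pd i g x) + g x * pd i (pd i f) x := by
    intro i
    have d1 : Differentiable ℝ (fun x => f x * pd i g x) := (cd2_diff hf).mul (cd2_pd hg i)
    have d2 : Differentiable ℝ (fun x => g x * pd i f x) := (cd2_diff hg).mul (cd2_pd hf i)
    rw [pd_mul (cd2_diff hf) (cd2_diff hg), pd_add d1 d2, pd_mul (cd2_diff hf) (cd2_pd hg i),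
      pd_mul (cd2_diff hg) (cd2_pd hf i)]
    ring
  simp only [this, Finset.sum_add_distrib, Finset.mul_sum]

lemma lap_add {n : ℕ} {f g : EE n → ℝ} (hf : ContDiff ℝ 2 f) (hg : ContDiff ℝ 2 g) (x : EE n) :
    lap (fun x => f x + g x) x = lap f x + lap g x := by
  simp only [lap_eq, ← Finset.sum_add_distrib]
  refine Finset.sum_congr rfl fun i _ => ?_
  rw [pd_add (cd2_diff hf) (cd2_diff hg), pd_add (cd2_pd hf i) (cd2_pd hg i)]

lemma lap_const_mul {n : ℕ} {f : EE n → ℝ} (c : ℝ) (hf : ContDiff ℝ 2 f) (x : EE n) :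
    lap (fun x => c * f x) x = c * lap f x := by
  simp only [lap_eq, Finset.mul_sum]
  refine Finset.sum_congr rfl fun i _ => ?_
  rw [pd_const_mul c (cd2_diff hf), pd_const_mul c (cd2_pd hf i)]

lemma lap_zero {n : ℕ} (x : EE n) : lap (fun _ : EE n => (0:ℝ)) x = 0 := by
  simp [lap]

lemma lap_sum {n : ℕ} {ι : Type*} (s : Finset ι) {f : ι → EE n → ℝ}
    (hf : ∀ i ∈ s, ContDiff ℝ 2 (f i)) (x : EE n) :
    lap (fun x => ∑ i ∈ s, f i x) x = ∑ i ∈ s, lap (f i) x := by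
  classical
  induction s using Finset.induction_on with
  | empty => simp [lap_zero]
  | insert a s ha ih =>
    simp only [Finset.sum_insert ha]
    rw [lap_add (hf a (Finset.mem_insert_self _ _))
      (ContDiff.sum fun i hi => hf i (Finset.mem_insert_of_mem hi)),
      ih fun i hi => hf i (Finset.mem_insert_of_mem hi)]

lemma pd_coord {n : ℕ} (i j : Fin n) (x : EE n) :
    pd i (fun x : EE n => x j) x = if j = i then 1 else 0 := by
  have : HasFDerivAt (fun x : EE n => x j) (EuclideanSpace.proj j : EE n →L[ℝ] ℝ) x :=
    (EuclideanSpace.proj j : EE n →L[ℝ] ℝ).hasFDerivAt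
  simp only [pd, this.fderiv]
  simp

lemma hasFDerivAt_radial {n : ℕ} {f : ℝ → ℝ} {f' : ℝ} {x : EE n} (h : HasDerivAt f f' (‖x‖ ^ 2)) :
    HasFDerivAt (fun y : EE n => f (‖y‖ ^ 2)) (f' • ((2:ℝ) • innerSL ℝ x)) x := by
  have := h.comp_hasFDerivAt x (hasStrictFDerivAt_norm_sq x).hasFDerivAt
  have e : f' • ((2:ℝ) • innerSL ℝ x) = f' • (2 • innerSL ℝ x) := by
    rw [ofNat_smul_eq_nsmul]
  rw [e]
  exact this

lemma pd_radial {n : ℕ} {f : ℝ → ℝ} {f' : ℝ} {x : EE n} (i : Fin n)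
    (h : HasDerivAt f f' (‖x‖ ^ 2)) :
    pd i (fun y : EE n => f (‖y‖ ^ 2)) x = 2 * x i * f' := by
  simp only [pd, (hasFDerivAt_radial h).fderiv]
  simp [EuclideanSpace.inner_single_right]
  ring

lemma lap_radial {n : ℕ} {f f1 : ℝ → ℝ} {f2 : ℝ} {x : EE n}
    (h : ∀ᶠ s in 𝓝 (‖x‖ ^ 2), HasDerivAt f (f1 s) s)
    (h1 : HasDerivAt f1 f2 (‖x‖ ^ 2)) :
    lap (fun y : EE n => f (‖y‖ ^ 2)) x = 4 * ‖x‖ ^ 2 * f2 + 2 * n * f1 (‖x‖ ^ 2) := by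
  have hc : Tendsto (fun y : EE n => ‖y‖ ^ 2) (𝓝 x) (𝓝 (‖x‖ ^ 2)) := by
    apply Continuous.tendsto; fun_prop
  have h' := hc.eventually h
  have : ∀ i, pd i (pd i (fun y : EE n => f (‖y‖ ^ 2))) x =
      4 * (x i) ^ 2 * f2 + 2 * f1 (‖x‖ ^ 2) := by
    intro i
    have e : pd i (fun y : EE n => f (‖y‖ ^ 2)) =ᶠ[𝓝 x] fun y => 2 * (y i * f1 (‖y‖ ^ 2)) := by
      filter_upwards [h'] with y hy
      rw [pd_radial i hy]; ring
    rw [(pd_congr e).eq_of_nhds]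
    have a1 := (EuclideanSpace.proj i : EE n →L[ℝ] ℝ).hasFDerivAt (x := x)
    have a2 := (a1.mul (hasFDerivAt_radial h1)).const_mul 2
    have a3 : HasFDerivAt (fun y : EE n => 2 * (y i * f1 (‖y‖ ^ 2))) _ x := a2
    simp only [pd, a3.fderiv]
    simp [EuclideanSpace.inner_single_right]
    ring
  rw [lap_eq]
  simp only [this, Finset.sum_add_distrib, ← Finset.sum_mul, ← Finset.mul_sum]
  rw [← EuclideanSpace.real_norm_sq_eq]
  simp only [Finset.sum_const, Finset.card_univ, Fintype.card_fin, nsmul_eq_mul]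
  ring

lemma hasFDerivAt_lin {n : ℕ} {f : ℝ → ℝ} {f' : ℝ} {x z : EE n} (h : HasDerivAt f f' ⟪z, x⟫) :
    HasFDerivAt (fun y : EE n => f ⟪z, y⟫) (f' • innerSL ℝ z) x :=
  h.comp_hasFDerivAt x (innerSL ℝ z).hasFDerivAt

lemma pd_lin {n : ℕ} {f : ℝ → ℝ} {f' : ℝ} {x z : EE n} (i : Fin n) (h : HasDerivAt f f' ⟪z, x⟫) :
    pd i (fun y : EE n => f ⟪z, y⟫) x = f' * z i := by
  simp only [pd, (hasFDerivAt_lin h).fderiv]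
  simp [EuclideanSpace.inner_single_right]

lemma lap_lin_pow {n : ℕ} (z x : EE n) (m : ℕ) :
    lap (fun y : EE n => ⟪z, y⟫ ^ (m + 2)) x = (m + 2) * (m + 1) * ⟪z, x⟫ ^ m * ‖z‖ ^ 2 := by
  have : ∀ i, pd i (pd i (fun y : EE n => ⟪z, y⟫ ^ (m + 2))) x =
      ((m + 2) * (m + 1) * ⟪z, x⟫ ^ m) * (z i) ^ 2 := by
    intro i
    have e : pd i (fun y : EE n => ⟪z, y⟫ ^ (m + 2)) =
        fun y => (fun s : ℝ => (m + 2) * s ^ (m + 1) * z i) ⟪z, y⟫ := by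
      ext y
      rw [pd_lin (f := fun s => s ^ (m+2)) i (hasDerivAt_pow (m + 2) _)]
      push_cast; simp
    rw [e, pd_lin (f := fun s : ℝ => (m + 2) * s ^ (m + 1) * z i) (f' := (m + 2) * ((m + 1) * ⟪z, x⟫ ^ m) * z i) i]
    · ring
    · have := ((hasDerivAt_pow (m + 1) ⟪z, x⟫).const_mul ((m:ℝ) + 2)).mul_const (z i)
      simpa using this
  rw [lap_eq]
  simp only [this, ← Finset.mul_sum]
  rw [EuclideanSpace.real_norm_sq_eq z]

lemma sum_coord_pd {n : ℕ} (f : EE n → ℝ) (x : EE n) :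
    ∑ i, x i * pd i f x = fderiv ℝ f x x := by
  simp only [pd]
  generalize fderiv ℝ f x = L
  conv_rhs => rw [← (EuclideanSpace.basisFun (Fin n) ℝ).sum_repr x]
  simp

end

end

section
open Metric Set Filter MeasureTheory
open scoped RealInnerProductSpace Topology

noncomputable section

/-- weight -/
def Nw (n : ℕ) (l s : ℝ) : ℝ := Real.exp (l / (4 * s)) * s ^ ((n : ℝ) / 2 - 2)

def gw (n : ℕ) (l : ℝ) (m : ℕ) (σ s : ℝ) : ℝ := s ^ m * Nw n l s * Real.exp (-(σ * s))

def AI (n : ℕ) (l : ℝ) (I : Set ℝ) (m : ℕ) (σ : ℝ) : ℝ := ∫ s in I, gw n l m σ s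

lemma Nw_nonneg {n : ℕ} {l s : ℝ} (hs : 0 ≤ s) : 0 ≤ Nw n l s := by
  unfold Nw; positivity

lemma Nw_pos {n : ℕ} {l s : ℝ} (hs : 0 < s) : 0 < Nw n l s := by
  unfold Nw; positivity

lemma gw_nonneg {n : ℕ} {l σ s : ℝ} {m : ℕ} (hs : 0 ≤ s) : 0 ≤ gw n l m σ s := by
  have := Nw_nonneg (n := n) (l := l) hs
  unfold gw; positivity

lemma gw_succ {n : ℕ} {l σ s : ℝ} {m : ℕ} : gw n l (m + 1) σ s = s * gw n l m σ s := by
  unfold gw; ring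

lemma Nw_hasDerivAt {n : ℕ} {l s : ℝ} (hs : 0 < s) :
    HasDerivAt (Nw n l) (Nw n l s * (-(l / (4 * s ^ 2)) + ((n : ℝ) / 2 - 2) / s)) s := by
  have h1 : HasDerivAt (fun s : ℝ => l / (4 * s)) (-(l / (4 * s ^ 2))) s := by
    have := (hasDerivAt_inv hs.ne').const_mul (l / 4)
    refine (this.congr_of_eventuallyEq ?_).congr_deriv ?_
    · exact Eventually.of_forall fun t => by
        simp only [div_eq_mul_inv, mul_inv]; ring
    · field_simp
  have h2 := Real.hasDerivAt_rpow_const (x := s) (p := (n : ℝ) / 2 - 2) (Or.inl hs.ne')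
  have := h1.exp.mul h2
  refine this.congr_deriv ?_
  unfold Nw
  rw [Real.rpow_sub_one hs.ne']
  field_simp

lemma gw_continuousOn {n : ℕ} {l σ : ℝ} {m : ℕ} : ContinuousOn (gw n l m σ) (Ioi 0) := by
  have : ContinuousOn (Nw n l) (Ioi 0) := fun s hs =>
    (Nw_hasDerivAt hs).continuousAt.continuousWithinAt
  unfold gw
  exact ((continuous_id.pow m).continuousOn.mul this).mul (by fun_prop)

lemma Nw_le {n : ℕ} {l s : ℝ} (hl : 0 ≤ l) (hs : 1 ≤ s) : Nw n l s ≤ Real.exp l * s ^ n := by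
  have h0 : 0 < s := by linarith
  unfold Nw
  have h1 : Real.exp (l / (4 * s)) ≤ Real.exp l := by
    apply Real.exp_le_exp.2
    exact div_le_self hl (by linarith)
  have h2 : s ^ ((n : ℝ) / 2 - 2) ≤ s ^ n := by
    rw [← Real.rpow_natCast]
    apply Real.rpow_le_rpow_of_exponent_le hs
    have : (0:ℝ) ≤ n := Nat.cast_nonneg n
    linarith
  gcongr

/-- key elementary bound -/
lemma pow_mul_exp_le {σ s : ℝ} (hσ : 0 < σ) (hs : 0 ≤ s) (m : ℕ) :
    s ^ m * Real.exp (-(σ * s)) ≤ m.factorial * (2 / σ) ^ m * Real.exp (-(σ / 2 * s)) := by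
  have h := Real.pow_div_factorial_le_exp (σ / 2 * s) (by positivity) m
  have hf : (0:ℝ) < m.factorial := by exact_mod_cast m.factorial_pos
  rw [div_le_iff₀ hf, mul_pow] at h
  have e : Real.exp (-(σ * s)) = Real.exp (-(σ / 2 * s)) * Real.exp (-(σ / 2 * s)) := by
    rw [← Real.exp_add]; ring_nf
  have e2 : Real.exp (σ / 2 * s) * Real.exp (-(σ / 2 * s)) = 1 := by
    rw [← Real.exp_add]; simp
  rw [e]
  have h3 : s ^ m ≤ Real.exp (σ / 2 * s) * m.factorial * (2 / σ) ^ m := by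
    have : s ^ m = ((σ / 2) ^ m * s ^ m) * (2 / σ) ^ m := by
      rw [mul_right_comm, ← mul_pow]
      have : σ / 2 * (2 / σ) = 1 := by field_simp
      rw [this]; simp
    rw [this]; gcongr
  calc s ^ m * (Real.exp (-(σ / 2 * s)) * Real.exp (-(σ / 2 * s)))
      ≤ (Real.exp (σ / 2 * s) * m.factorial * (2 / σ) ^ m) *
        (Real.exp (-(σ / 2 * s)) * Real.exp (-(σ / 2 * s))) := by gcongr
    _ = (Real.exp (σ / 2 * s) * Real.exp (-(σ / 2 * s))) * (m.factorial * (2 / σ) ^ m *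
        Real.exp (-(σ / 2 * s))) := by ring
    _ = _ := by rw [e2, one_mul]

lemma gw_le {n : ℕ} {l σ s : ℝ} (hσ : 0 < σ) (hs : 0 ≤ s) (m : ℕ) :
    gw n l m σ s ≤ m.factorial * (2 / σ) ^ m * gw n l 0 (σ / 2) s := by
  have := mul_le_mul_of_nonneg_left (pow_mul_exp_le hσ hs m) (Nw_nonneg (n := n) (l := l) hs)
  unfold gw
  calc _ = Nw n l s * (s ^ m * Real.exp (-(σ * s))) := by ring
    _ ≤ _ := this
    _ = _ := by ring

lemma gw_integrable {n : ℕ} {l σ : ℝ} (hl : 0 ≤ l) (hσ : 0 < σ) (m : ℕ) :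
    IntegrableOn (gw n l m σ) (Ioi 1) := by
  have h0 : IntegrableOn (fun s => (Real.exp l * ((m + n).factorial * (2 / σ) ^ (m + n))) *
      Real.exp (-(σ / 2) * s)) (Ioi 1) :=
    (integrableOn_exp_mul_Ioi (by linarith) 1).const_mul _
  refine Integrable.mono' h0 ?_ ?_
  · exact (gw_continuousOn.mono (Ioi_subset_Ioi zero_le_one)).aestronglyMeasurable measurableSet_Ioi
  · refine (ae_restrict_iff' measurableSet_Ioi).2 (Eventually.of_forall fun s hs => ?_)
    have hs' : (1:ℝ) ≤ s := le_of_lt hs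
    have hs0 : (0:ℝ) ≤ s := by linarith
    rw [Real.norm_of_nonneg (gw_nonneg hs0)]
    calc gw n l m σ s ≤ s ^ m * (Real.exp l * s ^ n) * Real.exp (-(σ * s)) := by
          unfold gw; gcongr; exact Nw_le hl hs'
      _ = Real.exp l * (s ^ (m + n) * Real.exp (-(σ * s))) := by rw [pow_add]; ring
      _ ≤ Real.exp l * ((m + n).factorial * (2 / σ) ^ (m + n) * Real.exp (-(σ / 2 * s))) := by
          exact mul_le_mul_of_nonneg_left (pow_mul_exp_le hσ hs0 _) (Real.exp_pos _).le
      _ = _ := by rw [neg_mul]; ring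

lemma gw_integrable_Ioc {n : ℕ} {l σ : ℝ} (S : ℝ) (m : ℕ) :
    IntegrableOn (gw n l m σ) (Ioc 1 S) :=
  (ContinuousOn.integrableOn_Icc (gw_continuousOn.mono
    fun _ hx => lt_of_lt_of_le zero_lt_one hx.1)).mono_set Ioc_subset_Icc_self

lemma AI_hasDerivAt {n : ℕ} {l τ σ : ℝ} {I : Set ℝ} (hI : MeasurableSet I) (hI1 : I ⊆ Ioi 0)
    (hItg : ∀ m, IntegrableOn (gw n l m τ) I) (hτ : τ < σ) (m : ℕ) :
    HasDerivAt (AI n l I m) (-AI n l I (m + 1) σ) σ := by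
  have hmeas : ∀ m σ, AEStronglyMeasurable (gw n l m σ) (volume.restrict I) := fun m σ =>
    (gw_continuousOn.mono hI1).aestronglyMeasurable hI
  have hle : ∀ m, ∀ s ∈ I, ∀ x ∈ Ioi τ, ‖gw n l m x s‖ ≤ gw n l m τ s := by
    intro m s hs x hx
    have h0 : 0 < s := hI1 hs
    rw [Real.norm_of_nonneg (gw_nonneg h0.le)]
    have := Nw_nonneg (n := n) (l := l) h0.le
    unfold gw
    gcongr
    exact le_of_lt hx
  have hii : ∀ m, ∀ x ∈ Ioi τ, Integrable (gw n l m x) (volume.restrict I) := fun m x hx =>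
    Integrable.mono' (hItg m) (hmeas m x) ((ae_restrict_iff' hI).2
      (Eventually.of_forall fun s hs => hle m s hs x hx))
  have := hasDerivAt_integral_of_dominated_loc_of_deriv_le (μ := volume.restrict I)
    (F := fun x s => gw n l m x s) (F' := fun x s => -gw n l (m + 1) x s) (x₀ := σ)
    (s := Ioi τ) (bound := gw n l (m + 1) τ) (Ioi_mem_nhds hτ)
    (Eventually.of_forall fun x => hmeas m x) (hii m σ hτ) (hmeas (m+1) σ).neg
    ((ae_restrict_iff' hI).2 (Eventually.of_forall fun s hs x hx => by
      rw [norm_neg]; exact hle (m+1) s hs x hx)) (hItg (m + 1))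
    (Eventually.of_forall fun s x _ => by
      have h1 : HasDerivAt (fun x : ℝ => Real.exp (-(x * s))) (Real.exp (-(x * s)) * (-s)) x := by
        have := ((hasDerivAt_id x).mul_const s).neg.exp
        simpa using this
      have := h1.const_mul (s ^ m * Nw n l s)
      refine this.congr_deriv ?_
      unfold gw; ring)
  have h2 := this.2
  rw [integral_neg] at h2
  exact h2

lemma gw_prim {n : ℕ} {l σ s : ℝ} (hs : 0 < s) (m : ℕ) :
    HasDerivAt (gw n l (m + 2) σ)
      (-(l / 4) * gw n l m σ s + ((n : ℝ) / 2 + m) * gw n l (m + 1) σ s - σ * gw n l (m + 2) σ s)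
      s := by
  have h1 : HasDerivAt (fun s : ℝ => Real.exp (-(σ * s))) (Real.exp (-(σ * s)) * (-σ)) s := by
    have := ((hasDerivAt_id s).const_mul σ).neg.exp
    simpa using this
  have := ((hasDerivAt_pow (m + 2) s).mul (Nw_hasDerivAt (n := n) (l := l) hs)).mul h1
  refine this.congr_deriv ?_
  unfold gw
  push_cast
  simp only [Pi.mul_apply]
  field_simp
  ring

lemma integral_lin3 {μ : Measure ℝ} {f g h : ℝ → ℝ} (hf : Integrable f μ) (hg : Integrable g μ)
    (hh : Integrable h μ) (a b c : ℝ) :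
    ∫ s, (a * f s + b * g s - c * h s) ∂μ = a * ∫ s, f s ∂μ + b * ∫ s, g s ∂μ - c * ∫ s, h s ∂μ := by
  have h1 : Integrable (fun s => a * f s + b * g s) μ := (hf.const_mul a).add (hg.const_mul b)
  rw [integral_sub h1 (hh.const_mul c), integral_add (hf.const_mul a) (hg.const_mul b),
    integral_const_mul, integral_const_mul, integral_const_mul]

lemma AI_rec {n : ℕ} {l σ : ℝ} (hl : 0 ≤ l) (hσ : 0 < σ) (m : ℕ) :
    4 * σ * AI n l (Ioi 1) (m + 2) σ - (4 * m + 2 * n) * AI n l (Ioi 1) (m + 1) σ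
      + l * AI n l (Ioi 1) m σ = 4 * Real.exp (l / 4) * Real.exp (-σ) := by
  have hi := fun m => gw_integrable (n := n) hl hσ m
  have hd : ∀ s ∈ Ioi (1:ℝ), HasDerivAt (gw n l (m + 2) σ) _ s := fun s hs =>
    gw_prim (lt_trans zero_lt_one hs) m
  have hI : IntegrableOn (fun s => -(l / 4) * gw n l m σ s + ((n : ℝ) / 2 + m) * gw n l (m + 1) σ s
      - σ * gw n l (m + 2) σ s) (Ioi 1) :=
    (((hi m).const_mul _).add ((hi (m+1)).const_mul _)).sub ((hi (m+2)).const_mul _)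
  have ht := tendsto_zero_of_hasDerivAt_of_integrableOn_Ioi hd hI (hi (m+2))
  have := integral_Ioi_of_hasDerivAt_of_tendsto
    (gw_prim zero_lt_one m).continuousAt.continuousWithinAt hd hI ht
  rw [integral_lin3 (hi m) (hi (m+1)) (hi (m+2))] at this
  have e : gw n l (m + 2) σ 1 = Real.exp (l / 4) * Real.exp (-σ) := by simp [gw, Nw]
  rw [e] at this
  unfold AI
  linarith

lemma AI_rec_Ioc {n : ℕ} {l σ S : ℝ} (hS : 1 ≤ S) :
    4 * σ * AI n l (Ioc 1 S) 2 σ - 2 * n * AI n l (Ioc 1 S) 1 σ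
      + l * AI n l (Ioc 1 S) 0 σ = 4 * Real.exp (l / 4) * Real.exp (-σ) - 4 * gw n l 2 σ S := by
  have hi := fun m => gw_integrable_Ioc (n := n) (l := l) (σ := σ) S m
  have hI : IntegrableOn (fun s => -(l / 4) * gw n l 0 σ s + ((n : ℝ) / 2 + (0:ℕ)) * gw n l (0 + 1) σ s
      - σ * gw n l (0 + 2) σ s) (Ioc 1 S) :=
    (((hi 0).const_mul _).add ((hi (0+1)).const_mul _)).sub ((hi (0+2)).const_mul _)
  have := intervalIntegral.integral_eq_sub_of_hasDerivAt (a := 1) (b := S)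
    (f := gw n l (0 + 2) σ) (fun s hs => by
      rw [uIcc_of_le hS] at hs
      exact gw_prim (n := n) (l := l) (σ := σ) (lt_of_lt_of_le zero_lt_one hs.1) 0)
    ((intervalIntegrable_iff_integrableOn_Ioc_of_le hS).2 hI)
  rw [intervalIntegral.integral_of_le hS,
    integral_lin3 (hi 0) (hi (0+1)) (hi (0+2))] at this
  have e : gw n l (0 + 2) σ 1 = Real.exp (l / 4) * Real.exp (-σ) := by simp [gw, Nw]
  rw [e] at this
  unfold AI
  simp only [zero_add, Nat.cast_zero, add_zero] at this ⊢
  linarith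

lemma AI_le {n : ℕ} {l σ : ℝ} (hl : 0 ≤ l) (hσ : 0 < σ) (m : ℕ) :
    AI n l (Ioi 1) m σ ≤ m.factorial * (2 / σ) ^ m * AI n l (Ioi 1) 0 (σ / 2) := by
  unfold AI
  rw [← integral_const_mul]
  refine setIntegral_mono_on (gw_integrable hl hσ m)
    ((gw_integrable hl (half_pos hσ) 0).const_mul _) measurableSet_Ioi fun s hs => ?_
  exact gw_le hσ (le_of_lt (lt_trans zero_lt_one hs)) m

lemma AI_nonneg {n : ℕ} {l σ : ℝ} (m : ℕ) {I : Set ℝ} (hI : MeasurableSet I) (h : I ⊆ Ioi 0) :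
    0 ≤ AI n l I m σ :=
  setIntegral_nonneg hI fun _ hs => gw_nonneg (le_of_lt (h hs))

lemma AI_anti {n : ℕ} {l σ τ : ℝ} (hl : 0 ≤ l) (hσ : 0 < σ) (h : σ ≤ τ) (m : ℕ) :
    AI n l (Ioi 1) m τ ≤ AI n l (Ioi 1) m σ := by
  refine setIntegral_mono_on (gw_integrable hl (hσ.trans_le h) m)
    (gw_integrable hl hσ m) measurableSet_Ioi fun s hs => ?_
  have h0 : 0 < s := lt_trans zero_lt_one hs
  have := Nw_nonneg (n := n) (l := l) h0.le
  unfold gw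
  gcongr

/-- coefficients of the entire corrector -/
def cc (n : ℕ) (l : ℝ) : ℕ → ℝ
  | 0 => 0
  | (k + 1) => (-(4 * Real.exp (l / 4)) * (-1) ^ k - l * cc n l k) / (4 * k + 2 * n)

lemma cc_rec {n : ℕ} (hn : 2 ≤ n) (l : ℝ) (k : ℕ) :
    (4 * k + 2 * n) * cc n l (k + 1) + l * cc n l k = -(4 * Real.exp (l / 4)) * (-1) ^ k := by
  have : (4 * (k:ℝ) + 2 * n) ≠ 0 := by positivity
  rw [cc]; field_simp; ring

lemma cc_EB {n : ℕ} (hn : 2 ≤ n) {l : ℝ} (hl : 0 ≤ l) :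
    EB (cc n l) (4 * Real.exp (l / 4)) (1 + l) := by
  intro k
  induction k with
  | zero => simp [cc]; positivity
  | succ k ih =>
    have hn' : (2:ℝ) ≤ n := by exact_mod_cast hn
    have hk : (0:ℝ) ≤ k := Nat.cast_nonneg k
    set β := 4 * Real.exp (l / 4) with hβ
    have hβ0 : 0 ≤ β := by positivity
    have hp : 1 ≤ (1 + l) ^ k := one_le_pow₀ (by linarith)
    rw [cc, abs_div, abs_of_pos (by positivity : (0:ℝ) < 4 * k + 2 * n),
      div_le_iff₀ (by positivity)]
    have h1 : |-β * (-1) ^ k - l * cc n l k| ≤ β + l * (β * (1 + l) ^ k) := by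
      refine (abs_sub _ _).trans ?_
      rw [abs_mul, abs_mul, abs_pow, abs_neg, abs_neg, abs_one, one_pow, mul_one,
        abs_of_nonneg hβ0, abs_of_nonneg hl]
      gcongr
    calc _ ≤ _ := h1
      _ ≤ β * (1 + l) ^ (k + 1) * 1 := by
        rw [pow_succ]; nlinarith [mul_le_mul_of_nonneg_left hp hβ0]
      _ ≤ _ := by gcongr; linarith

def Hm (n : ℕ) (l : ℝ) (m : ℕ) : ℝ → ℝ := egf (fun k => cc n l (k + m))

lemma Hm_hasDerivAt {n : ℕ} (hn : 2 ≤ n) {l : ℝ} (hl : 0 ≤ l) (m : ℕ) (x : ℝ) :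
    HasDerivAt (Hm n l m) (Hm n l (m + 1) x) x := by
  have := ((cc_EB hn hl).shift m).hasDerivAt (by linarith) x
  have e : (fun k => cc n l (k + 1 + m)) = fun k => cc n l (k + (m + 1)) := by
    ext k; congr 1; omega
  rw [e] at this
  exact this

lemma Hm_rec {n : ℕ} (hn : 2 ≤ n) {l : ℝ} (hl : 0 ≤ l) (m : ℕ) (σ : ℝ) :
    4 * σ * Hm n l (m + 2) σ + (4 * m + 2 * n) * Hm n l (m + 1) σ + l * Hm n l m σ =
      -(-1) ^ m * (4 * Real.exp (l / 4)) * Real.exp (-σ) := by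
  have h := ((cc_EB hn hl).shift m).ode (4 * m + 2 * n) l σ
  have e1 : (fun k => cc n l (k + 1 + m)) = fun k => cc n l (k + (m + 1)) := by
    ext k; congr 1; omega
  have e2 : (fun k => cc n l (k + 2 + m)) = fun k => cc n l (k + (m + 2)) := by
    ext k; congr 1; omega
  rw [e1, e2] at h
  have h2 : HasSum (fun k : ℕ => (-(-1) ^ m * (4 * Real.exp (l / 4))) * ((-σ) ^ k / k.factorial))
      ((-(-1) ^ m * (4 * Real.exp (l / 4))) * Real.exp (-σ)) := by
    have := NormedSpace.expSeries_div_hasSum_exp (𝔸 := ℝ) (-σ)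
    rw [← Real.exp_eq_exp_ℝ] at this
    exact this.mul_left _
  refine h.unique (h2.congr_fun' fun k => ?_)
  have := cc_rec hn l (k + m)
  push_cast at this
  have e3 : k + 1 + m = k + m + 1 := by omega
  rw [e3]
  have : (4 * (k:ℝ) + (4 * m + 2 * n)) * cc n l (k + m + 1) + l * cc n l (k + m) =
    -(4 * Real.exp (l / 4)) * (-1) ^ (k + m) := by rw [← this]; ring
  rw [this, neg_pow σ k, pow_add]
  ring

/-- radial derivative profiles of the fundamental solution -/
def phi (n : ℕ) (l : ℝ) (m : ℕ) (σ : ℝ) : ℝ := (-1) ^ m * AI n l (Ioi 1) m σ + Hm n l m σ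

lemma phi_rec {n : ℕ} (hn : 2 ≤ n) {l : ℝ} (hl : 0 ≤ l) (m : ℕ) {σ : ℝ} (hσ : 0 < σ) :
    4 * σ * phi n l (m + 2) σ + (4 * m + 2 * n) * phi n l (m + 1) σ + l * phi n l m σ = 0 := by
  have h1 := AI_rec (n := n) hl hσ m
  have h2 := Hm_rec hn hl m σ
  unfold phi
  rw [pow_succ, pow_succ]
  linear_combination (-1) ^ m * h1 + h2

lemma phi_hasDerivAt {n : ℕ} (hn : 2 ≤ n) {l : ℝ} (hl : 0 ≤ l) (m : ℕ) {σ : ℝ} (hσ : 0 < σ) :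
    HasDerivAt (phi n l m) (phi n l (m + 1) σ) σ := by
  have h1 := AI_hasDerivAt (n := n) (l := l) (τ := σ / 2) (σ := σ) measurableSet_Ioi
    (Ioi_subset_Ioi zero_le_one) (gw_integrable hl (half_pos hσ)) (half_lt_self hσ) m
  have := (h1.const_mul ((-1) ^ m)).add (Hm_hasDerivAt hn hl m σ)
  refine this.congr_deriv ?_
  unfold phi; rw [pow_succ]; ring

lemma Hm_le {n : ℕ} (hn : 2 ≤ n) {l : ℝ} (hl : 0 ≤ l) (m : ℕ) (σ : ℝ) :
    |Hm n l m σ| ≤ 4 * Real.exp (l / 4) * (1 + l) ^ m * Real.exp ((1 + l) * |σ|) :=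
  ((cc_EB hn hl).shift m).abs_egf_le σ

lemma pow_le_fact {a σ : ℝ} (ha : 0 ≤ a) (hσ : 0 < σ) (m : ℕ) :
    a ^ m ≤ m.factorial * (2 / σ) ^ m * Real.exp (a * σ) := by
  have h := Real.pow_div_factorial_le_exp (a * σ) (by positivity) m
  have hf : (0:ℝ) < m.factorial := by exact_mod_cast m.factorial_pos
  rw [div_le_iff₀ hf] at h
  have e : a ^ m = (a * σ) ^ m * (1 / σ) ^ m := by
    rw [← mul_pow]; congr 1; field_simp
  have h2 : (1 / σ) ^ m ≤ (2 / σ) ^ m := by gcongr; norm_num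
  rw [e]
  calc (a * σ) ^ m * (1 / σ) ^ m ≤ (Real.exp (a * σ) * m.factorial) * (2 / σ) ^ m := by gcongr
    _ = _ := by ring

/-- majorant constant -/
def MM (n : ℕ) (l d R : ℝ) : ℝ :=
  AI n l (Ioi 1) 0 (d / 2) + 4 * Real.exp (l / 4) * Real.exp (2 * (1 + l) * R)

lemma MM_nonneg {n : ℕ} {l d R : ℝ} : 0 ≤ MM n l d R := by
  have := AI_nonneg (n := n) (l := l) (σ := d / 2) 0 (I := Ioi 1) measurableSet_Ioi
    (Ioi_subset_Ioi zero_le_one)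
  unfold MM; positivity

lemma phi_le {n : ℕ} (hn : 2 ≤ n) {l : ℝ} (hl : 0 ≤ l) (m : ℕ) {σ d R : ℝ} (hd : 0 < d)
    (hσ : d ≤ σ) (hR : σ ≤ R) :
    |phi n l m σ| ≤ MM n l d R * (m.factorial * (2 / σ) ^ m) := by
  have hσ0 : 0 < σ := hd.trans_le hσ
  have hA := AI_le (n := n) hl hσ0 m
  have hA2 := AI_anti (n := n) (l := l) hl (half_pos hd) (by linarith : d / 2 ≤ σ / 2) 0
  have hA0 := AI_nonneg (n := n) (l := l) (σ := σ) m (I := Ioi 1) measurableSet_Ioi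
    (Ioi_subset_Ioi zero_le_one)
  have hH := Hm_le hn hl m σ
  have hp := pow_le_fact (a := 1 + l) (by linarith) hσ0 m
  rw [abs_of_pos hσ0] at hH
  have he : Real.exp ((1 + l) * σ) * Real.exp ((1 + l) * σ) ≤ Real.exp (2 * (1 + l) * R) := by
    rw [← Real.exp_add]
    apply Real.exp_le_exp.2
    nlinarith
  unfold phi MM
  refine (abs_add_le _ _).trans ?_
  rw [abs_mul, abs_pow, abs_neg, abs_one, one_pow, one_mul, abs_of_nonneg hA0, add_mul]
  gcongr
  · calc _ ≤ _ := hA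
      _ ≤ m.factorial * (2 / σ) ^ m * AI n l (Ioi 1) 0 (d / 2) := by gcongr
      _ = _ := by ring
  · calc _ ≤ _ := hH
      _ ≤ 4 * Real.exp (l / 4) * (m.factorial * (2 / σ) ^ m * Real.exp ((1 + l) * σ)) *
          Real.exp ((1 + l) * σ) := by gcongr
      _ = 4 * Real.exp (l / 4) * (Real.exp ((1 + l) * σ) * Real.exp ((1 + l) * σ)) *
          (m.factorial * (2 / σ) ^ m) := by ring
      _ ≤ _ := by gcongr

end

end

section
open Metric Set Filter MeasureTheory
open scoped RealInnerProductSpace Topology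

noncomputable section

lemma AI_taylor {n : ℕ} {l σ τ : ℝ} (hl : 0 ≤ l) (hσ : 0 < σ) (hτ : |τ| ≤ σ / 4) :
    HasSum (fun m : ℕ => ((-1) ^ m * AI n l (Ioi 1) m σ) * (τ ^ m / m.factorial))
      (AI n l (Ioi 1) 0 (σ + τ)) := by
  have hq : 2 / σ * |τ| ≤ 1 / 2 := by
    rw [div_mul_eq_mul_div, div_le_iff₀ hσ]; linarith
  have h := hasSum_integral_of_summable_integral_norm (μ := volume.restrict (Ioi (1:ℝ)))
    (F := fun (m : ℕ) s => ((-1) ^ m * (τ ^ m / m.factorial)) * gw n l m σ s)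
    (fun m => (gw_integrable hl hσ m).const_mul _) (by
      refine Summable.of_nonneg_of_le (fun m => integral_nonneg fun _ => norm_nonneg _)
        (f := fun m => AI n l (Ioi 1) 0 (σ / 2) * (1 / 2) ^ m) (fun m => ?_)
        ((summable_geometric_of_lt_one (by norm_num) (by norm_num)).mul_left _)
      have e : ∫ s in Ioi (1:ℝ), ‖((-1) ^ m * (τ ^ m / m.factorial)) * gw n l m σ s‖ =
          (|τ| ^ m / m.factorial) * AI n l (Ioi 1) m σ := by
        unfold AI
        rw [← integral_const_mul]
        refine setIntegral_congr_fun measurableSet_Ioi fun s hs => ?_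
        have h0 : (0:ℝ) ≤ s := le_of_lt (lt_trans zero_lt_one hs)
        simp only [norm_mul, norm_pow, norm_neg, norm_one, one_pow, one_mul, norm_div,
          Real.norm_eq_abs, Nat.abs_cast, abs_of_nonneg (gw_nonneg h0)]
      rw [e]
      have hf : (0:ℝ) < m.factorial := by exact_mod_cast m.factorial_pos
      have hA0 := AI_nonneg (n := n) (l := l) (σ := σ / 2) 0 (I := Ioi 1) measurableSet_Ioi
        (Ioi_subset_Ioi zero_le_one)
      calc _ ≤ (|τ| ^ m / m.factorial) * (m.factorial * (2 / σ) ^ m * AI n l (Ioi 1) 0 (σ / 2)) := by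
            gcongr; exact AI_le hl hσ m
        _ = AI n l (Ioi 1) 0 (σ / 2) * (2 / σ * |τ|) ^ m := by
            rw [mul_pow]; field_simp
        _ ≤ _ := by gcongr)
  have e2 : ∫ s in Ioi (1:ℝ), (∑' m : ℕ, ((-1) ^ m * (τ ^ m / m.factorial)) * gw n l m σ s) =
      AI n l (Ioi 1) 0 (σ + τ) := by
    unfold AI
    refine setIntegral_congr_fun measurableSet_Ioi fun s _ => ?_
    have h1 := NormedSpace.expSeries_div_hasSum_exp (𝔸 := ℝ) (-(τ * s))
    rw [← Real.exp_eq_exp_ℝ] at h1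
    have h2 := h1.mul_left (gw n l 0 σ s)
    have e3 : gw n l 0 σ s * Real.exp (-(τ * s)) = gw n l 0 (σ + τ) s := by
      unfold gw
      rw [mul_assoc, ← Real.exp_add]; ring_nf
    rw [← e3, ← h2.tsum_eq]
    congr 1
    ext m
    unfold gw
    rw [neg_pow (τ * s), mul_pow]; ring
  rw [e2] at h
  refine h.congr_fun' fun m => ?_
  rw [integral_const_mul]
  unfold AI; ring

lemma Hm_taylor {n : ℕ} (hn : 2 ≤ n) {l : ℝ} (hl : 0 ≤ l) (σ τ : ℝ) :
    HasSum (fun m : ℕ => Hm n l m σ * (τ ^ m / m.factorial)) (Hm n l 0 (σ + τ)) := by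
  have hEB := cc_EB hn hl
  have hs : Summable (fun k => |cc n l k| * ((|τ| + |σ|) ^ k / k.factorial)) := by
    have := hEB.summable_abs (|τ| + |σ|)
    refine this.congr fun k => ?_
    rw [abs_mul, abs_div, abs_pow, abs_of_nonneg (by positivity : 0 ≤ |τ| + |σ|), Nat.abs_cast]
  have h := (egf_add hs).1
  have h2 := h.prod_fiberwise (g := fun m => Hm n l m σ * (τ ^ m / m.factorial)) (fun m => by
    have := ((hEB.shift m).hasSum σ).mul_right (τ ^ m / m.factorial)
    refine this.congr_fun' fun k => ?_
    simp only
    rw [add_comm m k]; ring)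
  rw [add_comm τ σ] at h2
  exact h2

lemma phi_taylor {n : ℕ} (hn : 2 ≤ n) {l σ τ : ℝ} (hl : 0 ≤ l) (hσ : 0 < σ) (hτ : |τ| ≤ σ / 4) :
    HasSum (fun m : ℕ => phi n l m σ * (τ ^ m / m.factorial)) (phi n l 0 (σ + τ)) := by
  have h := (AI_taylor (n := n) hl hσ hτ).add (Hm_taylor hn hl σ τ)
  have e : phi n l 0 (σ + τ) = AI n l (Ioi 1) 0 (σ + τ) + Hm n l 0 (σ + τ) := by
    simp [phi]
  rw [e]
  refine h.congr_fun' fun m => ?_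
  unfold phi; ring

/-- homogeneous Taylor pieces -/
def Qq {n : ℕ} (z : EE n) (i j : ℕ) (v : EE n) : ℝ :=
  ((2 * ⟪z, v⟫) ^ i / i.factorial) * ((‖v‖ ^ 2) ^ j / j.factorial)

def Pk {n : ℕ} (l : ℝ) (k : ℕ) (z v : EE n) : ℝ :=
  ∑ j ∈ Finset.range (k / 2 + 1), phi n l (k - 2 * j + j) (‖z‖ ^ 2) * Qq z (k - 2 * j) j v

lemma Qq_abs_le {n : ℕ} (l : ℝ) {z : EE n} (hz : z ≠ 0) (i j : ℕ) (v : EE n) :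
    ((i + j).factorial * (2 / ‖z‖ ^ 2) ^ (i + j)) * |Qq z i j v| ≤ (8 * (‖v‖ / ‖z‖)) ^ (i + 2 * j) := by
  have hz0 : 0 < ‖z‖ := norm_pos_iff.2 hz
  set r := ‖v‖ / ‖z‖ with hr
  have hr0 : 0 ≤ r := by positivity
  have hv : ‖v‖ = r * ‖z‖ := by rw [hr]; field_simp
  have hfi : (0:ℝ) < i.factorial := by exact_mod_cast i.factorial_pos
  have hfj : (0:ℝ) < j.factorial := by exact_mod_cast j.factorial_pos
  have hch : ((i + j).factorial : ℝ) ≤ 2 ^ (i + j) * (i.factorial * j.factorial) := by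
    have h1 := Nat.add_choose_mul_factorial_mul_factorial i j
    have h2 := Nat.choose_le_two_pow (i + j) i
    have : (i + j).factorial ≤ 2 ^ (i + j) * (i.factorial * j.factorial) := by
      rw [← h1, mul_assoc]
      first
        | exact Nat.mul_le_mul_right _ h2
        | exact Nat.mul_le_mul_right _ (Nat.choose_le_two_pow (i + j) j)
    exact_mod_cast this
  have hin : |2 * ⟪z, v⟫| ≤ 2 * (r * ‖z‖ ^ 2) := by
    rw [abs_mul, abs_two]
    have := abs_real_inner_le_norm z v
    rw [hv] at this
    nlinarith
  have hQ : |Qq z i j v| ≤ ((2 * (r * ‖z‖ ^ 2)) ^ i / i.factorial) *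
      (((r * ‖z‖) ^ 2) ^ j / j.factorial) := by
    unfold Qq
    rw [abs_mul, abs_div, abs_div, abs_pow, abs_pow, Nat.abs_cast, Nat.abs_cast,
      abs_of_nonneg (by positivity : 0 ≤ ‖v‖ ^ 2), hv]
    gcongr
  calc _ ≤ ((2 ^ (i + j) * (i.factorial * j.factorial)) * (2 / ‖z‖ ^ 2) ^ (i + j)) *
        (((2 * (r * ‖z‖ ^ 2)) ^ i / i.factorial) * (((r * ‖z‖) ^ 2) ^ j / j.factorial)) := by
        gcongr
    _ = (8 * r) ^ i * (4 * r ^ 2) ^ j := by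
        rw [pow_add, pow_add, div_pow, div_pow]
        have e8 : (8:ℝ) = 2 * 2 * 2 := by norm_num
        have e4 : (4:ℝ) = 2 * 2 := by norm_num
        rw [e8, e4]
        simp only [mul_pow]
        field_simp
    _ ≤ (8 * r) ^ i * ((8 * r) ^ 2) ^ j := by
        gcongr; nlinarith [sq_nonneg r]
    _ = _ := by rw [pow_add, pow_mul]

lemma Pk_abs_le {n : ℕ} (hn : 2 ≤ n) {l : ℝ} (hl : 0 ≤ l) {d R : ℝ} (hd : 0 < d) {z : EE n}
    (hz1 : d ≤ ‖z‖ ^ 2) (hz2 : ‖z‖ ^ 2 ≤ R) (k : ℕ) (v : EE n) :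
    |Pk l k z v| ≤ MM n l d R * (16 * (‖v‖ / ‖z‖)) ^ k := by
  have hz : z ≠ 0 := by
    rintro rfl; simp at hz1; linarith
  have hM : 0 ≤ MM n l d R := MM_nonneg
  unfold Pk
  refine (Finset.abs_sum_le_sum_abs _ _).trans ?_
  have h1 : ∀ j ∈ Finset.range (k / 2 + 1),
      |phi n l (k - 2 * j + j) (‖z‖ ^ 2) * Qq z (k - 2 * j) j v| ≤
      MM n l d R * (8 * (‖v‖ / ‖z‖)) ^ k := by
    intro j hj
    have hj' : 2 * j ≤ k := by
      have := Finset.mem_range.1 hj; omega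
    rw [abs_mul]
    calc _ ≤ (MM n l d R * ((k - 2 * j + j).factorial * (2 / ‖z‖ ^ 2) ^ (k - 2 * j + j))) *
          |Qq z (k - 2 * j) j v| := by
          gcongr; exact phi_le hn hl _ hd hz1 hz2
      _ = MM n l d R * (((k - 2 * j + j).factorial * (2 / ‖z‖ ^ 2) ^ (k - 2 * j + j)) *
          |Qq z (k - 2 * j) j v|) := by ring
      _ ≤ MM n l d R * (8 * (‖v‖ / ‖z‖)) ^ (k - 2 * j + 2 * j) := by
          gcongr; exact Qq_abs_le l hz _ _ _
      _ = _ := by rw [Nat.sub_add_cancel hj']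
  refine (Finset.sum_le_card_nsmul _ _ _ h1).trans ?_
  rw [Finset.card_range, nsmul_eq_mul]
  have h2 : ((k / 2 + 1 : ℕ) : ℝ) ≤ 2 ^ k := by
    have : k / 2 + 1 ≤ 2 ^ k := by
      have := Nat.lt_two_pow_self (n := k); omega
    exact_mod_cast this
  have e16 : 16 * (‖v‖ / ‖z‖) = 2 * (8 * (‖v‖ / ‖z‖)) := by ring
  rw [e16, mul_pow 2 (8 * (‖v‖ / ‖z‖))]
  calc _ ≤ 2 ^ k * (MM n l d R * (8 * (‖v‖ / ‖z‖)) ^ k) := by gcongr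
    _ = _ := by ring

lemma Pk_hasSum {n : ℕ} (hn : 2 ≤ n) {l : ℝ} (hl : 0 ≤ l) {z : EE n} (hz : z ≠ 0) {v : EE n}
    (hv : ‖v‖ ≤ ‖z‖ / 32) :
    HasSum (fun k => Pk l k z v) (phi n l 0 (‖z + v‖ ^ 2)) := by
  have hz0 : 0 < ‖z‖ := norm_pos_iff.2 hz
  set σ := ‖z‖ ^ 2 with hσ
  have hσ0 : 0 < σ := by positivity
  set x := 2 * ⟪z, v⟫ with hx
  set y := ‖v‖ ^ 2 with hy
  have hxy : |x| + |y| ≤ σ / 4 := by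
    rw [hx, hy, abs_mul, abs_two, abs_of_nonneg (by positivity : 0 ≤ ‖v‖ ^ 2)]
    have := abs_real_inner_le_norm z v
    have h2 : ‖z‖ * ‖v‖ ≤ ‖z‖ * (‖z‖ / 32) := by gcongr
    have h3 : ‖v‖ ^ 2 ≤ (‖z‖ / 32) ^ 2 := by gcongr
    nlinarith
  have hτ : |x + y| ≤ σ / 4 := (abs_add_le _ _).trans hxy
  have hs : Summable (fun m => |phi n l m σ| * ((|x| + |y|) ^ m / m.factorial)) := by
    refine Summable.of_nonneg_of_le (fun m => by positivity)
      (f := fun m => MM n l σ σ * (1 / 2) ^ m) (fun m => ?_)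
      ((summable_geometric_of_lt_one (by norm_num) (by norm_num)).mul_left _)
    have hf : (0:ℝ) < m.factorial := by exact_mod_cast m.factorial_pos
    have hM : 0 ≤ MM n l σ σ := MM_nonneg
    have hq : 2 / σ * (|x| + |y|) ≤ 1 / 2 := by
      rw [div_mul_eq_mul_div, div_le_iff₀ hσ0]; linarith
    calc _ ≤ (MM n l σ σ * (m.factorial * (2 / σ) ^ m)) * ((|x| + |y|) ^ m / m.factorial) := by
          gcongr; exact phi_le hn hl m hσ0 le_rfl le_rfl
      _ = MM n l σ σ * (2 / σ * (|x| + |y|)) ^ m := by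
          rw [mul_pow]; field_simp
      _ ≤ _ := by gcongr
  have h := (egf_add hs).1
  have e : egf (fun m => phi n l m σ) (x + y) = phi n l 0 (‖z + v‖ ^ 2) := by
    have := (phi_taylor hn hl hσ0 hτ).tsum_eq
    rw [egf, this, norm_add_sq_real, ← add_assoc]
  rw [e] at h
  have h2 := h.tsum_fiberwise (fun p : ℕ × ℕ => p.1 + 2 * p.2)
  refine h2.congr_fun' fun k => ?_
  have hset : (fun p : ℕ × ℕ => p.1 + 2 * p.2) ⁻¹' {k} =
      ((Finset.range (k / 2 + 1)).image (fun j => (k - 2 * j, j)) : Finset (ℕ × ℕ)) := by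
    ext ⟨i, j⟩
    simp only [Set.mem_preimage, Set.mem_singleton_iff, Finset.coe_image, Finset.coe_range,
      Set.mem_image, Set.mem_Iio, Prod.mk.injEq]
    constructor
    · intro h; exact ⟨j, by omega, by omega, rfl⟩
    · rintro ⟨j', h1, h2, rfl⟩; omega
  rw [tsum_congr_set_coe (fun p : ℕ × ℕ => phi n l (p.1 + p.2) σ * (x ^ p.1 / p.1.factorial) *
    (y ^ p.2 / p.2.factorial)) hset]
  rw [Finset.tsum_subtype' ((Finset.range (k / 2 + 1)).image (fun j => (k - 2 * j, j)))
    (fun p : ℕ × ℕ => phi n l (p.1 + p.2) σ * (x ^ p.1 / p.1.factorial) * (y ^ p.2 / p.2.factorial))]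
  rw [Finset.sum_image (fun a _ b _ hab => (Prod.mk.inj hab).2)]
  unfold Pk
  refine Finset.sum_congr rfl fun j _ => ?_
  simp only [Qq, hx, hy]
  ring

lemma Qq_smul {n : ℕ} (z : EE n) (i j : ℕ) (t : ℝ) (v : EE n) :
    Qq z i j (t • v) = t ^ (i + 2 * j) * Qq z i j v := by
  unfold Qq
  rw [inner_smul_right, norm_smul, mul_pow ‖t‖, Real.norm_eq_abs, sq_abs, pow_add, pow_mul,
    show 2 * (t * ⟪z, v⟫) = t * (2 * ⟪z, v⟫) by ring, mul_pow, mul_pow]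
  ring

lemma Pk_smul {n : ℕ} (l : ℝ) (k : ℕ) (z : EE n) (t : ℝ) (v : EE n) :
    Pk l k z (t • v) = t ^ k * Pk l k z v := by
  unfold Pk
  rw [Finset.mul_sum]
  refine Finset.sum_congr rfl fun j hj => ?_
  have hj' : 2 * j ≤ k := by
    have := Finset.mem_range.1 hj; omega
  rw [Qq_smul, Nat.sub_add_cancel hj']; ring

lemma Qq_contDiff {n : ℕ} (z : EE n) (i j : ℕ) : ContDiff ℝ (⊤ : ℕ∞) (Qq z i j) := by
  unfold Qq
  have h1 : ContDiff ℝ (⊤ : ℕ∞) (fun v : EE n => ⟪z, v⟫) := contDiff_const.inner ℝ contDiff_id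
  have h2 : ContDiff ℝ (⊤ : ℕ∞) (fun v : EE n => ‖v‖ ^ 2) := contDiff_id.norm_sq ℝ
  exact (((contDiff_const.mul h1).pow i).div_const _).mul ((h2.pow j).div_const _)

lemma Pk_contDiff {n : ℕ} (l : ℝ) (k : ℕ) (z : EE n) : ContDiff ℝ (⊤ : ℕ∞) (Pk l k z) := by
  unfold Pk
  exact ContDiff.sum fun j _ => contDiff_const.mul (Qq_contDiff z _ _)

lemma Pk_euler {n : ℕ} (l : ℝ) (k : ℕ) (z v : EE n) :
    fderiv ℝ (Pk l k z) v v = k * Pk l k z v := by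
  have hd : DifferentiableAt ℝ (Pk l k z) v :=
    (Pk_contDiff l k z).differentiable (by simp) v
  have h1 : HasDerivAt (fun t : ℝ => t • v) v 1 := by
    simpa using (hasDerivAt_id (1:ℝ)).smul_const v
  have hd' : HasFDerivAt (Pk l k z) (fderiv ℝ (Pk l k z) v) ((1:ℝ) • v) := by
    rw [one_smul]; exact hd.hasFDerivAt
  have h2 := hd'.comp_hasDerivAt (1:ℝ) h1
  have h3 : HasDerivAt (fun t : ℝ => t ^ k * Pk l k z v) (k * Pk l k z v) 1 := by
    simpa using (hasDerivAt_pow k (1:ℝ)).mul_const (Pk l k z v)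
  have e : (Pk l k z ∘ fun t : ℝ => t • v) = fun t : ℝ => t ^ k * Pk l k z v := by
    ext t; exact Pk_smul l k z t v
  rw [e] at h2
  exact h2.unique h3

lemma lap_Qq {n : ℕ} (z : EE n) (i j : ℕ) (v : EE n) :
    lap (Qq z i j) v = (if 2 ≤ i then 4 * ‖z‖ ^ 2 * Qq z (i - 2) j v else 0) +
      (if 1 ≤ j then (4 * (i + (j - 1 : ℕ)) + 2 * n) * Qq z i (j - 1) v else 0) := by
  set f : EE n → ℝ := fun v => ⟪z, v⟫ ^ i with hf
  set g : EE n → ℝ := fun v => (‖v‖ ^ 2) ^ j with hg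
  have h1 : ContDiff ℝ 2 (fun v : EE n => ⟪z, v⟫) := contDiff_const.inner ℝ contDiff_id
  have h2 : ContDiff ℝ 2 (fun v : EE n => ‖v‖ ^ 2) := contDiff_id.norm_sq ℝ
  have hfc : ContDiff ℝ 2 f := h1.pow i
  have hgc : ContDiff ℝ 2 g := h2.pow j
  have eQ : Qq z i j = fun v => (2 ^ i / i.factorial / j.factorial) * (f v * g v) := by
    ext v; unfold Qq; rw [hf, hg, mul_pow]; ring
  rw [eQ, lap_const_mul _ (hfc.mul hgc), lap_mul hfc hgc]
  have hlapf : lap f v = if 2 ≤ i then (i * (i - 1)) * ⟪z, v⟫ ^ (i - 2) * ‖z‖ ^ 2 else 0 := by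
    rcases i with _ | _ | i
    · simp [hf, lap]
    · simp only [hf, zero_add, pow_one]
      have : ∀ k, pd k (fun y : EE n => ⟪z, y⟫) = fun _ => z k := by
        intro k; ext y
        rw [pd_lin (f := fun s => s) (f' := 1) k (hasDerivAt_id _), one_mul]
      rw [lap_eq]; simp only [this]; simp [pd]
    · rw [hf]
      rw [lap_lin_pow z v i, if_pos (by omega), show i + 1 + 1 - 2 = i from rfl]; push_cast; ring
  have hlapg : lap g v = if 1 ≤ j then
      (4 * (j * (j - 1)) + 2 * n * j) * (‖v‖ ^ 2) ^ (j - 1) else 0 := by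
    rw [hg, lap_radial (f := fun s => s ^ j) (f1 := fun s => j * s ^ (j - 1))
      (f2 := j * ((j - 1 : ℕ) * (‖v‖ ^ 2) ^ (j - 1 - 1)))
      (Eventually.of_forall fun s => hasDerivAt_pow j s)
      ((hasDerivAt_pow (j - 1) (‖v‖ ^ 2)).const_mul (j:ℝ))]
    rcases j with _ | _ | j
    · simp
    · simp
    · push_cast; simp; ring
  have hcross : ∑ k, pd k f v * pd k g v = if 1 ≤ j then
      2 * i * j * ⟪z, v⟫ ^ i * (‖v‖ ^ 2) ^ (j - 1) else 0 := by
    have e1 : ∀ k, pd k f v = (i * ⟪z, v⟫ ^ (i - 1)) * z k := fun k =>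
      pd_lin (f := fun s => s ^ i) k (hasDerivAt_pow i _)
    have e2 : ∀ k, pd k g v = 2 * v k * (j * (‖v‖ ^ 2) ^ (j - 1)) := fun k =>
      pd_radial (f := fun s => s ^ j) k (hasDerivAt_pow j _)
    have e3 : ∀ k, pd k f v * pd k g v =
        (2 * (i * ⟪z, v⟫ ^ (i - 1)) * (j * (‖v‖ ^ 2) ^ (j - 1))) * (v k * z k) := by
      intro k; rw [e1, e2]; ring
    have e4 : ∑ k, v k * z k = ⟪z, v⟫ := by
      simp [PiLp.inner_apply]
    simp only [e3, ← Finset.mul_sum, e4]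
    rcases j with _ | j
    · simp
    · rcases i with _ | i
      · simp
      · rw [if_pos (by omega), show i + 1 - 1 = i from rfl]; push_cast; ring
  rw [hlapf, hlapg, hcross]
  unfold Qq
  rcases i with _ | _ | i <;> rcases j with _ | j
  · simp
  · simp [hf, Nat.factorial_succ]; field_simp
  · simp
  · simp [hf, Nat.factorial_succ]; field_simp; ring
  · simp [hf, hg, Nat.factorial_succ]; field_simp; ring
  · simp [hf, hg, Nat.factorial_succ]; field_simp; ring

lemma lap_Pk_eq {n : ℕ} (l : ℝ) (k : ℕ) (z v : EE n) :
    lap (Pk l k z) v = ∑ j ∈ Finset.range (k / 2 + 1),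
      phi n l (k - 2 * j + j) (‖z‖ ^ 2) * lap (Qq z (k - 2 * j) j) v := by
  have hc : ∀ i j, ContDiff ℝ 2 (Qq z i j) := fun i j => contDiff_infty.1 (Qq_contDiff z i j) 2
  unfold Pk
  rw [lap_sum _ (fun j _ => contDiff_const.mul (hc _ _))]
  refine Finset.sum_congr rfl fun j _ => ?_
  rw [lap_const_mul _ (hc _ _)]

lemma lap_Pk_small {n : ℕ} (l : ℝ) {k : ℕ} (hk : k < 2) (z v : EE n) :
    lap (Pk l k z) v = 0 := by
  rw [lap_Pk_eq]
  have : k / 2 + 1 = 1 := by omega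
  rw [this, Finset.sum_range_one, lap_Qq, if_neg (by omega), if_neg (by omega)]
  simp

lemma lap_Pk {n : ℕ} (hn : 2 ≤ n) {l : ℝ} (hl : 0 ≤ l) (k : ℕ) {z : EE n} (hz : z ≠ 0) (v : EE n) :
    lap (Pk l (k + 2) z) v = -l * Pk l k z v := by
  have hσ : 0 < ‖z‖ ^ 2 := by have := norm_pos_iff.2 hz; positivity
  rw [lap_Pk_eq]
  simp only [lap_Qq, mul_add, Finset.sum_add_distrib]
  rw [show (k + 2) / 2 + 1 = k / 2 + 1 + 1 by omega, Finset.sum_range_succ]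
  rw [if_neg (by omega : ¬ 2 ≤ k + 2 - 2 * (k / 2 + 1))]
  rw [Finset.sum_range_succ' _ (k / 2 + 1)]
  rw [if_neg (by omega : ¬ 1 ≤ 0)]
  simp only [mul_zero, add_zero]
  rw [← Finset.sum_add_distrib, Pk, Finset.mul_sum]
  refine Finset.sum_congr rfl fun j hj => ?_
  have hj' : 2 * j ≤ k := by
    have := Finset.mem_range.1 hj; omega
  obtain ⟨i, rfl⟩ := Nat.exists_eq_add_of_le hj'
  have e1 : 2 * j + i + 2 - 2 * j = i + 2 := by omega
  have e2 : 2 * j + i + 2 - 2 * (j + 1) = i := by omega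
  have e3 : 2 * j + i - 2 * j = i := by omega
  rw [e1, e2, e3, if_pos (by omega), if_pos (by omega)]
  have hr := phi_rec hn hl (i + j) hσ
  have e4 : i + 2 + j = i + j + 2 := by omega
  have e5 : i + (j + 1) = i + j + 1 := by omega
  rw [e4, e5, show i + 2 - 2 = i from rfl, show j + 1 - 1 = j from rfl]
  push_cast at hr ⊢
  linear_combination (Qq z i j v) * hr

end

end

section
open Metric Set Filter MeasureTheory
open scoped RealInnerProductSpace Topology

noncomputable section

/-- Runge coefficients -/
def ra (n : ℕ) (l : ℝ) (N : ℕ) : ℕ → ℕ → ℝ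
  | 0 => fun k => if k ≤ N then 1 else 0
  | (m + 1) => fun k => l * (ra n l N m (k + 2) - ra n l N m k) / (4 * m + (2 * n + 4 * k))

lemma ra_0 (n : ℕ) (l : ℝ) (N k : ℕ) : ra n l N 0 k = if k ≤ N then 1 else 0 := rfl

lemma ra_s (n : ℕ) (l : ℝ) (N m k : ℕ) : ra n l N (m + 1) k =
    l * (ra n l N m (k + 2) - ra n l N m k) / (4 * m + (2 * n + 4 * k)) := rfl

lemma ra_rec {n : ℕ} (hn : 2 ≤ n) (l : ℝ) (N k m : ℕ) :
    (4 * m + (2 * n + 4 * k)) * ra n l N (m + 1) k + l * ra n l N m k = l * ra n l N m (k + 2) := by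
  have : (4 * (m:ℝ) + (2 * n + 4 * k)) ≠ 0 := by positivity
  rw [ra_s]; field_simp; ring

lemma ra_zero {n : ℕ} (l : ℝ) (N k m : ℕ) (hk : N < k) : ra n l N m k = 0 := by
  induction m generalizing k with
  | zero => simp [ra, hk]
  | succ m ih => rw [ra_s, ih k hk, ih (k + 2) (by omega)]; simp

lemma ra_zero' {n : ℕ} (l : ℝ) (N k m : ℕ) (hk : k + 2 * (m + 1) ≤ N) : ra n l N (m + 1) k = 0 := by
  induction m generalizing k with
  | zero => rw [ra_s, ra_0, ra_0, if_pos (by omega), if_pos (by omega)]; simp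
  | succ m ih => rw [ra_s, ih k (by omega), ih (k + 2) (by omega)]; simp

lemma ra_EB {n : ℕ} (hn : 2 ≤ n) {l : ℝ} (hl : 0 ≤ l) (N k : ℕ) :
    EB (fun m => ra n l N m k) 1 l := by
  intro m
  induction m generalizing k with
  | zero => simp only [ra]; split_ifs <;> simp
  | succ m ih =>
    have hn' : (2:ℝ) ≤ n := by exact_mod_cast hn
    have hk : (0:ℝ) ≤ k := Nat.cast_nonneg k
    have hm : (0:ℝ) ≤ m := Nat.cast_nonneg m
    simp only [one_mul] at ih ⊢
    rw [ra_s, abs_div, abs_of_pos (by positivity : (0:ℝ) < 4 * m + (2 * n + 4 * k)),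
      div_le_iff₀ (by positivity), abs_mul, abs_of_nonneg hl]
    have h1 : |ra n l N m (k + 2) - ra n l N m k| ≤ l ^ m + l ^ m :=
      (abs_sub _ _).trans (add_le_add (ih (k + 2)) (ih k))
    have hp : 0 ≤ l ^ m := pow_nonneg hl m
    calc _ ≤ l * (l ^ m + l ^ m) := by gcongr
      _ = l ^ (m + 1) * 2 := by ring
      _ ≤ _ := by gcongr; linarith

def rA (n : ℕ) (l : ℝ) (N k : ℕ) : ℝ → ℝ := egf (fun m => ra n l N m k)

lemma rA_zero {n : ℕ} (l : ℝ) (N k : ℕ) (hk : N < k) (x : ℝ) : rA n l N k x = 0 := by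
  simp [rA, egf, ra_zero l N k _ hk]

lemma rA_contDiff {n : ℕ} (hn : 2 ≤ n) {l : ℝ} (hl : 0 ≤ l) (N k : ℕ) :
    ContDiff ℝ (⊤ : ℕ∞) (rA n l N k) := (ra_EB hn hl N k).contDiff hl

lemma lap_term {n : ℕ} (hn : 2 ≤ n) {l : ℝ} (hl : 0 ≤ l) (N k : ℕ) (z y : EE n) :
    lap (fun y => Pk l k z y * rA n l N k (‖y‖ ^ 2)) y + l * (Pk l k z y * rA n l N k (‖y‖ ^ 2)) =
      l * rA n l N (k + 2) (‖y‖ ^ 2) * Pk l k z y + rA n l N k (‖y‖ ^ 2) * lap (Pk l k z) y := by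
  have hE := ra_EB hn hl N k
  set f1 : ℝ → ℝ := egf (fun m => ra n l N (m + 1) k) with hf1
  set f2 : ℝ → ℝ := egf (fun m => ra n l N (m + 2) k) with hf2
  have hd1 : ∀ s, HasDerivAt (rA n l N k) (f1 s) s := fun s => hE.hasDerivAt hl s
  have hd2 : ∀ s, HasDerivAt f1 (f2 s) s := fun s => (hE.shift 1).hasDerivAt hl s
  have hP : ContDiff ℝ 2 (Pk l k z) := contDiff_infty.1 (Pk_contDiff l k z) 2
  have hr : ContDiff ℝ 2 (fun y : EE n => rA n l N k (‖y‖ ^ 2)) :=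
    (contDiff_infty.1 (rA_contDiff hn hl N k) 2).comp (contDiff_id.norm_sq ℝ)
  have hlr := lap_radial (x := y) (Eventually.of_forall hd1) (hd2 (‖y‖ ^ 2))
  have hcross : ∑ i, pd i (Pk l k z) y * pd i (fun y : EE n => rA n l N k (‖y‖ ^ 2)) y =
      2 * f1 (‖y‖ ^ 2) * (k * Pk l k z y) := by
    rw [← Pk_euler, ← sum_coord_pd, Finset.mul_sum]
    refine Finset.sum_congr rfl fun i _ => ?_
    rw [pd_radial i (hd1 _)]; ring
  have hode := hE.ode (2 * n + 4 * k) l (‖y‖ ^ 2)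
  have h2 := ((ra_EB hn hl N (k + 2)).hasSum (‖y‖ ^ 2)).mul_left l
  have h3 := hode.unique (h2.congr_fun' fun m => by rw [ra_rec hn]; ring)
  rw [lap_mul hP hr, hlr, hcross]
  have h3' : 4 * ‖y‖ ^ 2 * f2 (‖y‖ ^ 2) + (2 * n + 4 * k) * f1 (‖y‖ ^ 2) + l * rA n l N k (‖y‖ ^ 2)
    = l * rA n l N (k + 2) (‖y‖ ^ 2) := h3
  linear_combination (Pk l k z y) * h3'

def uN {n : ℕ} (l : ℝ) (N : ℕ) (z y : EE n) : ℝ :=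
  ∑ k ∈ Finset.range (N + 3), Pk l k z y * rA n l N k (‖y‖ ^ 2)

lemma uN_contDiff {n : ℕ} (hn : 2 ≤ n) {l : ℝ} (hl : 0 ≤ l) (N : ℕ) (z : EE n) :
    ContDiff ℝ (⊤ : ℕ∞) (uN l N z) :=
  ContDiff.sum fun k _ => (Pk_contDiff l k z).mul
    ((rA_contDiff hn hl N k).comp (contDiff_id.norm_sq ℝ))

lemma uN_helm {n : ℕ} (hn : 2 ≤ n) {l : ℝ} (hl : 0 ≤ l) (N : ℕ) {z : EE n} (hz : z ≠ 0) (y : EE n) :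
    lap (uN l N z) y + l * uN l N z y = 0 := by
  have hc : ∀ k ∈ Finset.range (N + 3), ContDiff ℝ 2 (fun y : EE n => Pk l k z y * rA n l N k (‖y‖ ^ 2)) :=
    fun k _ => contDiff_infty.1 ((Pk_contDiff l k z).mul
      ((rA_contDiff hn hl N k).comp (contDiff_id.norm_sq ℝ))) 2
  have e : lap (uN l N z) y = _ := lap_sum (Finset.range (N + 3)) hc y
  rw [e, uN, Finset.mul_sum, ← Finset.sum_add_distrib]
  simp only [lap_term hn hl, Finset.sum_add_distrib]
  rw [Finset.sum_range_succ, Finset.sum_range_succ, rA_zero l N (N + 1 + 2) (by omega),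
    rA_zero l N (N + 2 + 2) (by omega), Finset.sum_range_succ' _ (N + 2),
    Finset.sum_range_succ' _ (N + 1), lap_Pk_small l (by omega : 0 < 2),
    lap_Pk_small l (by omega : 0 + 1 < 2)]
  simp only [mul_zero, zero_mul, add_zero]
  rw [← Finset.sum_add_distrib]
  refine Finset.sum_eq_zero fun k _ => ?_
  rw [show k + 1 + 1 = k + 2 from rfl, lap_Pk hn hl k hz]; ring

lemma rA_sub_one {n : ℕ} (hn : 2 ≤ n) {l : ℝ} (hl : 0 ≤ l) (N k : ℕ) (hk : k ≤ N) {x B : ℝ}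
    (hx : |x| ≤ B) :
    |rA n l N k x - 1| ≤ (1 / 2) ^ (N - k) * Real.exp (4 * l * B) := by
  have hE := ra_EB hn hl N k
  have hEB : EB (fun m => ra n l N m k - if m = 0 then 1 else 0) ((1 / 2) ^ (N - k)) (4 * l) := by
    intro m
    rcases m with _ | m
    · simp [ra, hk]
    · simp only [Nat.add_eq_zero_iff, one_ne_zero, and_false, if_false, sub_zero]
      by_cases h : k + 2 * (m + 1) ≤ N
      · rw [ra_zero' l N k m h]; simp; positivity
      · have h1 := hE (m + 1)
        rw [one_mul] at h1
        refine h1.trans ?_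
        rw [mul_pow, ← mul_assoc]
        have : (1:ℝ) ≤ (1 / 2) ^ (N - k) * 4 ^ (m + 1) := by
          have e4 : (4:ℝ) ^ (m + 1) = 2 ^ (2 * (m + 1)) := by rw [pow_mul]; norm_num
          have : (2:ℝ) ^ (N - k) ≤ 2 ^ (2 * (m + 1)) :=
            pow_le_pow_right₀ (by norm_num) (by omega)
          rw [e4, one_div, inv_pow, ← div_eq_inv_mul, le_div_iff₀ (by positivity), one_mul]
          exact this
        have hp : 0 ≤ l ^ (m + 1) := pow_nonneg hl _
        nlinarith
  have e : rA n l N k x - 1 = egf (fun m => ra n l N m k - if m = 0 then 1 else 0) x := by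
    have h1 := hE.hasSum x
    have h2 : HasSum (fun m : ℕ => (if m = 0 then (1:ℝ) else 0) * (x ^ m / m.factorial)) 1 := by
      have := hasSum_ite_eq (0:ℕ) (1:ℝ)
      refine this.congr_fun' fun m => ?_
      by_cases h : m = 0 <;> simp [h]
    have h3 := (h1.sub h2).congr_fun' (g := fun m : ℕ =>
      (ra n l N m k - if m = 0 then (1:ℝ) else 0) * (x ^ m / m.factorial)) (fun m => by ring)
    exact h3.tsum_eq.symm
  rw [e]
  refine (hEB.abs_egf_le x).trans ?_
  gcongr

lemma runge {n : ℕ} (hn : 2 ≤ n) {l : ℝ} (hl : 0 ≤ l) {z : EE n} (hz : z ≠ 0) {R : ℝ}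
    (hR : R ≤ ‖z‖ / 32) {ε : ℝ} (hε : 0 < ε) :
    ∃ u : EE n → ℝ, ContDiff ℝ (⊤ : ℕ∞) u ∧ (∀ y, lap u y + l * u y = 0) ∧
      ∀ y, ‖y‖ ≤ R → |u y - phi n l 0 (‖z + y‖ ^ 2)| ≤ ε := by
  have hz0 : 0 < ‖z‖ := norm_pos_iff.2 hz
  set M := MM n l (‖z‖ ^ 2) (‖z‖ ^ 2) with hM
  have hM0 : 0 ≤ M := MM_nonneg
  set C := M * (Real.exp (4 * l * R ^ 2) + 2) with hC
  have ht : Tendsto (fun N : ℕ => C * ((N:ℝ) * (1 / 2) ^ N + (1 / 2) ^ N)) atTop (𝓝 0) := by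
    have h1 := tendsto_self_mul_const_pow_of_lt_one (r := (1 / 2 : ℝ)) (by norm_num) (by norm_num)
    have h2 := tendsto_pow_atTop_nhds_zero_of_lt_one (r := (1 / 2 : ℝ)) (by norm_num) (by norm_num)
    simpa using (h1.add h2).const_mul C
  obtain ⟨N, hN⟩ := (ht.eventually (gt_mem_nhds hε)).exists
  refine ⟨uN l N z, uN_contDiff hn hl N z, uN_helm hn hl N hz, fun y hy => ?_⟩
  have hP : ∀ k, |Pk l k z y| ≤ M * (1 / 2) ^ k := by
    intro k
    refine (Pk_abs_le hn hl (by positivity) le_rfl le_rfl k y).trans ?_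
    have : 16 * (‖y‖ / ‖z‖) ≤ 1 / 2 := by
      rw [← mul_div_assoc, div_le_iff₀ hz0]; linarith
    gcongr
  have hsum := Pk_hasSum hn hl hz (hy.trans hR)
  have h1 := norm_sub_le_of_geometric_bound_of_hasSum (r := 1 / 2) (C := M) (by norm_num) hP hsum (N + 1)
  have h2 : uN l N z y - ∑ k ∈ Finset.range (N + 1), Pk l k z y =
      ∑ k ∈ Finset.range (N + 1), Pk l k z y * (rA n l N k (‖y‖ ^ 2) - 1) := by
    rw [uN, Finset.sum_range_succ, Finset.sum_range_succ, rA_zero l N (N + 1) (by omega),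
      rA_zero l N (N + 2) (by omega), mul_zero, mul_zero, add_zero, add_zero,
      ← Finset.sum_sub_distrib]
    exact Finset.sum_congr rfl fun k _ => by ring
  have h3 : |uN l N z y - ∑ k ∈ Finset.range (N + 1), Pk l k z y| ≤
      (N + 1) * (M * (1 / 2) ^ N * Real.exp (4 * l * R ^ 2)) := by
    rw [h2]
    refine (Finset.abs_sum_le_sum_abs _ _).trans ?_
    refine (Finset.sum_le_card_nsmul _ _ (M * (1 / 2) ^ N * Real.exp (4 * l * R ^ 2)) ?_).trans ?_
    · intro k hk
      have hk' : k ≤ N := by have := Finset.mem_range.1 hk; omega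
      rw [abs_mul]
      have hb : |‖y‖ ^ 2| ≤ R ^ 2 := by
        rw [abs_of_nonneg (by positivity)]; gcongr
      calc _ ≤ (M * (1 / 2) ^ k) * ((1 / 2) ^ (N - k) * Real.exp (4 * l * R ^ 2)) := by
            gcongr
            · exact hP k
            · exact rA_sub_one hn hl N k hk' hb
        _ = M * ((1 / 2) ^ k * (1 / 2) ^ (N - k)) * Real.exp (4 * l * R ^ 2) := by ring
        _ = _ := by rw [← pow_add, Nat.add_sub_cancel' hk']
    · rw [Finset.card_range, nsmul_eq_mul]; push_cast; exact le_rfl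
  rw [Real.norm_eq_abs] at h1
  have h4 : M * (1 / 2) ^ (N + 1) / (1 - 1 / 2) = M * (1 / 2) ^ N := by
    rw [pow_succ]; ring
  rw [h4] at h1
  calc _ = |(uN l N z y - ∑ k ∈ Finset.range (N + 1), Pk l k z y) +
        (∑ k ∈ Finset.range (N + 1), Pk l k z y - phi n l 0 (‖z + y‖ ^ 2))| := by congr 1; ring
    _ ≤ _ := abs_add_le _ _
    _ ≤ (N + 1) * (M * (1 / 2) ^ N * Real.exp (4 * l * R ^ 2)) + M * (1 / 2) ^ N := add_le_add h3 h1
    _ ≤ C * ((N:ℝ) * (1 / 2) ^ N + (1 / 2) ^ N) := by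
      rw [hC]
      have : 0 ≤ M * ((N:ℝ) * (1 / 2) ^ N) := by positivity
      have : 0 ≤ M * ((1 / 2) ^ N) := by positivity
      nlinarith
    _ ≤ ε := hN.le

end

end

section
open Metric Set Filter MeasureTheory
open scoped RealInnerProductSpace Topology

noncomputable section

/-- fundamental kernel -/
def kk {n : ℕ} (l : ℝ) (z : EE n) : ℝ := phi n l 0 (‖z‖ ^ 2)

/-- potential -/
def ww {n : ℕ} (l : ℝ) (μ : Measure (EE n)) (x : EE n) : ℝ := ∫ y, kk l (x - y) ∂μ

lemma phi_continuousOn {n : ℕ} (hn : 2 ≤ n) {l : ℝ} (hl : 0 ≤ l) (m : ℕ) :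
    ContinuousOn (phi n l m) (Ioi 0) := fun _ hs =>
  (phi_hasDerivAt hn hl m hs).continuousAt.continuousWithinAt

lemma phi_norm_continuousOn {n : ℕ} (hn : 2 ≤ n) {l : ℝ} (hl : 0 ≤ l) (m : ℕ) :
    ContinuousOn (fun z : EE n => phi n l m (‖z‖ ^ 2)) {0}ᶜ := by
  refine (phi_continuousOn hn hl m).comp (by fun_prop) ?_
  intro z hz
  have : 0 < ‖z‖ := norm_pos_iff.2 hz
  simp only [mem_Ioi]; positivity

lemma Pk_continuousOn {n : ℕ} (hn : 2 ≤ n) {l : ℝ} (hl : 0 ≤ l) (k : ℕ) (v : EE n) :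
    ContinuousOn (fun z : EE n => Pk l k z v) {0}ᶜ := by
  unfold Pk
  refine continuousOn_finset_sum _ fun j _ => ?_
  refine (phi_norm_continuousOn hn hl _).mul ?_
  unfold Qq
  fun_prop

lemma measurable_off_zero {n : ℕ} {g : EE n → ℝ} (hg : ContinuousOn g {0}ᶜ) : Measurable g :=
  measurable_of_continuousOn_compl_singleton 0 hg

lemma kk_measurable {n : ℕ} (hn : 2 ≤ n) {l : ℝ} (hl : 0 ≤ l) : Measurable (kk (n := n) l) :=
  measurable_off_zero (phi_norm_continuousOn hn hl 0)

lemma meas_shift {n : ℕ} {g : EE n → ℝ} (hg : ContinuousOn g {0}ᶜ) (x : EE n) :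
    Measurable (fun y => g (x - y)) :=
  (measurable_off_zero hg).comp (measurable_const.sub measurable_id)

lemma kk_abs_le {n : ℕ} (hn : 2 ≤ n) {l : ℝ} (hl : 0 ≤ l) {d R : ℝ} (hd : 0 < d) {z : EE n}
    (hz1 : d ≤ ‖z‖ ^ 2) (hz2 : ‖z‖ ^ 2 ≤ R) : |kk l z| ≤ MM n l d R := by
  have := phi_le hn hl 0 hd hz1 hz2
  simpa [kk] using this

lemma integrable_of_bdd {n : ℕ} {μ : Measure (EE n)} [IsFiniteMeasure μ] {K : Set (EE n)}
    (hμK : ∀ᵐ y ∂μ, y ∈ K) {f : EE n → ℝ} (hf : Measurable f) {C : ℝ} (h : ∀ y ∈ K, |f y| ≤ C) :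
    Integrable f μ :=
  Integrable.mono' (integrable_const C) hf.aestronglyMeasurable
    (hμK.mono fun y hy => h y hy)

lemma ww_far {n : ℕ} (hn : 2 ≤ n) {l : ℝ} (hl : 0 ≤ l) {μ : Measure (EE n)} [IsFiniteMeasure μ]
    {K : Set (EE n)} (hμK : ∀ᵐ y ∂μ, y ∈ K) {R : ℝ} (hR : ∀ y ∈ K, ‖y‖ ≤ R) (hR0 : 0 ≤ R)
    (hμ : ∀ u : EE n → ℝ, ContDiff ℝ (⊤ : ℕ∞) u → (∀ y, lap u y + l * u y = 0) → ∫ y, u y ∂μ = 0)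
    {x : EE n} (hx : 32 * (R + 1) ≤ ‖x‖) : ww l μ x = 0 := by
  have hx0 : x ≠ 0 := by rintro rfl; simp at hx; linarith
  have hnx : ‖-x‖ = ‖x‖ := norm_neg x
  have key : ∀ ε > 0, |ww l μ x| ≤ ε * μ.real univ := by
    intro ε hε
    obtain ⟨u, hu1, hu2, hu3⟩ := runge hn hl (z := -x) (neg_ne_zero.2 hx0) (R := R)
      (by rw [hnx]; linarith) hε
    have hb : ∀ y ∈ K, |u y - kk l (x - y)| ≤ ε := by
      intro y hy
      have := hu3 y (hR y hy)
      unfold kk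
      rwa [show -x + y = -(x - y) by abel, norm_neg] at this
    have hm : Measurable (fun y => u y - kk l (x - y)) :=
      hu1.continuous.measurable.sub (meas_shift (phi_norm_continuousOn hn hl 0) x)
    have hi := integrable_of_bdd hμK hm hb
    have hiu : Integrable u μ := by
      obtain ⟨C, hC⟩ := (isCompact_closedBall (0 : EE n) R).exists_bound_of_continuousOn
        hu1.continuous.continuousOn
      exact integrable_of_bdd hμK hu1.continuous.measurable
        (fun y hy => hC y (by simpa using hR y hy))
    have hik : Integrable (fun y => kk l (x - y)) μ := by
      have := hiu.sub hi
      refine this.congr (Eventually.of_forall fun y => ?_)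
      simp
    have e : ∫ y, (u y - kk l (x - y)) ∂μ = - ww l μ x := by
      rw [integral_sub hiu hik, hμ u hu1 hu2, zero_sub, ww]
    rw [← abs_neg, ← e]
    have hb2 : ∀ᵐ y ∂μ, ‖u y - kk l (x - y)‖ ≤ ε := by
      filter_upwards [hμK] with y hy
      rw [Real.norm_eq_abs]; exact hb y hy
    have := norm_integral_le_of_norm_le_const hb2
    rwa [Real.norm_eq_abs] at this
  have : |ww l μ x| ≤ 0 := by
    refine ge_of_tendsto (x := 𝓝[>] (0:ℝ)) (f := fun ε : ℝ => ε * μ.real univ) ?_ ?_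
    · have : Tendsto (fun ε : ℝ => ε * μ.real univ) (𝓝 0) (𝓝 (0 * μ.real univ)) :=
        (continuous_id.mul continuous_const).tendsto 0
      rw [zero_mul] at this
      exact this.mono_left nhdsWithin_le_nhds
    · exact eventually_mem_nhdsWithin.mono fun ε hε => key ε hε
  exact abs_nonpos_iff.1 this

lemma coeff_zero {c : ℕ → ℝ} (h : ∀ᶠ t in 𝓝 (0:ℝ), HasSum (fun k => t ^ k * c k) 0) :
    ∀ k, c k = 0 := by
  have h1 : HasFPowerSeriesAt (fun _ : ℝ => (0:ℝ)) (FormalMultilinearSeries.ofScalars ℝ c) 0 := by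
    rw [hasFPowerSeriesAt_iff]
    filter_upwards [h] with t ht
    refine ht.congr_fun' fun k => ?_
    simp [FormalMultilinearSeries.coeff_ofScalars]
  have h2 := HasFPowerSeriesAt.eq_zero h1
  intro k
  have := FormalMultilinearSeries.coeff_ofScalars (p := c) (n := k) (𝕜 := ℝ)
  rw [h2] at this
  rw [← this]; simp [FormalMultilinearSeries.coeff]

/-- local power expansion of the potential -/
lemma ww_hasSum {n : ℕ} (hn : 2 ≤ n) {l : ℝ} (hl : 0 ≤ l) {μ : Measure (EE n)} [IsFiniteMeasure μ]
    {K : Set (EE n)} (hμK : ∀ᵐ y ∂μ, y ∈ K) {d R : ℝ} (hd : 0 < d) {x v : EE n}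
    (h1 : ∀ y ∈ K, d ≤ ‖x - y‖) (h2 : ∀ y ∈ K, ‖x - y‖ ≤ R) (hv : ‖v‖ ≤ d / 32) :
    HasSum (fun k => ∫ y, Pk l k (x - y) v ∂μ) (ww l μ (x + v)) := by
  set M := MM n l (d ^ 2) (R ^ 2) with hM
  have hM0 : 0 ≤ M := MM_nonneg
  have hb : ∀ k, ∀ y ∈ K, |Pk l k (x - y) v| ≤ M * (1 / 2) ^ k := by
    intro k y hy
    have hy1 := h1 y hy
    have hy2 := h2 y hy
    have hp : 0 < ‖x - y‖ := hd.trans_le hy1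
    refine (Pk_abs_le hn hl (d := d ^ 2) (R := R ^ 2) (by positivity) (by gcongr)
      (by gcongr) k v).trans ?_
    have : 16 * (‖v‖ / ‖x - y‖) ≤ 1 / 2 := by
      rw [← mul_div_assoc, div_le_iff₀ hp]; linarith
    gcongr
  have hi : ∀ k, Integrable (fun y => Pk l k (x - y) v) μ := fun k =>
    integrable_of_bdd hμK (meas_shift (Pk_continuousOn hn hl k v) x) (hb k)
  have := hasSum_integral_of_summable_integral_norm hi (by
    refine Summable.of_nonneg_of_le (fun k => integral_nonneg fun _ => norm_nonneg _)
      (f := fun k => (M * μ.real univ) * (1 / 2) ^ k) (fun k => ?_)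
      ((summable_geometric_of_lt_one (by norm_num) (by norm_num)).mul_left _)
    calc ∫ y, ‖Pk l k (x - y) v‖ ∂μ ≤ ∫ _, M * (1 / 2) ^ k ∂μ :=
          integral_mono_ae (hi k).norm (integrable_const _) (hμK.mono fun y hy => hb k y hy)
      _ = _ := by rw [integral_const, smul_eq_mul]; ring)
  have e : ∫ y, (∑' k, Pk l k (x - y) v) ∂μ = ww l μ (x + v) := by
    unfold ww
    refine integral_congr_ae (hμK.mono fun y hy => ?_)
    have hy1 := h1 y hy
    have hz : x - y ≠ 0 := by
      intro h; rw [h, norm_zero] at hy1; linarith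
    have := (Pk_hasSum hn hl hz (v := v) (by linarith)).tsum_eq
    simp only [this, kk]
    congr 3; abel
  rw [e] at this
  exact this

lemma ww_uc_local {n : ℕ} (hn : 2 ≤ n) {l : ℝ} (hl : 0 ≤ l) {μ : Measure (EE n)} [IsFiniteMeasure μ]
    {K : Set (EE n)} (hμK : ∀ᵐ y ∂μ, y ∈ K) {d R : ℝ} (hd : 0 < d) {x : EE n}
    (h1 : ∀ y ∈ K, d ≤ ‖x - y‖) (h2 : ∀ y ∈ K, ‖x - y‖ ≤ R)
    (hx : ∀ᶠ x' in 𝓝 x, ww l μ x' = 0) {v : EE n} (hv : ‖v‖ ≤ d / 32) : ww l μ (x + v) = 0 := by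
  have hc : ∀ k, ∫ y, Pk l k (x - y) v ∂μ = 0 := by
    apply coeff_zero
    have ht : Tendsto (fun t : ℝ => x + t • v) (𝓝 0) (𝓝 x) := by
      have : Continuous (fun t : ℝ => x + t • v) := by fun_prop
      simpa using this.tendsto 0
    filter_upwards [ht.eventually hx, Metric.ball_mem_nhds (0:ℝ) one_pos] with t ht1 ht2
    have htv : ‖t • v‖ ≤ d / 32 := by
      rw [norm_smul]
      have : ‖t‖ ≤ 1 := by simpa using (mem_ball_zero_iff.1 ht2).le
      nlinarith [norm_nonneg v, norm_nonneg t]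
    have := ww_hasSum hn hl hμK hd h1 h2 htv
    rw [ht1] at this
    refine this.congr_fun' fun k => ?_
    rw [← integral_const_mul]
    simp only [Pk_smul]
  have := ww_hasSum hn hl hμK hd h1 h2 hv
  simp only [hc] at this
  exact this.unique hasSum_zero

lemma ww_uc {n : ℕ} (hn : 2 ≤ n) {l : ℝ} (hl : 0 ≤ l) {μ : Measure (EE n)} [IsFiniteMeasure μ]
    {K : Set (EE n)} (hK : IsCompact K) (hKne : K.Nonempty) (hμK : ∀ᵐ y ∂μ, y ∈ K)
    (hμ : ∀ u : EE n → ℝ, ContDiff ℝ (⊤ : ℕ∞) u → (∀ y, lap u y + l * u y = 0) → ∫ y, u y ∂μ = 0)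
    {Ω : Set (EE n)} (hΩ : IsConnected Ω) (hΩK : Disjoint Ω K)
    (hΩb : Bornology.IsBounded Ωᶜ) {x : EE n} (hx : x ∈ Ω) : ww l μ x = 0 := by
  obtain ⟨R, hR0, hR⟩ : ∃ R, 0 ≤ R ∧ ∀ y ∈ K, ‖y‖ ≤ R := by
    obtain ⟨R, hR⟩ := hK.isBounded.exists_norm_le
    exact ⟨max R 0, le_max_right _ _, fun y hy => (hR y hy).trans (le_max_left _ _)⟩
  set Z := interior {x | ww l μ x = 0} with hZ
  have hfar : ∀ x : EE n, 32 * (R + 1) < ‖x‖ → x ∈ Z := by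
    intro x hx
    rw [hZ, mem_interior]
    refine ⟨{x | 32 * (R + 1) < ‖x‖}, fun x' hx' => ww_far hn hl hμK hR hR0 hμ (le_of_lt hx'),
      isOpen_lt continuous_const continuous_norm, hx⟩
  have hne : (Ω ∩ Z).Nonempty := by
    obtain ⟨R', hR'⟩ := hΩb.exists_norm_le
    haveI : Nontrivial (EE n) := by
      haveI : Nonempty (Fin n) := ⟨⟨0, by omega⟩⟩
      infer_instance
    obtain ⟨x', hx'⟩ := NormedSpace.exists_lt_norm ℝ (EE n) (max R' (32 * (R + 1)))
    refine ⟨x', ?_, hfar x' ((le_max_right _ _).trans_lt hx')⟩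
    by_contra hcon
    have := hR' x' hcon
    exact absurd ((le_max_left R' _).trans_lt hx') (not_lt.2 this)
  have hsub : Ω ⊆ Z := by
    refine hΩ.isPreconnected.subset_of_closure_inter_subset isOpen_interior hne ?_
    rintro x0 ⟨hx0, hx0Ω⟩
    have hx0K : x0 ∉ K := disjoint_left.1 hΩK hx0Ω
    set d := infDist x0 K with hd
    have hd0 : 0 < d := (hK.isClosed.notMem_iff_infDist_pos hKne).1 hx0K
    obtain ⟨x1, hx1Z, hx1⟩ := Metric.mem_closure_iff.1 hx0 (d / 128) (by positivity)
    have h1 : ∀ y ∈ K, d / 2 ≤ ‖x1 - y‖ := by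
      intro y hy
      have ha : d ≤ dist x0 y := infDist_le_dist_of_mem hy
      have hb := dist_triangle x0 x1 y
      rw [← dist_eq_norm]; linarith
    have h2 : ∀ y ∈ K, ‖x1 - y‖ ≤ ‖x1‖ + R := fun y hy =>
      (norm_sub_le _ _).trans (by linarith [hR y hy])
    have hev : ∀ᶠ x' in 𝓝 x1, ww l μ x' = 0 := mem_interior_iff_mem_nhds.1 hx1Z
    rw [hZ, mem_interior]
    refine ⟨ball x1 (d / 64), fun x' hx' => ?_, isOpen_ball, ?_⟩
    · have := ww_uc_local hn hl hμK (half_pos hd0) h1 h2 hev (v := x' - x1)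
        (by rw [← dist_eq_norm]; have := mem_ball.1 hx'; linarith)
      simpa using this
    · rw [mem_ball]; linarith
  have hxx : x ∈ interior {x | ww l μ x = 0} := hsub hx
  have hxy : x ∈ {x | ww l μ x = 0} := interior_subset hxx
  exact hxy

end

end

section
open Metric Set Filter MeasureTheory
open scoped RealInnerProductSpace Topology

noncomputable section

/-- exterior cone type condition -/
def ExtCone {n : ℕ} (D : Set (EE n)) : Prop :=
  ∀ x0 ∈ frontier D, ∃ (e : EE n) (c t0 : ℝ), 0 < c ∧ c ≤ 1 ∧ 0 < t0 ∧ ∀ t, 0 < t → t < t0 →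
    x0 - t • e ∉ closure D ∧ ∀ y ∈ frontier D, c * ‖x0 - y‖ ≤ ‖x0 - t • e - y‖

lemma cone_aux {n : ℕ} {D : Set (EE n)} (hDo : IsOpen D) {x0 : EE n} (hx0 : x0 ∈ frontier D)
    {e : EE n} {φ : EE n → ℝ} {ρ : ℝ} (he : ‖e‖ = 1) (hρ : 0 < ρ)
    (hD : ∀ x ∈ ball x0 ρ, (x ∈ D ↔ φ (x - ⟪x, e⟫ • e) < ⟪x, e⟫))
    (hL : ∃ L : NNReal, ∃ t ∈ 𝓝 x0, LipschitzOnWith L (fun x => φ (x - ⟪x, e⟫ • e) - ⟪x, e⟫) t) :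
    ∃ (e : EE n) (c t0 : ℝ), 0 < c ∧ c ≤ 1 ∧ 0 < t0 ∧ ∀ t, 0 < t → t < t0 →
    x0 - t • e ∉ closure D ∧ ∀ y ∈ frontier D, c * ‖x0 - y‖ ≤ ‖x0 - t • e - y‖ := by
  obtain ⟨L, T, hT, hLT⟩ := hL
  set f : EE n → ℝ := fun x => φ (x - ⟪x, e⟫ • e) - ⟪x, e⟫ with hf
  obtain ⟨r1, hr1, hr1T⟩ := Metric.mem_nhds_iff.1 hT
  set r := min r1 ρ with hr
  have hr0 : 0 < r := lt_min hr1 hρ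
  have hLr : LipschitzOnWith L f (ball x0 r) :=
    hLT.mono ((ball_subset_ball (min_le_left _ _)).trans hr1T)
  have hDr : ∀ x ∈ ball x0 r, (x ∈ D ↔ f x < 0) := fun x hx => by
    rw [hD x (ball_subset_ball (min_le_right _ _) hx), hf]; simp
  have hfc : ContinuousOn f (ball x0 r) := hLr.continuousOn
  have hcl : ∀ x ∈ ball x0 r, x ∈ closure D → f x ≤ 0 := by
    intro x hx hxD
    by_contra hcon
    push Not at hcon
    have h1 : ∀ᶠ y in 𝓝 x, 0 < f y :=
      ((hfc x hx).continuousAt (isOpen_ball.mem_nhds hx)).eventually (lt_mem_nhds hcon)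
    have h2 : ∀ᶠ y in 𝓝 x, y ∈ ball x0 r := isOpen_ball.mem_nhds hx
    obtain ⟨y, ⟨hy1, hy2⟩, hyD⟩ := mem_closure_iff_nhds.1 hxD _ (h1.and h2)
    have := (hDr y hy2).1 hyD
    exact absurd hy1 (not_lt.2 this.le)
  have hfr : ∀ x ∈ ball x0 r, x ∈ frontier D → f x = 0 := by
    intro x hx hxf
    refine le_antisymm (hcl x hx (frontier_subset_closure hxf)) ?_
    by_contra hcon
    push Not at hcon
    have h1 : x ∈ D := (hDr x hx).2 hcon
    rw [hDo.frontier_eq] at hxf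
    exact hxf.2 h1
  have hft : ∀ t : ℝ, f (x0 - t • e) = f x0 + t := by
    intro t
    have h1 : ⟪x0 - t • e, e⟫ = ⟪x0, e⟫ - t := by
      rw [inner_sub_left, inner_smul_left, real_inner_self_eq_norm_sq, he]; simp
    have h2 : x0 - t • e - ⟪x0 - t • e, e⟫ • e = x0 - ⟪x0, e⟫ • e := by
      rw [h1, sub_smul]; abel
    change φ (x0 - t • e - ⟪x0 - t • e, e⟫ • e) - ⟪x0 - t • e, e⟫ =
      φ (x0 - ⟪x0, e⟫ • e) - ⟪x0, e⟫ + t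
    rw [h2, h1]; ring
  have hx0b : x0 ∈ ball x0 r := mem_ball_self hr0
  refine ⟨e, 1 / (2 + L), r / 2, by positivity, ?_, by positivity, fun t ht0 ht => ?_⟩
  · rw [div_le_one (by positivity)]; have := L.2; linarith [L.coe_nonneg]
  have hte : ‖t • e‖ = t := by rw [norm_smul, he, Real.norm_of_nonneg ht0.le, mul_one]
  have hxt : x0 - t • e ∈ ball x0 r := by
    rw [mem_ball, dist_eq_norm]; simp [hte]; linarith
  have hft0 : f (x0 - t • e) = t := by rw [hft, hfr x0 hx0b hx0, zero_add]
  refine ⟨fun hc => ?_, fun y hy => ?_⟩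
  · have := hcl _ hxt hc
    linarith
  have htri : ‖x0 - y‖ ≤ ‖x0 - t • e - y‖ + t := by
    calc ‖x0 - y‖ = ‖(x0 - t • e - y) + t • e‖ := by congr 1; abel
      _ ≤ _ := (norm_add_le _ _).trans (by rw [hte])
  have hL0 : (0:ℝ) ≤ L := L.coe_nonneg
  rw [one_div, inv_mul_le_iff₀ (by positivity)]
  by_cases hyb : y ∈ ball x0 r
  · have := hLr.dist_le_mul _ hxt _ hyb
    rw [hft0, hfr y hyb hy, Real.dist_eq, sub_zero, abs_of_pos ht0, dist_eq_norm] at this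
    nlinarith [norm_nonneg (x0 - t • e - y)]
  · have : r ≤ ‖x0 - y‖ := by
      rw [← dist_eq_norm, dist_comm]; simpa using hyb
    nlinarith [norm_nonneg (x0 - t • e - y)]

lemma extCone_of {n : ℕ} {D : Set (EE n)} (hDo : IsOpen D)
    (hdom : IsC1Domain D ∨ IsLipschitzDomain D) : ExtCone D := by
  intro x0 hx0
  rcases hdom with h | h
  · obtain ⟨e, φ, ρ, he, hρ, hφ, hD⟩ := h x0 hx0
    refine cone_aux hDo hx0 he hρ hD ?_
    apply ContDiffAt.exists_lipschitzOnWith (𝕂 := ℝ)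
    apply ContDiff.contDiffAt
    have h1 : ContDiff ℝ 1 (fun x : EE n => ⟪x, e⟫) := contDiff_id.inner ℝ contDiff_const
    exact (hφ.comp (contDiff_id.sub (h1.smul contDiff_const))).sub h1
  · obtain ⟨e, L, φ, ρ, he, hρ, hφ, hD⟩ := h x0 hx0
    refine cone_aux hDo hx0 he hρ hD ?_
    have h1 : ContDiff ℝ 1 (fun x : EE n => ⟪x, e⟫) := contDiff_id.inner ℝ contDiff_const
    have h2 : ContDiff ℝ 1 (fun x : EE n => x - ⟪x, e⟫ • e) :=
      contDiff_id.sub (h1.smul contDiff_const)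
    obtain ⟨L1, T1, hT1, hL1⟩ := ContDiffAt.exists_lipschitzOnWith (𝕂 := ℝ) (h1.contDiffAt (x := x0))
    obtain ⟨L2, T2, hT2, hL2⟩ := ContDiffAt.exists_lipschitzOnWith (𝕂 := ℝ) (h2.contDiffAt (x := x0))
    refine ⟨L * L2 + L1, T1 ∩ T2, inter_mem hT1 hT2, ?_⟩
    have h3 := hφ.comp_lipschitzOnWith (hL2.mono inter_subset_right (s := T1 ∩ T2))
    have h4 := hL1.mono inter_subset_left (s := T1 ∩ T2)
    exact h3.sub h4

/-- comparison of kernels at comparable radii -/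
lemma AI_compare {n : ℕ} {l : ℝ} (hl : 0 ≤ l) {a : ℝ} (ha : 0 < a) (ha1 : a ≤ 1) :
    ∃ C, 0 ≤ C ∧ ∀ σ, 0 < σ → AI n l (Ioi 1) 0 (a * σ) ≤ C * (AI n l (Ioi 1) 0 σ + 1) := by
  set p : ℝ := (n : ℝ) / 2 - 2 with hp
  have hap : 0 < a ^ (-p) := Real.rpow_pos_of_pos ha _
  have hNint : IntegrableOn (fun u => Nw n l u) (Ioc a 1) := by
    have h : ContinuousOn (gw n l 0 0) (Icc a 1) :=
      gw_continuousOn.mono fun u hu => ha.trans_le hu.1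
    have h2 := (h.integrableOn_Icc).mono_set Ioc_subset_Icc_self (μ := volume)
    have e0 : gw n l 0 0 = fun u => Nw n l u := by funext u; simp [gw]
    rwa [e0] at h2
  set J := ∫ u in Ioc a 1, Nw n l u with hJ
  have hJ0 : 0 ≤ J := setIntegral_nonneg measurableSet_Ioc fun u hu => Nw_nonneg (ha.trans hu.1).le
  refine ⟨a⁻¹ * a ^ (-p) * (1 + J), by positivity, fun σ hσ => ?_⟩
  have hA0 : 0 ≤ AI n l (Ioi 1) 0 σ := AI_nonneg 0 measurableSet_Ioi (Ioi_subset_Ioi zero_le_one)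
  have e1 : AI n l (Ioi 1) 0 (a * σ) = a⁻¹ * ∫ u in Ioi a, Nw n l (u / a) * Real.exp (-(σ * u)) := by
    have := integral_comp_mul_left_Ioi (fun u => Nw n l (u / a) * Real.exp (-(σ * u))) 1 ha
    rw [mul_one, smul_eq_mul] at this
    rw [← this, AI]
    refine integral_congr_ae (Eventually.of_forall fun s => ?_)
    simp only [gw, pow_zero, one_mul]
    rw [mul_div_cancel_left₀ _ ha.ne']
    congr 3; ring
  have hle : ∀ u ∈ Ioi a, Nw n l (u / a) * Real.exp (-(σ * u)) ≤ a ^ (-p) * gw n l 0 σ u := by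
    intro u hu
    have hu0 : 0 < u := ha.trans hu
    have : Nw n l (u / a) ≤ a ^ (-p) * Nw n l u := by
      unfold Nw
      rw [Real.div_rpow hu0.le ha.le, ← hp, Real.rpow_neg ha.le]
      have h1 : Real.exp (l / (4 * (u / a))) ≤ Real.exp (l / (4 * u)) := by
        apply Real.exp_le_exp.2
        have : u ≤ u / a := by rw [le_div_iff₀ ha]; nlinarith
        gcongr
      have h2 : 0 ≤ u ^ p / a ^ p := by positivity
      calc _ ≤ Real.exp (l / (4 * u)) * (u ^ p / a ^ p) := mul_le_mul_of_nonneg_right h1 h2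
        _ = _ := by ring
    calc _ ≤ (a ^ (-p) * Nw n l u) * Real.exp (-(σ * u)) :=
          mul_le_mul_of_nonneg_right this (Real.exp_pos _).le
      _ = _ := by simp only [gw]; ring
  have hi1 : IntegrableOn (gw n l 0 σ) (Ioc a 1) :=
    ((gw_continuousOn.mono fun u (hu : u ∈ Icc a 1) => ha.trans_le hu.1).integrableOn_Icc).mono_set
      Ioc_subset_Icc_self
  have hi2 := gw_integrable (n := n) hl hσ 0
  have hu : Ioc a 1 ∪ Ioi 1 = Ioi a := Ioc_union_Ioi_eq_Ioi ha1
  have hi : IntegrableOn (gw n l 0 σ) (Ioi a) := by rw [← hu]; exact hi1.union hi2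
  have hgm : ∫ u in Ioi a, gw n l 0 σ u ≤ J + AI n l (Ioi 1) 0 σ := by
    rw [← hu, setIntegral_union (by
      rw [disjoint_left]; intro x h1 h2; exact absurd h1.2 (not_le.2 h2)) measurableSet_Ioi hi1 hi2]
    refine add_le_add ?_ le_rfl
    refine setIntegral_mono_on hi1 hNint measurableSet_Ioc fun u hu => ?_
    have hu0 : 0 < u := ha.trans hu.1
    have : Real.exp (-(σ * u)) ≤ 1 := Real.exp_le_one_iff.2 (by have := mul_pos hσ hu0; linarith)
    have h3 := Nw_nonneg (n := n) (l := l) hu0.le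
    simp only [gw, pow_zero, one_mul]
    nlinarith
  have e2 : ∫ u in Ioi a, Nw n l (u / a) * Real.exp (-(σ * u)) ≤
      a ^ (-p) * ∫ u in Ioi a, gw n l 0 σ u := by
    rw [← integral_const_mul]
    refine integral_mono_of_nonneg ?_ (hi.const_mul _) ?_
    · refine (ae_restrict_iff' measurableSet_Ioi).2 (Eventually.of_forall fun u hu => ?_)
      have hu0 : 0 < u := ha.trans hu
      exact mul_nonneg (Nw_nonneg (by positivity)) (Real.exp_pos _).le
    · exact (ae_restrict_iff' measurableSet_Ioi).2 (Eventually.of_forall hle)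
  rw [e1]
  calc _ ≤ a⁻¹ * (a ^ (-p) * (J + AI n l (Ioi 1) 0 σ)) := by
        gcongr; exact e2.trans (by gcongr)
    _ = a⁻¹ * a ^ (-p) * (J + AI n l (Ioi 1) 0 σ) := by ring
    _ ≤ a⁻¹ * a ^ (-p) * ((1 + J) * (AI n l (Ioi 1) 0 σ + 1)) := by
        gcongr; nlinarith
    _ = _ := by ring

/-- extended kernel -/
def aE {n : ℕ} (l : ℝ) (z : EE n) : ENNReal :=
  ∫⁻ s in Ioi (1:ℝ), ENNReal.ofReal (gw n l 0 (‖z‖ ^ 2) s)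

def aa {n : ℕ} (l : ℝ) (z : EE n) : ℝ := AI n l (Ioi 1) 0 (‖z‖ ^ 2)

def hh {n : ℕ} (l : ℝ) (z : EE n) : ℝ := Hm n l 0 (‖z‖ ^ 2)

lemma kk_eq {n : ℕ} (l : ℝ) (z : EE n) : kk l z = aa l z + hh l z := by
  simp [kk, aa, hh, phi]

lemma aE_eq {n : ℕ} {l : ℝ} (hl : 0 ≤ l) {z : EE n} (hz : z ≠ 0) :
    aE l z = ENNReal.ofReal (aa l z) := by
  have : 0 < ‖z‖ := norm_pos_iff.2 hz
  unfold aE aa AI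
  rw [ofReal_integral_eq_lintegral_ofReal (gw_integrable hl (by positivity) 0)]
  exact (ae_restrict_iff' measurableSet_Ioi).2 (Eventually.of_forall fun s hs =>
    gw_nonneg (le_of_lt (lt_trans zero_lt_one hs)))

lemma aE_zero {n : ℕ} (hn : 2 ≤ n) {l : ℝ} (hl : 0 ≤ l) : aE l (0 : EE n) = ⊤ := by
  by_contra hcon
  have hm : AEStronglyMeasurable (gw n l 0 0) (volume.restrict (Ioi (1:ℝ))) :=
    (gw_continuousOn.mono (Ioi_subset_Ioi zero_le_one)).aestronglyMeasurable measurableSet_Ioi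
  have hnn : 0 ≤ᵐ[volume.restrict (Ioi (1:ℝ))] gw n l 0 0 :=
    (ae_restrict_iff' measurableSet_Ioi).2 (Eventually.of_forall fun s hs =>
      gw_nonneg (le_of_lt (lt_trans zero_lt_one hs)))
  have hi : IntegrableOn (gw n l 0 0) (Ioi (1:ℝ)) := by
    refine (lintegral_ofReal_ne_top_iff_integrable hm hnn).1 ?_
    simpa [aE] using hcon
  refine not_integrableOn_Ioi_inv (a := (1:ℝ)) (Integrable.mono' hi ?_ ?_)
  · exact (measurable_inv).aestronglyMeasurable
  · refine (ae_restrict_iff' measurableSet_Ioi).2 (Eventually.of_forall fun s hs => ?_)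
    have hs1 : (1:ℝ) < s := hs
    have hs0 : 0 < s := by linarith
    rw [Real.norm_of_nonneg (by positivity)]
    simp only [gw, Nw, pow_zero, one_mul, zero_mul, neg_zero, Real.exp_zero, mul_one]
    have h1 : 1 ≤ Real.exp (l / (4 * s)) := Real.one_le_exp (by positivity)
    have h2 : s⁻¹ ≤ s ^ ((n:ℝ) / 2 - 2) := by
      rw [← Real.rpow_neg_one]
      refine Real.rpow_le_rpow_of_exponent_le hs1.le ?_
      have : (2:ℝ) ≤ n := by exact_mod_cast hn
      linarith
    have h3 : 0 < s⁻¹ := by positivity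
    nlinarith

lemma gw_ofReal_meas {n : ℕ} {l σ : ℝ} :
    AEMeasurable (fun s => ENNReal.ofReal (gw n l 0 σ s)) (volume.restrict (Ioi (1:ℝ))) :=
  ((gw_continuousOn.mono (Ioi_subset_Ioi zero_le_one)).aestronglyMeasurable
    measurableSet_Ioi).aemeasurable.ennreal_ofReal

/-- lower semicontinuity along sequences -/
lemma aE_lsc {n : ℕ} {l : ℝ} {z : ℕ → EE n} {z0 : EE n} (hz : Tendsto z atTop (𝓝 z0)) :
    aE l z0 ≤ liminf (fun k => aE l (z k)) atTop := by
  unfold aE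
  refine le_trans (le_of_eq ?_) (lintegral_liminf_le' fun k => gw_ofReal_meas)
  refine lintegral_congr fun s => ?_
  refine (Tendsto.liminf_eq ?_).symm
  refine (ENNReal.continuous_ofReal.tendsto _).comp ?_
  have : Continuous (fun z : EE n => gw n l 0 (‖z‖ ^ 2) s) := by unfold gw; fun_prop
  exact (this.tendsto z0).comp hz

lemma Hm_continuous {n : ℕ} (hn : 2 ≤ n) {l : ℝ} (hl : 0 ≤ l) (m : ℕ) : Continuous (Hm n l m) :=
  continuous_iff_continuousAt.2 fun x => (Hm_hasDerivAt hn hl m x).continuousAt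

lemma hh_continuous {n : ℕ} (hn : 2 ≤ n) {l : ℝ} (hl : 0 ≤ l) : Continuous (hh (n := n) l) :=
  (Hm_continuous hn hl 0).comp (by fun_prop)

lemma aa_continuousOn {n : ℕ} (hn : 2 ≤ n) {l : ℝ} (hl : 0 ≤ l) :
    ContinuousOn (aa (n := n) l) {0}ᶜ := by
  have := (phi_norm_continuousOn (n := n) hn hl 0).sub (hh_continuous hn hl).continuousOn
  refine this.congr fun z _ => ?_
  have := kk_eq l z
  simp only [kk] at this
  simp [this]

lemma aa_nonneg {n : ℕ} {l : ℝ} (z : EE n) : 0 ≤ aa l z :=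
  AI_nonneg 0 measurableSet_Ioi (Ioi_subset_Ioi zero_le_one)

lemma aa_anti {n : ℕ} {l : ℝ} (hl : 0 ≤ l) {z z' : EE n} (hz : z ≠ 0) (h : ‖z‖ ≤ ‖z'‖) :
    aa l z' ≤ aa l z := by
  have : 0 < ‖z‖ := norm_pos_iff.2 hz
  exact AI_anti hl (by positivity) (by gcongr) 0

lemma aa_compare {n : ℕ} {l : ℝ} (hl : 0 ≤ l) {c : ℝ} (hc : 0 < c) (hc1 : c ≤ 1) :
    ∃ C, 0 ≤ C ∧ ∀ z z' : EE n, z' ≠ 0 → c * ‖z'‖ ≤ ‖z‖ → aa l z ≤ C * (aa l z' + 1) := by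
  obtain ⟨C, hC, h⟩ := AI_compare (n := n) hl (a := c ^ 2) (by positivity) (by nlinarith)
  refine ⟨C, hC, fun z z' hz' hzz => ?_⟩
  have : 0 < ‖z'‖ := norm_pos_iff.2 hz'
  refine le_trans ?_ (h (‖z'‖ ^ 2) (by positivity))
  unfold aa
  refine AI_anti hl (by positivity) ?_ 0
  rw [← mul_pow]; gcongr

end

end

section
open Metric Set Filter MeasureTheory
open scoped RealInnerProductSpace Topology

noncomputable section

lemma aE_measurable {n : ℕ} (hn : 2 ≤ n) {l : ℝ} (hl : 0 ≤ l) : Measurable (aE (n := n) l) := by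
  classical
  have : aE (n := n) l = fun z => if z = 0 then aE l (0 : EE n) else ENNReal.ofReal (aa l z) := by
    funext z
    split_ifs with h
    · rw [h]
    · exact aE_eq hl h
  rw [this]
  exact Measurable.ite (measurableSet_singleton 0) measurable_const
    (measurable_off_zero (aa_continuousOn hn hl)).ennreal_ofReal

section
variable {n : ℕ} {l : ℝ} {μ : Measure (EE n)} [IsFiniteMeasure μ] {K : Set (EE n)}

lemma aa_int_off (hn : 2 ≤ n) (hl : 0 ≤ l) (hμK : ∀ᵐ y ∂μ, y ∈ K) {x : EE n} {d : ℝ} (hd : 0 < d)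
    (h : ∀ y ∈ K, d ≤ ‖x - y‖) : Integrable (fun y => aa l (x - y)) μ := by
  refine integrable_of_bdd hμK (meas_shift (aa_continuousOn hn hl) x) (C := AI n l (Ioi 1) 0 (d ^ 2))
    fun y hy => ?_
  rw [abs_of_nonneg (aa_nonneg _)]
  exact AI_anti hl (by positivity) (by have := h y hy; gcongr) 0

lemma hh_int (hn : 2 ≤ n) (hl : 0 ≤ l) (hK : IsCompact K) (hμK : ∀ᵐ y ∂μ, y ∈ K) (x : EE n) :
    Integrable (fun y => hh l (x - y)) μ := by
  have hc : Continuous (fun y => hh l (x - y)) := (hh_continuous hn hl).comp (by fun_prop)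
  obtain ⟨C, hC⟩ := hK.exists_bound_of_continuousOn hc.continuousOn
  exact integrable_of_bdd hμK hc.measurable hC

lemma hpot_cont (hn : 2 ≤ n) (hl : 0 ≤ l) (hK : IsCompact K) (hμK : ∀ᵐ y ∂μ, y ∈ K) :
    Continuous (fun x => ∫ y, hh l (x - y) ∂μ) := by
  have h1 : μ.restrict K = μ := Measure.restrict_eq_self_of_ae_mem hμK
  have h2 := continuous_parametric_integral_of_continuous (μ := μ) (f := fun x y : EE n => hh l (x - y))
    ((hh_continuous hn hl).comp (by fun_prop)) hK
  rwa [h1] at h2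

lemma off_ne {x : EE n} {d : ℝ} (hd : 0 < d) (h : ∀ y ∈ K, d ≤ ‖x - y‖) {y : EE n} (hy : y ∈ K) :
    x - y ≠ 0 := by
  intro h0
  have := h y hy
  rw [h0, norm_zero] at this
  linarith

lemma exists_off (hK : IsCompact K) (hKne : K.Nonempty) {x : EE n} (hx : x ∉ K) :
    ∃ d, 0 < d ∧ ∀ y ∈ K, d ≤ ‖x - y‖ :=
  ⟨infDist x K, (hK.isClosed.notMem_iff_infDist_pos hKne).1 hx, fun y hy => by
    rw [← dist_eq_norm]; exact infDist_le_dist_of_mem hy⟩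

lemma ww_split (hn : 2 ≤ n) (hl : 0 ≤ l) (hK : IsCompact K) (hμK : ∀ᵐ y ∂μ, y ∈ K) {x : EE n}
    (h : Integrable (fun y => aa l (x - y)) μ) :
    ww l μ x = ∫ y, aa l (x - y) ∂μ + ∫ y, hh l (x - y) ∂μ := by
  unfold ww
  rw [← integral_add h (hh_int hn hl hK hμK x)]
  simp only [kk_eq]

lemma bdry_point (hn : 2 ≤ n) (hl : 0 ≤ l) (hK : IsCompact K) (hμK : ∀ᵐ y ∂μ, y ∈ K) {x0 : EE n}
    (hx0 : x0 ∈ K) {x : ℕ → EE n} (hx : Tendsto x atTop (𝓝 x0)) (hxK : ∀ k, x k ∉ K)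
    (hw : ∀ k, ww l μ (x k) = 0) {c : ℝ} (hc : 0 < c) (hc1 : c ≤ 1)
    (hcone : ∀ k, ∀ y ∈ K, c * ‖x0 - y‖ ≤ ‖x k - y‖) :
    Integrable (fun y => aa l (x0 - y)) μ ∧ μ {x0} = 0 ∧ ww l μ x0 = 0 := by
  have hoff : ∀ k, ∃ d, 0 < d ∧ ∀ y ∈ K, d ≤ ‖x k - y‖ := fun k => exists_off hK ⟨x0, hx0⟩ (hxK k)
  have hik : ∀ k, Integrable (fun y => aa l (x k - y)) μ := fun k => by
    obtain ⟨d, hd, h⟩ := hoff k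
    exact aa_int_off hn hl hμK hd h
  have hae : ∀ k, (fun y => aE l (x k - y)) =ᵐ[μ] fun y => ENNReal.ofReal (aa l (x k - y)) :=
    fun k => hμK.mono fun y hy => by
      obtain ⟨d, hd, h⟩ := hoff k
      exact aE_eq hl (off_ne hd h hy)
  set hp : EE n → ℝ := fun x => ∫ y, hh l (x - y) ∂μ with hhp
  have hval : ∀ k, ∫ y, aa l (x k - y) ∂μ = - hp (x k) := fun k => by
    have := ww_split hn hl hK hμK (hik k)
    rw [hw k] at this
    simp only [hhp]; linarith
  have haE0 : ∀ x' : EE n, Measurable (fun y => aE l (x' - y)) := fun x' =>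
    (aE_measurable hn hl).comp (measurable_const.sub measurable_id)
  have hfin : ∫⁻ y, aE l (x0 - y) ∂μ ≤ ENNReal.ofReal (- hp x0) := by
    calc ∫⁻ y, aE l (x0 - y) ∂μ ≤ ∫⁻ y, liminf (fun k => aE l (x k - y)) atTop ∂μ :=
          lintegral_mono fun y => aE_lsc (hx.sub tendsto_const_nhds)
      _ ≤ liminf (fun k => ∫⁻ y, aE l (x k - y) ∂μ) atTop := lintegral_liminf_le fun k => haE0 _
      _ = liminf (fun k => ENNReal.ofReal (- hp (x k))) atTop := by
          congr 1; funext k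
          rw [lintegral_congr_ae (hae k), ← hval k, ofReal_integral_eq_lintegral_ofReal (hik k)]
          exact Eventually.of_forall fun y => aa_nonneg _
      _ = ENNReal.ofReal (- hp x0) := by
          refine Tendsto.liminf_eq ((ENNReal.continuous_ofReal.tendsto _).comp ?_)
          exact (((hpot_cont hn hl hK hμK).tendsto x0).comp hx).neg
  have hlt : ∀ᵐ y ∂μ, aE l (x0 - y) < ⊤ :=
    ae_lt_top (haE0 x0) (ne_top_of_le_ne_top ENNReal.ofReal_ne_top hfin)
  have hne : ∀ᵐ y ∂μ, x0 - y ≠ 0 := hlt.mono fun y hy h => by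
    rw [h, aE_zero hn hl] at hy
    exact lt_irrefl _ hy
  have hi0 : Integrable (fun y => aa l (x0 - y)) μ := by
    refine (lintegral_ofReal_ne_top_iff_integrable
      (meas_shift (aa_continuousOn hn hl) x0).aestronglyMeasurable
      (Eventually.of_forall fun y => aa_nonneg _)).1 ?_
    rw [← lintegral_congr_ae (hne.mono fun y hy => aE_eq hl hy)]
    exact ne_top_of_le_ne_top ENNReal.ofReal_ne_top hfin
  refine ⟨hi0, ?_, ?_⟩
  · have : {x0} ⊆ {y | ¬ (x0 - y ≠ 0)} := by rintro _ rfl; simp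
    exact measure_mono_null this hne
  · obtain ⟨C, hC, hcmp⟩ := aa_compare (n := n) hl hc hc1
    have h1 : Tendsto (fun k => ∫ y, aa l (x k - y) ∂μ) atTop (𝓝 (∫ y, aa l (x0 - y) ∂μ)) := by
      refine tendsto_integral_of_dominated_convergence (fun y => C * (aa l (x0 - y) + 1))
        (fun k => (hik k).aestronglyMeasurable) ((hi0.add (integrable_const 1)).const_mul C) ?_ ?_
      · intro k
        filter_upwards [hμK, hne] with y hy hy0
        rw [Real.norm_of_nonneg (aa_nonneg _)]
        exact hcmp _ _ hy0 (hcone k y hy)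
      · filter_upwards [hne] with y hy0
        exact (((aa_continuousOn hn hl).continuousAt (isOpen_compl_singleton.mem_nhds hy0)).tendsto).comp
          (hx.sub tendsto_const_nhds)
    have h2 : Tendsto (fun k => - hp (x k)) atTop (𝓝 (- hp x0)) :=
      (((hpot_cont hn hl hK hμK).tendsto x0).comp hx).neg
    have h3 := tendsto_nhds_unique (h1.congr hval) h2
    rw [ww_split hn hl hK hμK hi0, h3]
    simp [hhp]

lemma ww_tendsto (hn : 2 ≤ n) (hl : 0 ≤ l) (hK : IsCompact K) (hμK : ∀ᵐ y ∂μ, y ∈ K)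
    (hItg : ∀ x0 ∈ K, Integrable (fun y => aa l (x0 - y)) μ) (hnull : ∀ x0 ∈ K, μ {x0} = 0)
    (hw : ∀ x0 ∈ K, ww l μ x0 = 0) {x0 : EE n} (hx0 : x0 ∈ K) :
    Tendsto (ww l μ) (𝓝[Kᶜ] x0) (𝓝 0) := by
  obtain ⟨C, hC, hcmp⟩ := aa_compare (n := n) hl (c := 1 / 2) (by norm_num) (by norm_num)
  set hp : EE n → ℝ := fun x => ∫ y, hh l (x - y) ∂μ with hhp
  have hall : ∀ x, Integrable (fun y => aa l (x - y)) μ := by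
    intro x
    by_cases hx : x ∈ K
    · exact hItg x hx
    · obtain ⟨d, hd, h⟩ := exists_off hK ⟨x0, hx0⟩ hx
      exact aa_int_off hn hl hμK hd h
  -- choose the radius
  have hsmall : ∀ η > 0, ∃ δ > 0, ∫ y in ball x0 δ, (aa l (x0 - y) + 1) ∂μ < η := by
    intro η hη
    have h1 := tendsto_setIntegral_of_antitone (μ := μ) (f := fun y => aa l (x0 - y) + 1)
      (s := fun k : ℕ => ball x0 (1 / ((k:ℝ) + 1))) (fun _ => measurableSet_ball)
      (fun i j hij => ball_subset_ball (by gcongr))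
      ⟨0, ((hItg x0 hx0).add (integrable_const 1)).integrableOn⟩
    have h2 : (⋂ k : ℕ, ball x0 (1 / ((k:ℝ) + 1))) = {x0} := by
      ext y
      simp only [mem_iInter, mem_ball, mem_singleton_iff]
      constructor
      · intro h
        by_contra hne
        obtain ⟨k, hk⟩ := exists_nat_one_div_lt (dist_pos.2 hne)
        exact absurd (h k) (not_lt.2 hk.le)
      · rintro rfl k; rw [dist_self]; positivity
    rw [h2, Measure.restrict_eq_zero.2 (hnull x0 hx0), integral_zero_measure] at h1
    obtain ⟨k, hk⟩ := (h1.eventually (gt_mem_nhds hη)).exists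
    exact ⟨_, by positivity, hk⟩
  rw [Metric.tendsto_nhds]
  intro ε hε
  set η := ε / (4 * (C + 2)) with hη
  have hη0 : 0 < η := by positivity
  obtain ⟨δ, hδ, hδη⟩ := hsmall η hη0
  set B := ball x0 δ with hB
  have hBm : MeasurableSet B := measurableSet_ball
  set near : EE n → ℝ := fun x => ∫ y in B, aa l (x - y) ∂μ with hnear
  set far : EE n → ℝ := fun x => ∫ y in Bᶜ, aa l (x - y) ∂μ with hfar
  have hdec : ∀ x, ww l μ x = near x + (far x + hp x) := fun x => by
    rw [ww_split hn hl hK hμK (hall x), ← integral_add_compl hBm (hall x)]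
    ring
  have hnn : ∀ x, 0 ≤ near x := fun x => integral_nonneg fun y => aa_nonneg _
  have hnear0 : near x0 + μ.real B < η := by
    rw [integral_add (hall x0).integrableOn (integrable_const 1)] at hδη
    simpa using hδη
  have hfarc : ContinuousAt far x0 := by
    refine continuousAt_of_dominated (bound := fun _ => AI n l (Ioi 1) 0 ((δ / 2) ^ 2)) ?_ ?_ ?_ ?_
    · exact Eventually.of_forall fun x => (hall x).integrableOn.aestronglyMeasurable
    · filter_upwards [ball_mem_nhds x0 (half_pos hδ)] with x hx
      refine (ae_restrict_iff' hBm.compl).2 (Eventually.of_forall fun y hy => ?_)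
      rw [Real.norm_of_nonneg (aa_nonneg _)]
      refine AI_anti hl (by positivity) ?_ 0
      have h1 : δ ≤ dist y x0 := by simpa [hB] using hy
      have h2 := mem_ball.1 hx
      have h3 := dist_triangle y x x0
      rw [dist_comm y x] at h3
      have h4 : δ / 2 ≤ ‖x - y‖ := by rw [← dist_eq_norm]; linarith
      gcongr
    · exact integrable_const _
    · refine (ae_restrict_iff' hBm.compl).2 (Eventually.of_forall fun y hy => ?_)
      have h1 : δ ≤ dist y x0 := by simpa [hB] using hy
      have h0 : x0 - y ≠ 0 := by
        intro h
        rw [sub_eq_zero] at h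
        rw [h, dist_self] at h1; linarith
      exact ContinuousAt.comp (f := fun x => x - y) (g := aa l)
        ((aa_continuousOn hn hl).continuousAt (isOpen_compl_singleton.mem_nhds h0)) (by fun_prop)
  set R : EE n → ℝ := fun x => far x + hp x with hR
  have hRc : ContinuousAt R x0 := hfarc.add (hpot_cont hn hl hK hμK).continuousAt
  have hR0 : |R x0| < η := by
    have h1 := hdec x0
    rw [hw x0 hx0] at h1
    have h2 : R x0 = - near x0 := by simp only [hR]; linarith
    have : 0 ≤ μ.real B := measureReal_nonneg
    rw [h2, abs_neg, abs_of_nonneg (hnn x0)]; linarith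
  have hRev : ∀ᶠ x in 𝓝 x0, |R x| < η :=
    (hRc.abs).eventually (gt_mem_nhds hR0)
  obtain ⟨ρ, hρ, hRρ⟩ := Metric.eventually_nhds_iff.1 hRev
  rw [eventually_nhdsWithin_iff]
  filter_upwards [ball_mem_nhds x0 (half_pos hρ)] with x hx hxK
  have hxd : dist x x0 < ρ / 2 := hx
  obtain ⟨y0, hy0, hy0d⟩ := hK.exists_infDist_eq_dist ⟨x0, hx0⟩ x
  have hmin : ∀ y ∈ K, dist x y0 ≤ dist x y := fun y hy => by
    rw [← hy0d]; exact infDist_le_dist_of_mem hy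
  have hy0x : dist y0 x0 < ρ := by
    have h1 := hmin x0 hx0
    have h2 := dist_triangle_left y0 x0 x
    linarith
  have hRx : |R x| < η := hRρ (by linarith)
  have hRy : |R y0| < η := hRρ hy0x
  have hny : near y0 < η := by
    have h1 := hdec y0
    rw [hw y0 hy0] at h1
    have h2 : near y0 = - R y0 := by simp only [hR]; linarith
    rw [h2]; exact lt_of_le_of_lt (neg_le_abs _) hRy
  have hny0 : ∀ᵐ y ∂μ, y0 - y ≠ 0 := by
    have : ∀ᵐ y ∂μ, y ∉ ({y0} : Set (EE n)) := measure_eq_zero_iff_ae_notMem.1 (hnull y0 hy0)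
    filter_upwards [this] with y hy h
    rw [sub_eq_zero] at h
    exact hy h.symm
  have hnx : near x ≤ C * (near y0 + μ.real B) := by
    have h1 : near x ≤ ∫ y in B, C * (aa l (y0 - y) + 1) ∂μ := by
      refine integral_mono_ae (hall x).integrableOn
        (((hall y0).add (integrable_const 1)).const_mul C).integrableOn ?_
      refine ae_restrict_of_ae ?_
      filter_upwards [hμK, hny0] with y hy hy'
      refine hcmp _ _ hy' ?_
      have h1 := hmin y hy
      have h2 := dist_triangle_left y0 y x
      rw [← dist_eq_norm, ← dist_eq_norm]; linarith
    refine h1.trans (le_of_eq ?_)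
    rw [integral_const_mul, integral_add (hall y0).integrableOn (integrable_const 1)]
    simp [hnear]
  have hμB : μ.real B < η := by linarith [hnn x0]
  rw [dist_zero_right, hdec x]
  have h1 : near x ≤ C * (2 * η) := hnx.trans (by gcongr; linarith)
  calc ‖near x + (far x + hp x)‖ ≤ |near x| + |R x| := abs_add_le _ _
    _ < C * (2 * η) + 2 * η := by rw [abs_of_nonneg (hnn x)]; linarith
    _ ≤ ε := by
        have : η * (4 * (C + 2)) = ε := by rw [hη]; field_simp
        nlinarith
end

end

end

section
open Metric Set Filter MeasureTheory
open scoped RealInnerProductSpace Topology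

noncomputable section

/-- general potential -/
def pot {n : ℕ} {F : Type} [NormedAddCommGroup F] [NormedSpace ℝ F] (μ : Measure (EE n))
    (κ : EE n → F) (x : EE n) : F := ∫ y, κ (x - y) ∂μ

section
variable {n : ℕ} {μ : Measure (EE n)} [IsFiniteMeasure μ] {K : Set (EE n)}
  {F : Type} [NormedAddCommGroup F] [NormedSpace ℝ F]

lemma pot_kernel_contOn {κ : EE n → F} (hκ : ContinuousOn κ {0}ᶜ) {x : EE n} (hx : x ∉ K) :
    ContinuousOn (fun y => κ (x - y)) K := by
  refine hκ.comp (by fun_prop) fun y hy h => hx ?_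
  rw [mem_singleton_iff, sub_eq_zero] at h
  rwa [h]

lemma pot_integrable (hK : IsCompact K) (hμK : ∀ᵐ y ∂μ, y ∈ K) {κ : EE n → F}
    (hκ : ContinuousOn κ {0}ᶜ) {x : EE n} (hx : x ∉ K) : Integrable (fun y => κ (x - y)) μ := by
  have h := (pot_kernel_contOn hκ hx).integrableOn_compact hK (μ := μ)
  rwa [IntegrableOn, Measure.restrict_eq_self_of_ae_mem hμK] at h

lemma pot_bound (hK : IsCompact K) {κ : EE n → F}
    (hκ : ContinuousOn κ {0}ᶜ) {x : EE n} (hx : x ∉ K) :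
    ∃ s ∈ 𝓝 x, ∃ C : ℝ, s ⊆ Kᶜ ∧ ∀ y ∈ K, ∀ x' ∈ s, ‖κ (x' - y)‖ ≤ C := by
  obtain ⟨s, hs, hsK, hsc⟩ := local_compact_nhds (hK.isClosed.isOpen_compl.mem_nhds hx)
  have hc : ContinuousOn (fun p : EE n × EE n => κ (p.1 - p.2)) (s ×ˢ K) := by
    refine hκ.comp (by fun_prop) fun p hp h => hsK hp.1 ?_
    rw [mem_singleton_iff, sub_eq_zero] at h
    rw [h]; exact hp.2
  obtain ⟨C, hC⟩ := (hsc.prod hK).exists_bound_of_continuousOn hc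
  exact ⟨s, hs, C, hsK, fun y hy x' hx' => hC (x', y) ⟨hx', hy⟩⟩

lemma pot_hasFDerivAt (hK : IsCompact K) (hμK : ∀ᵐ y ∂μ, y ∈ K) {κ : EE n → F}
    (hκ : ContDiffOn ℝ 1 κ {0}ᶜ) {x : EE n} (hx : x ∉ K) :
    HasFDerivAt (pot μ κ) (pot μ (fderiv ℝ κ) x) x := by
  have hκ' : ContinuousOn (fderiv ℝ κ) {0}ᶜ :=
    hκ.continuousOn_fderiv_of_isOpen isOpen_compl_singleton le_rfl
  obtain ⟨s, hs, C, hsK, hC⟩ := pot_bound hK hκ' hx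
  refine hasFDerivAt_integral_of_dominated_of_fderiv_le (bound := fun _ => C) hs
    (F' := fun x y => fderiv ℝ κ (x - y)) ?_ (pot_integrable hK hμK hκ.continuousOn hx)
    (pot_integrable hK hμK hκ' hx).aestronglyMeasurable ?_ (integrable_const C) ?_
  · filter_upwards [hs] with x' hx'
    exact (pot_integrable hK hμK hκ.continuousOn (hsK hx')).aestronglyMeasurable
  · exact hμK.mono fun y hy x' hx' => hC y hy x' hx'
  · refine hμK.mono fun y hy x' hx' => ?_
    have h0 : x' - y ∈ ({0}ᶜ : Set (EE n)) := fun h => hsK hx' (by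
      rw [mem_singleton_iff, sub_eq_zero] at h; rwa [h])
    have h1 : DifferentiableAt ℝ κ (x' - y) :=
      (hκ.differentiableOn one_ne_zero).differentiableAt (isOpen_compl_singleton.mem_nhds h0)
    have h2 := h1.hasFDerivAt.comp x' ((hasFDerivAt_id x').sub_const y)
    rwa [ContinuousLinearMap.comp_id] at h2

end

lemma pot_contDiffOn {n : ℕ} {μ : Measure (EE n)} [IsFiniteMeasure μ] {K : Set (EE n)}
    (hK : IsCompact K) (hμK : ∀ᵐ y ∂μ, y ∈ K) (m : ℕ) :
    ∀ {F : Type} [NormedAddCommGroup F] [NormedSpace ℝ F] {κ : EE n → F},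
      ContDiffOn ℝ (m + 1 : ℕ) κ {0}ᶜ → ContDiffOn ℝ m (pot μ κ) Kᶜ := by
  induction m with
  | zero =>
    intro F _ _ κ hκ
    rw [Nat.cast_zero, contDiffOn_zero]
    intro x hx
    exact (pot_hasFDerivAt hK hμK (by simpa using hκ) hx).continuousAt.continuousWithinAt
  | succ m ih =>
    intro F _ _ κ hκ
    have h1 : ContDiffOn ℝ 1 κ {0}ᶜ := hκ.of_le (by norm_cast; omega)
    rw [Nat.cast_succ, contDiffOn_succ_iff_fderiv_of_isOpen hK.isClosed.isOpen_compl]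
    refine ⟨fun x hx => (pot_hasFDerivAt hK hμK h1 hx).differentiableAt.differentiableWithinAt,
      by simp, ?_⟩
    rw [Nat.cast_succ, contDiffOn_succ_iff_fderiv_of_isOpen isOpen_compl_singleton] at hκ
    exact (ih hκ.2.2).congr fun x hx => (pot_hasFDerivAt hK hμK h1 hx).fderiv

lemma phi_contDiffOn {n : ℕ} (hn : 2 ≤ n) {l : ℝ} (hl : 0 ≤ l) (k : ℕ) :
    ∀ m, ContDiffOn ℝ k (phi n l m) (Ioi 0) := by
  induction k with
  | zero => intro m; rw [Nat.cast_zero, contDiffOn_zero]; exact phi_continuousOn hn hl m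
  | succ k ih =>
    intro m
    rw [Nat.cast_succ, contDiffOn_succ_iff_deriv_of_isOpen isOpen_Ioi]
    refine ⟨fun x hx => (phi_hasDerivAt hn hl m hx).differentiableAt.differentiableWithinAt,
      by simp, ?_⟩
    exact (ih (m + 1)).congr fun x hx => (phi_hasDerivAt hn hl m hx).deriv

lemma kk_contDiffOn {n : ℕ} (hn : 2 ≤ n) {l : ℝ} (hl : 0 ≤ l) (k : ℕ) :
    ContDiffOn ℝ k (kk (n := n) l) {0}ᶜ := by
  refine (phi_contDiffOn hn hl k 0).comp (t := Ioi 0) (contDiff_norm_sq ℝ).contDiffOn ?_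
  intro z hz
  have : 0 < ‖z‖ := norm_pos_iff.2 hz
  simp only [mem_Ioi]; positivity

lemma kk_helmholtz {n : ℕ} (hn : 2 ≤ n) {l : ℝ} (hl : 0 ≤ l) {z : EE n} (hz : z ≠ 0) :
    lap (kk l) z + l * kk l z = 0 := by
  have h0 : 0 < ‖z‖ := norm_pos_iff.2 hz
  have hs : 0 < ‖z‖ ^ 2 := by positivity
  have h1 := lap_radial (x := z) (f := phi n l 0) (f1 := phi n l 1)
    (Filter.mem_of_superset (Ioi_mem_nhds hs) fun s hs => phi_hasDerivAt hn hl 0 hs)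
    (phi_hasDerivAt hn hl 1 hs)
  have h2 := phi_rec hn hl 0 hs
  change lap (fun y : EE n => phi n l 0 (‖y‖ ^ 2)) z + l * phi n l 0 (‖z‖ ^ 2) = 0
  rw [h1]
  norm_num at h2 ⊢
  linarith

lemma ww_contDiffOn {n : ℕ} (hn : 2 ≤ n) {l : ℝ} (hl : 0 ≤ l) {μ : Measure (EE n)}
    [IsFiniteMeasure μ] {K : Set (EE n)} (hK : IsCompact K) (hμK : ∀ᵐ y ∂μ, y ∈ K) :
    ContDiffOn ℝ 2 (ww l μ) Kᶜ := pot_contDiffOn hK hμK 2 (kk_contDiffOn hn hl 3)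

lemma pd_contDiffOn {n : ℕ} {κ : EE n → ℝ} {m : ℕ} (i : Fin n)
    (hκ : ContDiffOn ℝ (m + 1 : ℕ) κ {0}ᶜ) : ContDiffOn ℝ m (pd i κ) {0}ᶜ := by
  rw [Nat.cast_succ, contDiffOn_succ_iff_fderiv_of_isOpen isOpen_compl_singleton] at hκ
  exact hκ.2.2.clm_apply contDiffOn_const

lemma pot_pd {n : ℕ} {μ : Measure (EE n)} [IsFiniteMeasure μ] {K : Set (EE n)} (hK : IsCompact K)
    (hμK : ∀ᵐ y ∂μ, y ∈ K) {κ : EE n → ℝ} (hκ : ContDiffOn ℝ 1 κ {0}ᶜ) (i : Fin n)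
    {x : EE n} (hx : x ∉ K) : pd i (pot μ κ) x = pot μ (pd i κ) x := by
  have hκ' : ContinuousOn (fderiv ℝ κ) {0}ᶜ :=
    hκ.continuousOn_fderiv_of_isOpen isOpen_compl_singleton le_rfl
  unfold pd
  rw [(pot_hasFDerivAt hK hμK hκ hx).fderiv]
  unfold pot
  rw [ContinuousLinearMap.integral_apply (pot_integrable hK hμK hκ' hx)]

lemma ww_helmholtz {n : ℕ} (hn : 2 ≤ n) {l : ℝ} (hl : 0 ≤ l) {μ : Measure (EE n)}
    [IsFiniteMeasure μ] {K : Set (EE n)} (hK : IsCompact K) (hμK : ∀ᵐ y ∂μ, y ∈ K)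
    {x : EE n} (hx : x ∉ K) : lap (ww l μ) x + l * ww l μ x = 0 := by
  have hnhds : Kᶜ ∈ 𝓝 x := hK.isClosed.isOpen_compl.mem_nhds hx
  have hk1 : ∀ i : Fin n, ContDiffOn ℝ 1 (pd i (kk (n := n) l)) {0}ᶜ := fun i =>
    pd_contDiffOn (m := 1) i (kk_contDiffOn hn hl 2)
  have hk2 : ∀ i : Fin n, ContinuousOn (pd i (pd i (kk (n := n) l))) {0}ᶜ := fun i => by
    have : ContDiffOn ℝ (0 + 1 : ℕ) (pd i (kk (n := n) l)) {0}ᶜ := by simpa using hk1 i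
    exact (pd_contDiffOn (m := 0) i this).continuousOn
  have e1 : ∀ i, pd i (pd i (ww l μ)) x = pot μ (pd i (pd i (kk l))) x := by
    intro i
    rw [← pot_pd hK hμK (hk1 i) i hx]
    refine Filter.EventuallyEq.eq_of_nhds (pd_congr ?_)
    filter_upwards [hnhds] with x' hx'
    exact pot_pd hK hμK (by simpa using kk_contDiffOn hn hl 1) i hx'
  have hki := pot_integrable hK hμK (phi_norm_continuousOn hn hl 0) hx
  rw [lap_eq]
  simp only [e1]
  unfold pot ww
  rw [← integral_finsetSum _ (fun i _ => pot_integrable hK hμK (hk2 i) hx), ← integral_const_mul,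
    ← integral_add]
  · rw [← integral_zero (EE n) ℝ (μ := μ)]
    refine integral_congr_ae (hμK.mono fun y hy => ?_)
    have h0 : x - y ≠ 0 := fun h => hx (by rw [sub_eq_zero] at h; rwa [h])
    exact kk_helmholtz hn hl h0
  · exact integrable_finsetSum _ (fun i _ => pot_integrable hK hμK (hk2 i) hx)
  · exact hki.const_mul l

end

end

section
open Metric Set Filter MeasureTheory
open scoped RealInnerProductSpace Topology

noncomputable section

lemma gauss_lint {n : ℕ} {s : ℝ} (hs : 0 < s) :
    ∫⁻ z : EE n, ENNReal.ofReal (Real.exp (-(‖z‖ ^ 2 * s))) =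
      ENNReal.ofReal ((Real.pi / s) ^ ((n : ℝ) / 2)) := by
  have h := GaussianFourier.integral_rexp_neg_mul_sq_norm (V := EE n) hs
  have e : (fun z : EE n => Real.exp (-s * ‖z‖ ^ 2)) = fun z => Real.exp (-(‖z‖ ^ 2 * s)) := by
    ext z; congr 1; ring
  rw [e, finrank_euclideanSpace_fin] at h
  have hi : Integrable (fun z : EE n => Real.exp (-(‖z‖ ^ 2 * s))) := by
    by_contra hc
    rw [integral_undef hc] at h
    have : 0 < (Real.pi / s) ^ ((n : ℝ) / 2) := by have := Real.pi_pos; positivity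
    linarith
  rw [← ofReal_integral_eq_lintegral_ofReal hi (Eventually.of_forall fun z => (Real.exp_pos _).le), h]

lemma gw_meas2 {n : ℕ} {l : ℝ} :
    Measurable (fun p : EE n × ℝ => ENNReal.ofReal (gw n l 0 (‖p.1‖ ^ 2) p.2)) := by
  unfold gw Nw
  have h1 : Measurable fun p : EE n × ℝ => p.2 ^ ((n : ℝ) / 2 - 2) := measurable_snd.pow_const _
  fun_prop

lemma aE_lint {n : ℕ} {l : ℝ} (hl : 0 ≤ l) : ∫⁻ z : EE n, aE l z < ⊤ := by
  unfold aE
  rw [lintegral_lintegral_swap gw_meas2.aemeasurable]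
  have hb : ∀ s ∈ Ioi (1:ℝ), ∫⁻ z : EE n, ENNReal.ofReal (gw n l 0 (‖z‖ ^ 2) s) ≤
      ENNReal.ofReal (Real.exp l * Real.pi ^ ((n : ℝ) / 2) * s ^ (-2 : ℝ)) := by
    intro s hs
    have hs0 : (0:ℝ) < s := lt_trans zero_lt_one hs
    have hpi := Real.pi_pos
    have e : ∀ z : EE n, ENNReal.ofReal (gw n l 0 (‖z‖ ^ 2) s) =
        ENNReal.ofReal (Nw n l s) * ENNReal.ofReal (Real.exp (-(‖z‖ ^ 2 * s))) := by
      intro z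
      rw [← ENNReal.ofReal_mul (Nw_nonneg hs0.le)]; unfold gw; rw [pow_zero, one_mul]
    simp_rw [e]
    rw [lintegral_const_mul _ (by fun_prop), gauss_lint hs0, ← ENNReal.ofReal_mul (Nw_nonneg hs0.le)]
    apply ENNReal.ofReal_le_ofReal
    unfold Nw
    rw [Real.div_rpow hpi.le hs0.le, Real.rpow_sub hs0]
    have h1 : Real.exp (l / (4 * s)) ≤ Real.exp l := by
      apply Real.exp_le_exp.2
      have : (1:ℝ) < s := hs
      exact div_le_self hl (by linarith)
    have h2 : s ^ (-2:ℝ) = (s ^ (2:ℝ))⁻¹ := Real.rpow_neg hs0.le 2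
    have h3 : 0 < s ^ ((n:ℝ)/2) := by positivity
    have h4 : 0 < s ^ (2:ℝ) := by positivity
    calc _ = Real.exp (l / (4 * s)) * Real.pi ^ ((n : ℝ) / 2) * s ^ (-2 : ℝ) := by
          rw [h2]; field_simp
      _ ≤ _ := by gcongr
  refine lt_of_le_of_lt (setLIntegral_mono' measurableSet_Ioi hb) ?_
  have hi : IntegrableOn (fun s : ℝ => Real.exp l * Real.pi ^ ((n : ℝ) / 2) * s ^ (-2 : ℝ)) (Ioi 1) :=
    ((integrableOn_Ioi_rpow_iff zero_lt_one).2 (by norm_num)).const_mul _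
  exact hi.lintegral_lt_top

lemma aa_integrable {n : ℕ} (hn : 2 ≤ n) {l : ℝ} (hl : 0 ≤ l) :
    Integrable (fun z : EE n => aa l z) := by
  have : Nonempty (Fin n) := ⟨⟨0, by omega⟩⟩
  have hne : ∀ᵐ z : EE n, z ≠ 0 := by
    rw [ae_iff]; simp
  have hm : AEStronglyMeasurable (fun z : EE n => aa l z) := by
    have := (aa_continuousOn hn hl).aestronglyMeasurable (μ := (volume : Measure (EE n))) (measurableSet_singleton (0 : EE n)).compl
    rwa [Measure.restrict_eq_self_of_ae_mem (s := ({0}ᶜ : Set (EE n))) hne] at this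
  refine ⟨hm, ?_⟩
  rw [hasFiniteIntegral_iff_ofReal (Eventually.of_forall fun z => aa_nonneg z)]
  have : ∫⁻ z : EE n, ENNReal.ofReal (aa l z) = ∫⁻ z : EE n, aE l z := by
    refine lintegral_congr_ae ?_
    filter_upwards [hne] with z hz
    rw [aE_eq hl hz]
  rw [this]
  exact aE_lint hl

/-- truncated kernel -/
def PhS (n : ℕ) (l S : ℝ) (m : ℕ) (σ : ℝ) : ℝ := (-1) ^ m * AI n l (Ioc 1 S) m σ + Hm n l m σ

lemma PhS_hasDerivAt {n : ℕ} (hn : 2 ≤ n) {l S : ℝ} (hl : 0 ≤ l) (m : ℕ) (σ : ℝ) :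
    HasDerivAt (PhS n l S m) (PhS n l S (m + 1) σ) σ := by
  have h1 := AI_hasDerivAt (n := n) (l := l) (τ := σ - 1) (σ := σ) (measurableSet_Ioc (a := 1) (b := S))
    (fun x hx => lt_trans zero_lt_one hx.1) (gw_integrable_Ioc S) (by linarith) m
  have := (h1.const_mul ((-1) ^ m)).add (Hm_hasDerivAt hn hl m σ)
  refine this.congr_deriv ?_
  unfold PhS; rw [pow_succ]; ring

lemma PhS_contDiff {n : ℕ} (hn : 2 ≤ n) {l S : ℝ} (hl : 0 ≤ l) (k : ℕ) :
    ∀ m, ContDiff ℝ k (PhS n l S m) := by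
  induction k with
  | zero =>
    intro m
    exact contDiff_zero.2 (continuous_iff_continuousAt.2 fun σ =>
      (PhS_hasDerivAt hn hl m σ).continuousAt)
  | succ k ih =>
    intro m
    have e : deriv (PhS n l S m) = PhS n l S (m + 1) := by
      ext σ; exact (PhS_hasDerivAt hn hl m σ).deriv
    push_cast
    rw [contDiff_succ_iff_deriv]
    refine ⟨fun σ => (PhS_hasDerivAt hn hl m σ).differentiableAt, by simp, ?_⟩
    rw [e]; exact ih _

def kS {n : ℕ} (l S : ℝ) (z : EE n) : ℝ := PhS n l S 0 (‖z‖ ^ 2)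

lemma kS_contDiff {n : ℕ} (hn : 2 ≤ n) {l S : ℝ} (hl : 0 ≤ l) : ContDiff ℝ 2 (kS (n := n) l S) :=
  (PhS_contDiff hn hl 2 0).comp (contDiff_norm_sq ℝ)

lemma kS_lap {n : ℕ} (hn : 2 ≤ n) {l S : ℝ} (hl : 0 ≤ l) (hS : 1 ≤ S) (z : EE n) :
    lap (kS (n := n) l S) z + l * kS l S z = -4 * gw n l 2 (‖z‖ ^ 2) S := by
  have h := lap_radial (n := n) (x := z) (f := PhS n l S 0)
    (Eventually.of_forall fun s => PhS_hasDerivAt hn hl 0 s) (PhS_hasDerivAt hn hl 1 _)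
  have h1 := AI_rec_Ioc (n := n) (l := l) (σ := ‖z‖ ^ 2) hS
  have h2 := Hm_rec hn hl 0 (‖z‖ ^ 2)
  change lap (fun y => PhS n l S 0 (‖y‖ ^ 2)) z + l * PhS n l S 0 (‖z‖ ^ 2) = _
  rw [h]
  unfold PhS
  norm_num at h2 ⊢
  linear_combination h1 + h2

lemma pd_ibp {n : ℕ} {f g : EE n → ℝ} (i : Fin n) (hf : ContDiff ℝ 1 f) (hg : ContDiff ℝ 1 g)
    (hgs : HasCompactSupport g) :
    ∫ x, f x * pd i g x = - ∫ x, pd i f x * g x := by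
  have cg : Continuous (pd i g) := (pd_contDiff (m' := 0) hg (by norm_num)).continuous
  have cf : Continuous (pd i f) := (pd_contDiff (m' := 0) hf (by norm_num)).continuous
  have hgs' : HasCompactSupport (pd i g) := hgs.fderiv_apply (𝕜 := ℝ) _
  exact integral_mul_fderiv_eq_neg_fderiv_mul_of_integrable
    ((cf.mul hg.continuous).integrable_of_hasCompactSupport hgs.mul_left)
    ((hf.continuous.mul cg).integrable_of_hasCompactSupport hgs'.mul_left)
    ((hf.continuous.mul hg.continuous).integrable_of_hasCompactSupport hgs.mul_left)
    (fun x _ => (hf.differentiable (by norm_num)) x) (fun x _ => (hg.differentiable (by norm_num)) x)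

end

end

section
open Metric Set Filter MeasureTheory
open scoped RealInnerProductSpace Topology

noncomputable section

lemma pd_supp {n : ℕ} {i : Fin n} {f : EE n → ℝ} (h : HasCompactSupport f) :
    HasCompactSupport (pd i f) := h.fderiv_apply (𝕜 := ℝ) _

lemma pd_cont {n : ℕ} {i : Fin n} {f : EE n → ℝ} (h : ContDiff ℝ 1 f) : Continuous (pd i f) :=
  (pd_contDiff (m' := 0) h (by norm_num)).continuous

lemma pd_cd1 {n : ℕ} {i : Fin n} {f : EE n → ℝ} (h : ContDiff ℝ 2 f) : ContDiff ℝ 1 (pd i f) :=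
  pd_contDiff h (by norm_num)

lemma lap_cont {n : ℕ} {f : EE n → ℝ} (h : ContDiff ℝ 2 f) : Continuous (lap f) := by
  have : lap f = fun x => ∑ i, pd i (pd i f) x := by ext x; exact lap_eq f x
  rw [this]
  exact continuous_finsetSum _ fun i _ => pd_cont (pd_cd1 h)

lemma lap_ibp {n : ℕ} {f g : EE n → ℝ} (hf : ContDiff ℝ 2 f) (hg : ContDiff ℝ 2 g)
    (hgs : HasCompactSupport g) : ∫ x, f x * lap g x = ∫ x, lap f x * g x := by
  have h1 : (1 : WithTop ℕ∞) ≤ 2 := by norm_num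
  simp only [lap_eq, Finset.mul_sum, Finset.sum_mul]
  rw [integral_finsetSum, integral_finsetSum]
  · refine Finset.sum_congr rfl fun i _ => ?_
    rw [pd_ibp i (hf.of_le h1) (pd_cd1 hg) (pd_supp hgs), 
      pd_ibp i (pd_cd1 hf) (hg.of_le h1) hgs, neg_neg]
  · exact fun i _ => ((pd_cont (pd_cd1 hf)).mul hg.continuous).integrable_of_hasCompactSupport hgs.mul_left
  · exact fun i _ => (hf.continuous.mul (pd_cont (pd_cd1 hg))).integrable_of_hasCompactSupport
      (pd_supp (pd_supp hgs)).mul_left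

lemma lap_supp {n : ℕ} {f : EE n → ℝ} (hg : HasCompactSupport f) : HasCompactSupport (lap f) := by
  refine HasCompactSupport.intro hg (fun x hx => ?_)
  have : f =ᶠ[𝓝 x] fun _ => 0 := by
    have := (isClosed_tsupport f).isOpen_compl.mem_nhds hx
    filter_upwards [this] with y hy
    exact image_eq_zero_of_notMem_tsupport hy
  rw [lap_congr this, lap_zero]

def Lop {n : ℕ} (l : ℝ) (f : EE n → ℝ) (x : EE n) : ℝ := lap f x + l * f x

lemma Lop_cont {n : ℕ} {l : ℝ} {f : EE n → ℝ} (h : ContDiff ℝ 2 f) : Continuous (Lop l f) :=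
  (lap_cont h).add (continuous_const.mul h.continuous)

lemma Lop_supp {n : ℕ} {l : ℝ} {f : EE n → ℝ} (h : HasCompactSupport f) :
    HasCompactSupport (Lop l f) := (lap_supp h).add h.mul_left

lemma L_ibp {n : ℕ} {l : ℝ} {f g : EE n → ℝ} (hf : ContDiff ℝ 2 f) (hg : ContDiff ℝ 2 g)
    (hgs : HasCompactSupport g) : ∫ x, f x * Lop l g x = ∫ x, Lop l f x * g x := by
  unfold Lop
  simp only [mul_add, add_mul]
  rw [integral_add, integral_add, lap_ibp hf hg hgs]
  · congr 1
    refine integral_congr_ae (Eventually.of_forall fun x => ?_)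
    simp only; ring
  · exact ((lap_cont hf).mul hg.continuous).integrable_of_hasCompactSupport hgs.mul_left
  · exact ((continuous_const.mul hf.continuous).mul hg.continuous).integrable_of_hasCompactSupport
      hgs.mul_left
  · exact (hf.continuous.mul (lap_cont hg)).integrable_of_hasCompactSupport (lap_supp hgs).mul_left
  · exact (hf.continuous.mul (continuous_const.mul hg.continuous)).integrable_of_hasCompactSupport
      (HasCompactSupport.mul_left (HasCompactSupport.mul_left hgs))

/-- lower bound of the mass -/
def c0 (n : ℕ) : ℝ := Real.exp (-1) * (volume (ball (0 : EE n) 1)).toReal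

lemma c0_pos (n : ℕ) : 0 < c0 n := by
  unfold c0
  have : 0 < (volume (ball (0 : EE n) 1)).toReal :=
    ENNReal.toReal_pos (measure_ball_pos _ _ one_pos).ne' measure_ball_lt_top.ne
  positivity

lemma gw_mass {n : ℕ} {l : ℝ} (hl : 0 ≤ l) {ψ : EE n → ℝ} (hψ : Continuous ψ)
    (hψs : HasCompactSupport ψ) (hψ0 : ∀ x, 0 ≤ ψ x) (hψ1 : ∀ x ∈ ball (0 : EE n) 1, ψ x = 1) (k : ℕ) :
    c0 n ≤ ∫ z : EE n, gw n l 2 (‖z‖ ^ 2) (((k:ℝ) + 1) ^ 2) * ψ z := by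
  have hk : (0:ℝ) < (k:ℝ) + 1 := by positivity
  set S : ℝ := ((k:ℝ) + 1) ^ 2 with hS
  have hS0 : 0 < S := by positivity
  have hcont : Continuous fun z : EE n => gw n l 2 (‖z‖ ^ 2) S * ψ z := by
    unfold gw; fun_prop
  have hItg := hcont.integrable_of_hasCompactSupport (μ := volume) hψs.mul_left
  have hnn : ∀ z, 0 ≤ gw n l 2 (‖z‖ ^ 2) S * ψ z := fun z => mul_nonneg (gw_nonneg hS0.le) (hψ0 z)
  refine le_trans ?_ (setIntegral_le_integral (s := ball (0 : EE n) (1 / ((k:ℝ) + 1))) hItg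
    (Eventually.of_forall hnn))
  have hle : ∀ z ∈ ball (0 : EE n) (1 / ((k:ℝ) + 1)),
      ((k:ℝ) + 1) ^ n * Real.exp (-1) ≤ gw n l 2 (‖z‖ ^ 2) S * ψ z := by
    intro z hz
    rw [mem_ball_zero_iff] at hz
    have hz1 : ‖z‖ < 1 := lt_of_lt_of_le hz (by
      rw [div_le_one hk]; have : (0:ℝ) ≤ k := k.cast_nonneg
      linarith)
    rw [hψ1 z (by simpa using hz1), mul_one]
    have hzS : ‖z‖ ^ 2 * S ≤ 1 := by
      rw [hS, ← mul_pow]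
      rw [lt_div_iff₀ hk] at hz
      exact pow_le_one₀ (by positivity) hz.le
    have e1 : S ^ 2 * S ^ ((n : ℝ) / 2 - 2) = ((k:ℝ) + 1) ^ n := by
      rw [Real.rpow_sub hS0, ← Real.rpow_natCast S 2]
      push_cast
      rw [mul_div_cancel₀ _ (by positivity), hS, ← Real.rpow_natCast _ 2, ← Real.rpow_mul hk.le,
        ← Real.rpow_natCast _ n]
      congr 1; push_cast; ring
    have e2 : 1 ≤ Real.exp (l / (4 * S)) := Real.one_le_exp (by positivity)
    have e3 : Real.exp (-1) ≤ Real.exp (-(‖z‖ ^ 2 * S)) := Real.exp_le_exp.2 (by linarith)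
    unfold gw Nw
    calc _ = (S ^ 2 * (1 * S ^ ((n : ℝ) / 2 - 2))) * Real.exp (-1) := by rw [one_mul, e1]
      _ ≤ _ := by gcongr
  have h1 := setIntegral_mono_on (μ := (volume : Measure (EE n)))
    (integrableOn_const (measure_ball_lt_top (μ := (volume : Measure (EE n)))).ne) hItg.integrableOn measurableSet_ball hle
  refine le_trans (le_of_eq ?_) h1
  rw [setIntegral_const, Measure.real, Measure.addHaar_ball_of_pos volume (0 : EE n) (by positivity),
    finrank_euclideanSpace_fin, ENNReal.toReal_mul, ENNReal.toReal_ofReal (by positivity), c0,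
    smul_eq_mul, div_pow, one_pow]
  have : ((k:ℝ) + 1) ^ n ≠ 0 := by positivity
  field_simp

lemma kk_pair {n : ℕ} (hn : 2 ≤ n) {l : ℝ} (hl : 0 ≤ l) {ψ : EE n → ℝ} (hψ : ContDiff ℝ 2 ψ)
    (hψs : HasCompactSupport ψ) (hψ0 : ∀ x, 0 ≤ ψ x) (hψ1 : ∀ x ∈ ball (0 : EE n) 1, ψ x = 1) :
    ∫ z, kk l z * Lop l ψ z ≤ -4 * c0 n := by
  have hnF : Nonempty (Fin n) := ⟨⟨0, by omega⟩⟩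
  have hne : ∀ᵐ z : EE n, z ≠ 0 := by
    rw [ae_iff]; simp
  have hk : ∀ k : ℕ, ∫ z, kS l (((k:ℝ) + 1) ^ 2) z * Lop l ψ z ≤ -4 * c0 n := by
    intro k
    rw [L_ibp (kS_contDiff hn hl) hψ hψs]
    have hS : (1:ℝ) ≤ ((k:ℝ) + 1) ^ 2 := by
      have : (0:ℝ) ≤ k := k.cast_nonneg
      nlinarith
    have e : ∀ z, Lop l (kS (n := n) l (((k:ℝ) + 1) ^ 2)) z * ψ z =
        -4 * (gw n l 2 (‖z‖ ^ 2) (((k:ℝ) + 1) ^ 2) * ψ z) := by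
      intro z; unfold Lop; rw [kS_lap hn hl hS]; ring
    simp only [e]
    rw [integral_const_mul]
    have := gw_mass hl hψ.continuous hψs hψ0 hψ1 k
    linarith
  have hL := Lop_cont (l := l) hψ
  have hLs := Lop_supp (l := l) hψs
  obtain ⟨C, hC⟩ := hLs.exists_bound_of_continuous hL
  have hC0 : 0 ≤ C := (norm_nonneg _).trans (hC 0)
  have hle : ∀ (S : ℝ) (z : EE n), z ≠ 0 → AI n l (Ioc 1 S) 0 (‖z‖ ^ 2) ≤ aa l z := by
    intro S z hz
    have hz2 : 0 < ‖z‖ ^ 2 := by have := norm_pos_iff.2 hz; positivity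
    refine setIntegral_mono_set (gw_integrable hl hz2 0) ?_ (Eventually.of_forall fun s hs => hs.1)
    filter_upwards [self_mem_ae_restrict measurableSet_Ioi] with s hs
    exact gw_nonneg (le_of_lt (lt_trans zero_lt_one hs))
  have hlim : Tendsto (fun k : ℕ => ∫ z, kS l (((k:ℝ) + 1) ^ 2) z * Lop l ψ z) atTop
      (𝓝 (∫ z, kk l z * Lop l ψ z)) := by
    refine tendsto_integral_of_dominated_convergence
      (fun z => aa l z * C + |hh l z| * ‖Lop l ψ z‖) ?_ ?_ ?_ ?_
    · exact fun k => ((kS_contDiff hn hl).continuous.mul hL).aestronglyMeasurable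
    · refine ((aa_integrable hn hl).mul_const C).add ?_
      exact ((hh_continuous hn hl).abs.mul hL.norm).integrable_of_hasCompactSupport hLs.norm.mul_left
    · intro k
      filter_upwards [hne] with z hz
      rw [norm_mul, Real.norm_eq_abs]
      have e : kS l (((k:ℝ) + 1) ^ 2) z = AI n l (Ioc 1 (((k:ℝ) + 1) ^ 2)) 0 (‖z‖ ^ 2) + hh l z := by
        unfold kS PhS hh; simp
      have h0 := AI_nonneg (n := n) (l := l) (σ := ‖z‖ ^ 2) 0 (I := Ioc 1 (((k:ℝ) + 1) ^ 2))
        measurableSet_Ioc (fun x hx => lt_trans zero_lt_one hx.1)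
      have h1 := hle (((k:ℝ) + 1) ^ 2) z hz
      have h2 : |kS l (((k:ℝ) + 1) ^ 2) z| ≤ aa l z + |hh l z| := by
        rw [e]; refine (abs_add_le _ _).trans ?_
        rw [abs_of_nonneg h0]; linarith
      calc _ ≤ (aa l z + |hh l z|) * ‖Lop l ψ z‖ := by gcongr
        _ = aa l z * ‖Lop l ψ z‖ + |hh l z| * ‖Lop l ψ z‖ := by ring
        _ ≤ _ := by
          have := mul_le_mul_of_nonneg_left (hC z) (aa_nonneg (l := l) z)
          linarith
    · filter_upwards [hne] with z hz
      refine Tendsto.mul_const _ ?_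
      have hz2 : 0 < ‖z‖ ^ 2 := by have := norm_pos_iff.2 hz; positivity
      have ht : Tendsto (fun k : ℕ => ((k:ℝ) + 1) ^ 2) atTop atTop :=
        (tendsto_pow_atTop (by norm_num)).comp
          (tendsto_atTop_add_const_right _ _ tendsto_natCast_atTop_atTop)
      have h3 := intervalIntegral_tendsto_integral_Ioi 1 (gw_integrable (n := n) hl hz2 0) ht
      have h4 : Tendsto (fun k : ℕ => AI n l (Ioc 1 (((k:ℝ) + 1) ^ 2)) 0 (‖z‖ ^ 2)) atTop
          (𝓝 (AI n l (Ioi 1) 0 (‖z‖ ^ 2))) := by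
        refine h3.congr fun k => ?_
        rw [intervalIntegral.integral_of_le, AI]
        have : (0:ℝ) ≤ k := k.cast_nonneg
        nlinarith
      have h5 := h4.add_const (Hm n l 0 (‖z‖ ^ 2))
      unfold kS kk PhS phi
      simpa using h5
  exact le_of_tendsto' hlim hk

end

end

section
open Metric Set Filter MeasureTheory
open scoped RealInnerProductSpace Topology

noncomputable section

lemma pd_shift {n : ℕ} {i : Fin n} (f : EE n → ℝ) (y x : EE n) :
    pd i (fun x => f (x + y)) x = pd i f (x + y) := by
  unfold pd; rw [fderiv_comp_add_right]

lemma lap_shift {n : ℕ} (f : EE n → ℝ) (y x : EE n) :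
    lap (fun x => f (x + y)) x = lap f (x + y) := by
  simp only [lap_eq]
  refine Finset.sum_congr rfl fun i _ => ?_
  have : pd i (fun x => f (x + y)) = fun x => pd i f (x + y) := by ext x; exact pd_shift f y x
  rw [this, pd_shift]

lemma mu_zero {n : ℕ} (hn : 2 ≤ n) {l : ℝ} (hl : 0 ≤ l) {μ : Measure (EE n)} [IsFiniteMeasure μ]
    {K : Set (EE n)} (hK : IsCompact K) (hμK : ∀ᵐ y ∂μ, y ∈ K) (hw : ∀ x, ww l μ x = 0) : μ = 0 := by
  have hnF : Nonempty (Fin n) := ⟨⟨0, by omega⟩⟩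
  have hne : ∀ᵐ z : EE n, z ≠ 0 := by
    rw [ae_iff]; simp
  obtain ⟨R0, hR0⟩ := hK.isBounded.subset_closedBall (0 : EE n)
  obtain ⟨R, hR, hRK⟩ : ∃ R : ℝ, 0 < R ∧ ∀ y ∈ K, ‖y‖ ≤ R := by
    refine ⟨max R0 1, by positivity, fun y hy => ?_⟩
    have := hR0 hy
    rw [mem_closedBall_zero_iff] at this
    exact this.trans (le_max_left _ _)
  let b : ContDiffBump (0 : EE n) := ⟨R + 1, R + 2, by linarith, by linarith⟩
  set ψ : EE n → ℝ := fun x => b x with hψdef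
  have hψ : ContDiff ℝ 2 ψ := b.contDiff
  have hψs : HasCompactSupport ψ := b.hasCompactSupport
  have hL := Lop_cont (l := l) hψ
  have hLs := Lop_supp (l := l) hψs
  obtain ⟨C, hC⟩ := hLs.exists_bound_of_continuous hL
  have hC0 : 0 ≤ C := (norm_nonneg _).trans (hC 0)
  have hI : ∀ y ∈ K, ∫ x, kk l (x - y) * Lop l ψ x ≤ -4 * c0 n := by
    intro y hy
    have h1 := kk_pair hn hl (ψ := fun x => ψ (x + y)) (hψ.comp (contDiff_id.add contDiff_const))
      (hψs.comp_homeomorph (Homeomorph.addRight y)) (fun x => b.nonneg) ?_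
    · rw [← integral_add_right_eq_self (μ := (volume : Measure (EE n))) _ y]
      refine le_trans (le_of_eq ?_) h1
      refine integral_congr_ae (Eventually.of_forall fun x => ?_)
      simp only [add_sub_cancel_right, Lop, lap_shift]
    · intro x hx
      refine b.one_of_mem_closedBall ?_
      rw [mem_closedBall_zero_iff]
      rw [mem_ball_zero_iff] at hx
      have := norm_add_le x y
      have := hRK y hy
      change _ ≤ R + 1
      linarith
  obtain ⟨M, hM⟩ : ∃ M : ℝ, ∀ x, ∀ y ∈ K, |hh l (x - y)| * ‖Lop l ψ x‖ ≤ M * ‖Lop l ψ x‖ := by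
    have hc : Continuous fun p : EE n × EE n => hh l (p.1 - p.2) := (hh_continuous hn hl).comp (by fun_prop)
    obtain ⟨M, hM⟩ := (hLs.isCompact.prod hK).exists_bound_of_continuousOn hc.continuousOn
    refine ⟨M, fun x y hy => ?_⟩
    by_cases hx : x ∈ tsupport (Lop l ψ)
    · exact mul_le_mul_of_nonneg_right (hM (x, y) ⟨hx, hy⟩) (norm_nonneg _)
    · rw [image_eq_zero_of_notMem_tsupport hx]; simp
  have hItg : Integrable (fun p : EE n × EE n => kk l (p.1 - p.2) * Lop l ψ p.1)
      ((volume : Measure (EE n)).prod μ) := by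
    have h1 : Integrable (fun p : EE n × EE n => aa l (p.1 - p.2)) ((volume : Measure (EE n)).prod μ) :=
      (measurePreserving_sub_prod (volume : Measure (EE n)) μ).integrable_comp_of_integrable
        (g := fun p : EE n × EE n => aa l p.1) ((aa_integrable hn hl).comp_fst μ)
    have h2 : Integrable (fun p : EE n × EE n => M * ‖Lop l ψ p.1‖) ((volume : Measure (EE n)).prod μ) :=
      (((hL.integrable_of_hasCompactSupport hLs).norm.const_mul M).comp_fst μ)
    refine ((h1.mul_const C).add h2).mono' ?_ ?_
    · exact (((kk_measurable hn hl).comp (measurable_fst.sub measurable_snd)).mul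
        (hL.measurable.comp measurable_fst)).aestronglyMeasurable
    · have : ∀ᵐ p ∂((volume : Measure (EE n)).prod μ), p.2 ∈ K :=
        Measure.quasiMeasurePreserving_snd.ae hμK
      filter_upwards [this] with p hp
      have e := hM p.1 p.2 hp
      have e2 := mul_le_mul_of_nonneg_left (hC p.1) (aa_nonneg (l := l) (p.1 - p.2))
      rw [norm_mul, kk_eq, Real.norm_eq_abs]
      have e3 : |aa l (p.1 - p.2) + hh l (p.1 - p.2)| ≤ aa l (p.1 - p.2) + |hh l (p.1 - p.2)| := by
        refine (abs_add_le _ _).trans ?_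
        rw [abs_of_nonneg (aa_nonneg _)]
      have e4 := mul_le_mul_of_nonneg_right e3 (norm_nonneg (Lop l ψ p.1))
      simp only [Pi.add_apply]
      linarith
  have hsw := integral_integral_swap (f := fun x y => kk l (x - y) * Lop l ψ x) hItg
  have hz : ∫ x, ∫ y, kk l (x - y) * Lop l ψ x ∂μ = 0 := by
    have : ∀ x, ∫ y, kk l (x - y) * Lop l ψ x ∂μ = 0 := by
      intro x
      rw [integral_mul_const]
      have := hw x
      unfold ww at this
      rw [this, zero_mul]
    simp [this]
  rw [hz] at hsw
  have hle : ∫ y, (∫ x, kk l (x - y) * Lop l ψ x) ∂μ ≤ ∫ y, -4 * c0 n ∂μ := by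
    refine integral_mono_ae hItg.integral_prod_right (integrable_const _) ?_
    filter_upwards [hμK] with y hy
    exact hI y hy
  rw [← hsw, integral_const, smul_eq_mul] at hle
  have hc := c0_pos n
  have h0 : μ.real univ = 0 := by
    have : 0 ≤ μ.real univ := measureReal_nonneg
    nlinarith
  rwa [measureReal_eq_zero_iff, Measure.measure_univ_eq_zero] at h0

end

end

section
open Metric Set Filter MeasureTheory
open scoped RealInnerProductSpace Topology

noncomputable section

open CompactlySupported in
lemma riesz_exists {X : Type} [TopologicalSpace X] [T2Space X] [CompactSpace X] [MeasurableSpace X]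
    [BorelSpace X] (f : C(X, ℝ) →ₗ[ℝ] ℝ) (hf : ∀ g : C(X, ℝ), (∀ x, 0 ≤ g x) → 0 ≤ f g) :
    ∃ μ : Measure X, IsFiniteMeasure μ ∧ ∀ g : C(X, ℝ), ∫ x, g x ∂μ = f g := by
  let f' : C_c(X, ℝ) →ₗ[ℝ] ℝ :=
    { toFun := fun g => f (g : C(X, ℝ))
      map_add' := fun a b => by rw [← map_add]; rfl
      map_smul' := fun a b => by rw [RingHom.id_apply, ← map_smul]; rfl }
  let Λ : C_c(X, ℝ) →ₚ[ℝ] ℝ := PositiveLinearMap.mk₀ f' fun g hg => hf _ fun x => hg x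
  refine ⟨RealRMK.rieszMeasure Λ, inferInstance, fun g => ?_⟩
  exact RealRMK.integral_rieszMeasure Λ (CompactlySupportedContinuousMap.continuousMapEquiv g)

/-- Duality: either a linear class contains a positive function on `K`, or it is annihilated by a
nonzero finite measure on `K`. -/
lemma dual_alt {n : ℕ} {K : Set (EE n)} (hK : IsCompact K) (hKne : K.Nonempty)
    (P : (EE n → ℝ) → Prop) (hc : ∀ u, P u → Continuous u)
    (hadd : ∀ u v, P u → P v → P (fun x => u x + v x)) (hsmul : ∀ (c : ℝ) u, P u → P (fun x => c * u x))
    (h0 : P fun _ => 0) (hno : ¬ ∃ u, P u ∧ ∀ x ∈ K, 0 < u x) :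
    ∃ μ : Measure (EE n), IsFiniteMeasure μ ∧ (∀ᵐ y ∂μ, y ∈ K) ∧ μ ≠ 0 ∧
      ∀ u, P u → ∫ y, u y ∂μ = 0 := by
  have : CompactSpace K := isCompact_iff_compactSpace.1 hK
  have : Nonempty K := hKne.to_subtype
  let r : ∀ u, P u → C(K, ℝ) := fun u hu => ⟨fun x => u x, (hc u hu).comp continuous_subtype_val⟩
  let V : Submodule ℝ C(K, ℝ) :=
    { carrier := {g | ∃ u, ∃ hu : P u, r u hu = g}
      add_mem' := by
        rintro _ _ ⟨u, hu, rfl⟩ ⟨v, hv, rfl⟩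
        exact ⟨_, hadd u v hu hv, rfl⟩
      zero_mem' := ⟨_, h0, rfl⟩
      smul_mem' := by
        rintro c _ ⟨u, hu, rfl⟩
        exact ⟨_, hsmul c u hu, rfl⟩ }
  let s : Set C(K, ℝ) := {g | ∀ x, 0 < g x}
  have hsc : Convex ℝ s := by
    intro g hg h hh a b ha hb hab x
    have h1 := hg x
    have h2 := hh x
    change 0 < a * g x + b * h x
    rcases ha.eq_or_lt with rfl | ha
    · have : b = 1 := by linarith
      subst this; linarith
    · have := mul_nonneg hb h2.le
      have := mul_pos ha h1
      linarith
  have hso : IsOpen s := by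
    have := ContinuousMap.isOpen_setOfPred_mapsTo (X := K) (Y := ℝ) isCompact_univ (isOpen_Ioi (a := (0:ℝ)))
    have e : s = {f : C(K, ℝ) | MapsTo f univ (Ioi 0)} := by
      ext g; simp [s, MapsTo]
    rw [e]; exact this
  have hdis : Disjoint s (V : Set C(K, ℝ)) := by
    rw [Set.disjoint_left]
    rintro _ hg ⟨u, hu, rfl⟩
    exact hno ⟨u, hu, fun x hx => hg ⟨x, hx⟩⟩
  obtain ⟨f, a, hfs, hfV⟩ := geometric_hahn_banach_open hsc hso V.convex hdis
  have ha : a ≤ 0 := by simpa using hfV 0 V.zero_mem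
  have hV0 : ∀ g ∈ V, f g = 0 := by
    intro g hg
    by_contra hne
    have := hfV (((a - 1) / f g) • g) (V.smul_mem _ hg)
    rw [map_smul, smul_eq_mul, div_mul_cancel₀ _ hne] at this
    linarith
  have hpos : ∀ g : C(K, ℝ), (∀ x, 0 ≤ g x) → 0 ≤ -f g := by
    intro g hg
    have hε : ∀ ε : ℝ, 0 < ε → f g + ε * f 1 ≤ 0 := by
      intro ε hε
      have := hfs (g + ε • (1 : C(K, ℝ))) (fun x => by
        have := hg x
        simp only [ContinuousMap.add_apply, ContinuousMap.smul_apply, ContinuousMap.one_apply, smul_eq_mul]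
        linarith)
      rw [map_add, map_smul, smul_eq_mul] at this
      linarith
    have ht : Tendsto (fun ε : ℝ => f g + ε * f 1) (𝓝[>] 0) (𝓝 (f g + 0 * f 1)) := by
      apply Tendsto.mono_left _ nhdsWithin_le_nhds
      exact Continuous.tendsto (by fun_prop) 0
    have := le_of_tendsto ht (Filter.mem_of_superset self_mem_nhdsWithin fun ε h => hε ε h)
    linarith
  obtain ⟨ν, hν, hνf⟩ := riesz_exists (-(f : C(K, ℝ) →ₗ[ℝ] ℝ)) (by simpa using hpos)
  have hm : Measurable (Subtype.val : K → EE n) := measurable_subtype_coe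
  have hme : MeasurableEmbedding (Subtype.val : K → EE n) :=
    MeasurableEmbedding.subtype_coe hK.measurableSet
  refine ⟨ν.map Subtype.val, inferInstance, ?_, ?_, ?_⟩
  · exact hme.ae_map_iff.2 (Eventually.of_forall fun x => x.2)
  · intro hz
    rw [Measure.map_eq_zero_iff hm.aemeasurable] at hz
    have h1 := hνf 1
    rw [hz, integral_zero_measure] at h1
    have h2 := hfs 1 (fun x => by simp)
    simp at h1
    linarith
  · intro u hu
    rw [hme.integral_map]
    have h1 := hνf (r u hu)
    have h2 := hV0 (r u hu) ⟨u, hu, rfl⟩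
    refine Eq.trans h1 ?_
    simp [h2]

lemma main_aux {n : ℕ} (hn : 2 ≤ n) (D : Set (EE n)) (hDo : IsOpen D) (hDb : Bornology.IsBounded D)
    (hDc : IsConnected (closure D)ᶜ) (hdom : IsC1Domain D ∨ IsLipschitzDomain D)
    (lam : ℝ) (heig : NotDirichletEigenvalue lam D) :
    ∃ u₀ : EE n → ℝ, (ContDiff ℝ (⊤ : ℕ∞) u₀ ∧ ∀ x, lap u₀ x + lam ^ 2 * u₀ x = 0) ∧
      ∀ x ∈ frontier D, 0 < u₀ x := by
  have hl : 0 ≤ lam ^ 2 := sq_nonneg _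
  have hcd : ∀ u : EE n → ℝ, ContDiff ℝ (⊤ : ℕ∞) u → ContDiff ℝ 2 u := fun u h => contDiff_infty.1 h 2
  by_cases hKne : (frontier D).Nonempty
  swap
  · rw [not_nonempty_iff_eq_empty] at hKne
    refine ⟨fun _ => 0, ⟨contDiff_const, fun x => by rw [lap_zero]; simp⟩, ?_⟩
    rw [hKne]; simp
  have hK : IsCompact (frontier D) := 
    (Metric.isCompact_of_isClosed_isBounded isClosed_frontier
      (hDb.closure.subset frontier_subset_closure))
  by_contra hno
  obtain ⟨μ, hμf, hμK, hμ0, hμ⟩ := dual_alt hK hKne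
    (fun u => ContDiff ℝ (⊤ : ℕ∞) u ∧ ∀ x, lap u x + lam ^ 2 * u x = 0)
    (fun u hu => hu.1.continuous)
    (fun u v hu hv => ⟨hu.1.add hv.1, fun x => by
      rw [lap_add (hcd u hu.1) (hcd v hv.1)]
      linear_combination hu.2 x + hv.2 x⟩)
    (fun c u hu => ⟨contDiff_const.mul hu.1, fun x => by
      rw [lap_const_mul c (hcd u hu.1)]
      linear_combination c * hu.2 x⟩)
    ⟨contDiff_const, fun x => by rw [lap_zero]; simp⟩ hno
  have hext : ∀ x ∈ (closure D)ᶜ, ww (lam ^ 2) μ x = 0 := fun x hx =>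
    ww_uc hn hl hK hKne hμK (fun u h1 h2 => hμ u ⟨h1, h2⟩) hDc
      (Set.disjoint_left.2 fun x hx hx' => hx (frontier_subset_closure hx'))
      (by rw [compl_compl]; exact hDb.closure) hx
  have hbd : ∀ x0 ∈ frontier D, Integrable (fun y => aa (lam ^ 2) (x0 - y)) μ ∧ μ {x0} = 0 ∧
      ww (lam ^ 2) μ x0 = 0 := by
    intro x0 hx0
    obtain ⟨e, c, t0, hc, hc1, ht0, h⟩ := extCone_of hDo hdom x0 hx0
    have hpos : ∀ k : ℕ, 0 < t0 / (k + 2) := fun k => by positivity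
    have hlt : ∀ k : ℕ, t0 / (k + 2) < t0 := fun k =>
      div_lt_self ht0 (by have : (0:ℝ) ≤ k := k.cast_nonneg
                          linarith)
    refine bdry_point hn hl hK hμK hx0 (x := fun k : ℕ => x0 - (t0 / ((k:ℝ) + 2)) • e) ?_ ?_ ?_ hc hc1 ?_
    · have h1 : Tendsto (fun k : ℕ => t0 / ((k:ℝ) + 2)) atTop (𝓝 0) :=
        tendsto_const_nhds.div_atTop
          (tendsto_atTop_add_const_right _ _ tendsto_natCast_atTop_atTop)
      simpa using (tendsto_const_nhds (x := x0)).sub (h1.smul_const e)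
    · exact fun k hk => (h _ (hpos k) (hlt k)).1 (frontier_subset_closure hk)
    · exact fun k => hext _ (h _ (hpos k) (hlt k)).1
    · exact fun k => (h _ (hpos k) (hlt k)).2
  have hDK : D ⊆ (frontier D)ᶜ := fun x hx hx' => by
    rw [hDo.frontier_eq] at hx'
    exact hx'.2 hx
  have hItg : ∀ x ∈ D, ww (lam ^ 2) μ x = 0 := by
    by_contra hc
    push Not at hc
    refine heig ⟨ww (lam ^ 2) μ, hc, (ww_contDiffOn hn hl hK hμK).mono hDK, ?_, ?_⟩
    · intro x hx
      exact (ww_tendsto hn hl hK hμK (fun x h => (hbd x h).1) (fun x h => (hbd x h).2.1)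
        (fun x h => (hbd x h).2.2) hx).mono_left (nhdsWithin_mono _ hDK)
    · exact fun x hx => ww_helmholtz hn hl hK hμK (hDK hx)
  refine hμ0 (mu_zero hn hl hK hμK fun x => ?_)
  by_cases hx : x ∈ closure D
  · by_cases hxD : x ∈ D
    · exact hItg x hxD
    · refine (hbd x ?_).2.2
      rw [hDo.frontier_eq]; exact ⟨hx, hxD⟩
  · exact hext x hx

end

end

/-- Theorem 1.3 / Proposition 3.3: if `λ > 0` is not a Dirichlet eigenvalue
of `−Δ` in the bounded `C¹` (Lipschitz if `n = 2,3`) domain `D` with `ℝⁿ \ D̄` connected,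
then there is a real-valued entire solution of `Δu₀ + λ²u₀ = 0` which is strictly positive
on `∂D`. -/
theorem exists_positive_helmholtz_solution {n : ℕ} (hn : 2 ≤ n)
    (D : Set (EuclideanSpace ℝ (Fin n))) (hDo : IsOpen D) (hDb : Bornology.IsBounded D)
    (hDne : D.Nonempty) (hDc : IsConnected (closure D)ᶜ)
    (hdom : IsC1Domain D ∨ ((n = 2 ∨ n = 3) ∧ IsLipschitzDomain D))
    (lam : ℝ) (hlam : 0 < lam) (heig : NotDirichletEigenvalue lam D) :
    ∃ u₀ : EuclideanSpace ℝ (Fin n) → ℝ,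
      ContDiff ℝ (⊤ : ℕ∞) u₀ ∧
      (∀ x, lap u₀ x + lam ^ 2 * u₀ x = 0) ∧
      ∀ x ∈ frontier D, 0 < u₀ x := by
  obtain ⟨u, ⟨h1, h2⟩, h3⟩ := main_aux hn D hDo hDb hDc (hdom.imp id And.right) lam heig
  exact ⟨u, h1, h2, h3⟩
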